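/- arXiv:2103.01700 — 2 statements merged into one kernel-verified Lean document; each statement's English description precedes it below -/
import Mathlib

section
/- Let β₃ ∈ (1,2) be the (unique) root in (1,2) of x³ = x² + x + 1 (β₃ ≈ 1.839286755214161). For every β ∈ (√2, 2) with |β − β₃| ≥ 10^{-8}, for μ_β-a.e. x ∈ ℝ, liminf_{r→0⁺} log μ_β(B̄(x,r)) / log r ≥ 0.9804094. (Since dim(μ_{β₃}) ≈ 0.98040931953 < 0.9804094, this implies dim(μ_β) > dim(μ_{β₃}) for β ∈ (√2,2) outside (β₃ − 10^{-8}, β₃ + 10^{-8}).) -/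
open MeasureTheory Filter Topology

/-- `m` is the infinite product on `{0,1}^ℕ` of the uniform measure on two points:
every cylinder of length `n` has mass `2⁻ⁿ`. -/
def IsCoinMeasure (m : Measure (ℕ → Fin 2)) : Prop :=
  IsProbabilityMeasure m ∧
  ∀ (n : ℕ) (w : Fin n → Fin 2),
    m {x | ∀ j : Fin n, x j.1 = w j} = (2 : ENNReal)⁻¹ ^ n

/-- The coding map `π_β(ε) = (1 - 1/β) ∑_{n≥0} ε_n β^{-n}` of the Bernoulli convolution. -/
noncomputable def piBeta (β : ℝ) (x : ℕ → Fin 2) : ℝ :=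
  (1 - 1/β) * ∑' n : ℕ, ((x n : ℕ) : ℝ) / β ^ n

namespace BernoulliConv

open ProbabilityTheory

/-! ### Independence and the law of large numbers for blocks -/

/-- The uniform measure on `{0,1}`. -/
noncomputable def coin : Measure (Fin 2) := (2 : ENNReal)⁻¹ • Measure.count

lemma coin_singleton (a : Fin 2) : coin {a} = 2⁻¹ := by simp [coin]

instance : IsProbabilityMeasure coin := ⟨by
  simp [coin, Measure.count_apply, ENat.card_eq_coe_fintype_card]
  exact ENNReal.inv_mul_cancel (by simp) (by simp)⟩

lemma map_restrict_digits {m : Measure (ℕ → Fin 2)} (hm : IsCoinMeasure m) (n : ℕ) :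
    m.map (fun x (i : Fin n) => x i) = Measure.pi fun _ => coin := by
  refine Measure.ext_of_singleton fun w => ?_
  rw [Measure.map_apply (by fun_prop) (measurableSet_singleton _), Measure.pi_singleton]
  simp only [coin_singleton, Finset.prod_const, Finset.card_univ, Fintype.card_fin]
  rw [← hm.2 n w]
  congr 1
  ext x
  simp [funext_iff]

lemma eq_infinitePi {m : Measure (ℕ → Fin 2)} (hm : IsCoinMeasure m) :
    m = Measure.infinitePi fun _ => coin := by
  refine Measure.eq_infinitePi _ fun s t _ => ?_
  obtain ⟨n, hn⟩ := s.exists_nat_subset_range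
  classical
  have h : Set.pi (s : Set ℕ) t = (fun (x : ℕ → Fin 2) (i : Fin n) => x i) ⁻¹'
      Set.pi Set.univ fun i : Fin n => if (i : ℕ) ∈ s then t i else Set.univ := by
    ext x
    simp only [Set.mem_pi, Set.mem_preimage, Set.mem_univ, forall_true_left, Finset.mem_coe]
    constructor
    · intro h i
      split_ifs with hi
      · exact h _ hi
      · trivial
    · intro h i hi
      have := h ⟨i, Finset.mem_range.1 (hn hi)⟩
      simpa [hi] using this
  rw [h, ← Measure.map_apply (by fun_prop) (Set.toFinite _).measurableSet, map_restrict_digits hm,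
    Measure.pi_pi, Fin.prod_univ_eq_prod_range (fun i => coin (if i ∈ s then t i else Set.univ)) n,
    ← Finset.prod_subset hn]
  · exact Finset.prod_congr rfl fun i hi => by simp [hi]
  · intro i _ hi
    simp [hi]

/-- The average of a function on words of length `n`. -/
noncomputable def avg {n : ℕ} (f : (Fin n → Fin 2) → ℝ) : ℝ := (∑ w, f w) / 2 ^ n

lemma integral_pi_coin {n : ℕ} (f : (Fin n → Fin 2) → ℝ) :
    ∫ w, f w ∂(Measure.pi fun _ : Fin n => coin) = avg f := by
  rw [integral_fintype (.of_finite), avg, Finset.sum_div]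
  refine Finset.sum_congr rfl fun w _ => ?_
  rw [Measure.real, Measure.pi_singleton]
  simp [coin_singleton, div_eq_inv_mul]

variable {m : Measure (ℕ → Fin 2)}

lemma map_block (hm : IsCoinMeasure m) (L p : ℕ) :
    m.map (fun x (i : Fin L) => x (p + i)) = Measure.pi fun _ => coin := by
  have := hm.1
  rw [eq_infinitePi hm,
    Measure.map_infinitePi_infinitePi_of_inj (P := fun _ : ℕ => coin)
      (f := fun i : Fin L => p + (i : ℕ)) (fun i j h => Fin.ext (by simpa using h)),
    Measure.infinitePi_eq_pi]

lemma indepFun_block (hm : IsCoinMeasure m) {L p q : ℕ} (hpq : p + L ≤ q)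
    (g : (Fin L → Fin 2) → ℝ) :
    IndepFun (fun x : ℕ → Fin 2 => g fun i => x (p + i)) (fun x => g fun i => x (q + i)) m := by
  have hi : iIndepFun (fun (i : ℕ) (x : ℕ → Fin 2) => x i) m := by
    rw [eq_infinitePi hm]
    exact iIndepFun_infinitePi (P := fun _ : ℕ => coin) (X := fun _ x => x) fun _ => measurable_id
  have hd : Disjoint (Finset.Ico p (p + L)) (Finset.Ico q (q + L)) :=
    Finset.disjoint_left.2 fun i h h' => by simp at h h'; omega
  have := hi.indepFun_finset _ _ hd fun i => measurable_pi_apply i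
  exact this.comp (φ := fun u => g fun i => u ⟨p + i, by simp⟩)
    (ψ := fun u => g fun i => u ⟨q + i, by simp⟩) (Measurable.of_discrete) (Measurable.of_discrete)

lemma ae_tendsto_block (hm : IsCoinMeasure m) {L : ℕ} (r : ℕ) (g : (Fin L → Fin 2) → ℝ) :
    ∀ᵐ x ∂m, Tendsto (fun n : ℕ => (∑ j ∈ Finset.range n, g fun i => x (L * j + r + i)) / n)
      atTop (𝓝 (avg g)) := by
  have := hm.1
  have hid : ∀ p q : ℕ, IdentDistrib (fun x : ℕ → Fin 2 => g fun i => x (p + i))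
      (fun x => g fun i => x (q + i)) m m := fun p q =>
    IdentDistrib.comp (u := g) ⟨(by fun_prop : Measurable _).aemeasurable,
      (by fun_prop : Measurable _).aemeasurable, by rw [map_block hm, map_block hm]⟩
      Measurable.of_discrete
  have h_int : ∀ p : ℕ, ∫ x, g (fun i => x (p + i)) ∂m = avg g := fun p => by
    rw [← integral_pi_coin, ← map_block hm L p, integral_map (by fun_prop : Measurable _).aemeasurable
      Measurable.of_discrete.aestronglyMeasurable]
  have := strong_law_ae_real (μ := m) (fun j x => g fun i => x (L * j + r + i)) ?_ ?_ fun j => hid _ _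
  · simpa only [h_int] using this
  · have : Integrable g (m.map fun x (i : Fin L) => x (L * 0 + r + i)) := by
      rw [map_block hm]
      exact .of_finite
    exact this.comp_measurable (by fun_prop)
  · intro j k hjk
    rcases lt_or_gt_of_ne hjk with h | h
    · exact indepFun_block hm (by nlinarith [Nat.mul_le_mul_left L h]) g
    · exact (indepFun_block hm (by nlinarith [Nat.mul_le_mul_left L h]) g).symm

/-- Birkhoff sums along the shift, for functions of the first `L` digits. -/
lemma ae_tendsto_birkhoff (hm : IsCoinMeasure m) {L : ℕ} (g : (Fin L → Fin 2) → ℝ) :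
    ∀ᵐ x ∂m, Tendsto (fun n : ℕ => (∑ k ∈ Finset.range (L * n), g fun i => x (k + i)) / n)
      atTop (𝓝 (L * avg g)) := by
  have h : ∀ᵐ x ∂m, ∀ r : ℕ, Tendsto
      (fun n : ℕ => (∑ j ∈ Finset.range n, g fun i => x (L * j + r + i)) / n) atTop (𝓝 (avg g)) :=
    ae_all_iff.2 fun r => ae_tendsto_block hm r g
  filter_upwards [h] with x hx
  have := tendsto_finsetSum (Finset.range L) fun r _ => hx r
  simp only [Finset.sum_const, Finset.card_range, nsmul_eq_mul] at this
  refine this.congr fun n => ?_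
  rw [← Finset.sum_div, Finset.sum_comm]
  congr 1
  induction n with
  | zero => simp
  | succ n ih =>
    rw [Finset.sum_range_succ, ih, Nat.mul_succ, Finset.sum_range_add]

/-! ### The coding map -/

/-- The complementary digit. -/
def flip (a : Fin 2) : Fin 2 := 1 - a

variable {β : ℝ}

lemma summable_digits (hβ : 1 < β) (x : ℕ → Fin 2) :
    Summable fun n : ℕ => ((x n : ℕ) : ℝ) / β ^ n := by
  refine .of_nonneg_of_le (fun n => by positivity) (fun n => ?_)
    (summable_geometric_of_lt_one (inv_nonneg.2 (by linarith)) (inv_lt_one_of_one_lt₀ hβ))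
  have : ((x n : ℕ) : ℝ) ≤ 1 := by exact_mod_cast (by omega : (x n : ℕ) ≤ 1)
  rw [inv_pow, div_eq_mul_inv]
  exact mul_le_of_le_one_left (by positivity) this

lemma piBeta_shift (hβ : 1 < β) (x : ℕ → Fin 2) :
    β * piBeta β x = (x 0 : ℕ) * (β - 1) + piBeta β fun k => x (k + 1) := by
  have h0 : β ≠ 0 := by positivity
  rw [piBeta, (summable_digits hβ x).tsum_eq_zero_add, piBeta]
  simp only [pow_succ, ← div_div, tsum_div_const]
  field_simp

lemma tsum_inv_pow (hβ : 1 < β) : (1 - 1 / β) * ∑' n : ℕ, (1 : ℝ) / β ^ n = 1 := by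
  have h0 : β - 1 ≠ 0 := by linarith
  simp only [one_div, ← inv_pow]
  rw [tsum_geometric_of_lt_one (inv_nonneg.2 (by linarith)) (inv_lt_one_of_one_lt₀ hβ)]
  field_simp

lemma piBeta_flip (hβ : 1 < β) (x : ℕ → Fin 2) :
    piBeta β (fun k => flip (x k)) = 1 - piBeta β x := by
  have h : ∀ n, ((flip (x n) : ℕ) : ℝ) / β ^ n = 1 / β ^ n - ((x n : ℕ) : ℝ) / β ^ n := by
    intro n
    generalize x n = a
    fin_cases a <;> simp [flip]
  have hs : Summable fun n : ℕ => (1 : ℝ) / β ^ n := by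
    simpa using summable_digits hβ fun _ => 1
  rw [piBeta, piBeta, funext h, hs.tsum_sub (summable_digits hβ x), mul_sub, tsum_inv_pow hβ]

lemma piBeta_mem (hβ : 1 < β) (x : ℕ → Fin 2) : piBeta β x ∈ Set.Icc 0 1 := by
  have h : ∀ x, 0 ≤ piBeta β x := fun x =>
    mul_nonneg (by rw [sub_nonneg, div_le_one] <;> linarith) (tsum_nonneg fun n => by positivity)
  have := h fun k => flip (x k)
  rw [piBeta_flip hβ] at this
  exact ⟨h x, by linarith⟩

lemma continuous_piBeta (hβ : 1 < β) : Continuous (piBeta β) := by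
  refine continuous_const.mul (continuous_tsum (u := fun n => β⁻¹ ^ n) (fun n => ?_)
    (summable_geometric_of_lt_one (inv_nonneg.2 (by linarith)) (inv_lt_one_of_one_lt₀ hβ)) ?_)
  · have : Continuous fun a : Fin 2 => ((a : ℕ) : ℝ) := continuous_of_discreteTopology
    exact (this.comp (continuous_apply n)).div_const _
  · intro n x
    have : ((x n : ℕ) : ℝ) ≤ 1 := by exact_mod_cast (by omega : (x n : ℕ) ≤ 1)
    rw [inv_pow, div_eq_mul_inv, Real.norm_of_nonneg (by positivity)]
    exact mul_le_of_le_one_left (by positivity) this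

lemma abs_piBeta_sub_le (hβ : 1 < β) (N : ℕ) : ∀ x y : ℕ → Fin 2, (∀ k < N, x k = y k) →
    |piBeta β x - piBeta β y| ≤ (β ^ N)⁻¹ := by
  induction N with
  | zero =>
    intro x y _
    have := piBeta_mem hβ x
    have := piBeta_mem hβ y
    simp only [Set.mem_Icc, pow_zero, inv_one] at *
    rw [abs_le]
    constructor <;> linarith
  | succ N ih =>
    intro x y h
    have h1 := ih (fun k => x (k + 1)) (fun k => y (k + 1)) fun k hk => h _ (by omega)
    have h2 := piBeta_shift hβ x
    have h3 := piBeta_shift hβ y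
    have h0 : 0 < β := by linarith
    rw [h 0 (by omega)] at h2
    have : piBeta β x - piBeta β y
        = (piBeta β (fun k => x (k + 1)) - piBeta β fun k => y (k + 1)) / β := by
      field_simp
      linarith
    rw [this, abs_div, abs_of_pos h0, pow_succ, mul_inv, ← div_eq_mul_inv]
    gcongr

/-- Position of the tail of a point of the right branch, in the coordinate `s = β (x - 1/2)`. -/
noncomputable def pos (β : ℝ) (x : ℕ → Fin 2) : ℝ := piBeta β x - 1 + β / 2

lemma pos_tail (hβ : 1 < β) (x : ℕ → Fin 2) :
    (if x 0 = 1 then β * (piBeta β x - 1 / 2) else -(β * (piBeta β x - 1 / 2)))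
      = pos β fun k => if x 0 = 1 then x (k + 1) else flip (x (k + 1)) := by
  have h := piBeta_shift hβ x
  split_ifs with h0
  · rw [h0] at h
    simp only [pos]
    simp at h
    linarith
  · have h0 : x 0 = 0 := by omega
    rw [h0] at h
    simp only [pos, piBeta_flip hβ fun k => x (k + 1)]
    simp at h
    linarith

/-- `Φ`, as a cost of the digit of a point in the coordinate `pos`, is bounded on neighbourhoods of
codes by a function of finitely many digits, with average at most `H`. -/
def CostBound (β : ℝ) (Φ : ℝ → ℝ) (H : ℝ) : Prop :=
  ∃ r > 0, ∃ (n : ℕ) (C : (Fin n → Fin 2) → ℝ),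
    (∀ (x : ℕ → Fin 2) (t : ℝ), |t - pos β x| ≤ r → Φ t ≤ C fun i => x i) ∧ avg C ≤ H

/-- Probability of the digit `a` at the point `y`. -/
noncomputable def weight (β : ℝ) (Φ : ℝ → ℝ) (a : Fin 2) (y : ℝ) : ℝ :=
  Real.exp (-Φ (if a = 1 then β * (y - 1 / 2) else -(β * (y - 1 / 2))))

/-- Probability of a word at the point `y`. -/
noncomputable def wordWeight (β : ℝ) (Φ : ℝ → ℝ) : (N : ℕ) → ℝ → (Fin N → Fin 2) → ℝ
  | 0, _, _ => 1
  | N + 1, y, w => weight β Φ (w 0) y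
      * wordWeight β Φ N (β * y - ((w 0 : ℕ) : ℝ) * (β - 1)) fun i => w i.succ

variable {Φ : ℝ → ℝ}

lemma sum_cons {N : ℕ} (f : (Fin (N + 1) → Fin 2) → ℝ) :
    ∑ w, f w = ∑ w : Fin N → Fin 2, f (Fin.cons 0 w) + ∑ w : Fin N → Fin 2, f (Fin.cons 1 w) := by
  rw [← (Fin.consEquiv fun _ : Fin (N + 1) => Fin 2).sum_comp, Fintype.sum_prod_type,
    Fin.sum_univ_two]
  rfl

lemma wordWeight_pos (N : ℕ) : ∀ y w, 0 < wordWeight β Φ N y w := by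
  induction N with
  | zero => intro y w; simp [wordWeight]
  | succ N ih => intro y w; exact mul_pos (Real.exp_pos _) (ih _ _)

lemma sum_wordWeight_le (hΦ : ∀ s, Real.exp (-Φ s) + Real.exp (-Φ (-s)) ≤ 1) (N : ℕ) :
    ∀ y, ∑ w, wordWeight β Φ N y w ≤ 1 := by
  induction N with
  | zero => intro y; simp [wordWeight]
  | succ N ih =>
    intro y
    rw [sum_cons]
    simp only [wordWeight, Fin.cons_zero, Fin.cons_succ, ← Finset.mul_sum]
    have h := hΦ (β * (y - 1 / 2))
    have h0 := mul_le_of_le_one_right (Real.exp_pos (-Φ (-(β * (y - 1 / 2))))).le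
      (ih (β * y - (((0 : Fin 2) : ℕ) : ℝ) * (β - 1)))
    have h1 := mul_le_of_le_one_right (Real.exp_pos (-Φ (β * (y - 1 / 2)))).le
      (ih (β * y - (((1 : Fin 2) : ℕ) : ℝ) * (β - 1)))
    simp only [weight, if_true, zero_ne_one, if_false] at *
    linarith

/-- The bound for the cost of the first digit, in terms of `n + 1` digits. -/
noncomputable def digitCost {n : ℕ} (C : (Fin n → Fin 2) → ℝ) (w : Fin (n + 1) → Fin 2) : ℝ :=
  C fun i => if w 0 = 1 then w i.succ else flip (w i.succ)

lemma avg_digitCost {n : ℕ} (C : (Fin n → Fin 2) → ℝ) : avg (digitCost C) = avg C := by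
  have h : ∑ w : Fin n → Fin 2, C (fun i => flip (w i)) = ∑ w, C w :=
    (Equiv.arrowCongr (Equiv.refl (Fin n)) (Equiv.subLeft (1 : Fin 2))).sum_comp C
  rw [avg, avg, sum_cons]
  simp only [digitCost, Fin.cons_zero, Fin.cons_succ, if_true, zero_ne_one, if_false]
  rw [h, pow_succ]
  field_simp
  ring

lemma exp_le_wordWeight (hβ : 1 < β) {r : ℝ} (hr : 0 < r) {n : ℕ} {C : (Fin n → Fin 2) → ℝ}
    (hC : ∀ (x : ℕ → Fin 2) (t : ℝ), |t - pos β x| ≤ r → Φ t ≤ C fun i => x i) (N : ℕ) :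
    ∀ (y : ℝ) (x : ℕ → Fin 2), |y - piBeta β x| ≤ r * (β ^ N)⁻¹ →
      Real.exp (-∑ k ∈ Finset.range N, digitCost C fun i => x (k + i))
        ≤ wordWeight β Φ N y fun i => x i := by
  have h0 : 0 < β := by linarith
  induction N with
  | zero => intro y x _; simp [wordWeight]
  | succ N ih =>
    intro y x h
    rw [Finset.sum_range_succ', neg_add, Real.exp_add, mul_comm, wordWeight]
    have hs := piBeta_shift hβ x
    have hβy : |β * y - β * piBeta β x| ≤ r * (β ^ N)⁻¹ := by
      rw [← mul_sub, abs_mul, abs_of_pos h0]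
      calc β * |y - piBeta β x| ≤ β * (r * (β ^ (N + 1))⁻¹) := by gcongr
        _ = r * (β ^ N)⁻¹ := by
          rw [pow_succ]
          field_simp
    refine mul_le_mul ?_ ?_ (Real.exp_pos _).le (Real.exp_pos _).le
    · refine Real.exp_le_exp.2 (neg_le_neg ?_)
      have hle : r * (β ^ N)⁻¹ ≤ r :=
        mul_le_of_le_one_right hr.le (inv_le_one_of_one_le₀ (one_le_pow₀ hβ.le))
      have := hC (fun k => if x 0 = 1 then x (k + 1) else flip (x (k + 1)))
        (if x 0 = 1 then β * (y - 1 / 2) else -(β * (y - 1 / 2))) ?_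
      · simpa [digitCost] using this
      · rw [← pos_tail hβ]
        refine le_trans (le_of_eq ?_) (hβy.trans hle)
        split_ifs
        · congr 1; ring
        · rw [← abs_neg]; congr 1; ring
    · have := ih (β * y - ((x 0 : ℕ) : ℝ) * (β - 1)) (fun k => x (k + 1)) (by
        convert hβy using 2
        linarith)
      simp only [add_right_comm _ _ 1] at this ⊢
      exact this

/-- The codes of points in a small ball with a small Birkhoff sum have small measure. -/
lemma measure_codes_le (hm : IsCoinMeasure m) (hβ : 1 < β)
    (hΦ : ∀ s, Real.exp (-Φ s) + Real.exp (-Φ (-s)) ≤ 1)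
    {r : ℝ} (hr : 0 < r) {n : ℕ} {C : (Fin n → Fin 2) → ℝ}
    (hC : ∀ (x : ℕ → Fin 2) (t : ℝ), |t - pos β x| ≤ r → Φ t ≤ C fun i => x i)
    (N : ℕ) (y S : ℝ) :
    m {x | ∑ k ∈ Finset.range N, digitCost C (fun i => x (k + i)) ≤ S ∧
        |y - piBeta β x| ≤ r * (β ^ N)⁻¹}
      ≤ ENNReal.ofReal (Real.exp S / 2 ^ N) := by
  classical
  set W : Finset (Fin N → Fin 2) := {w | Real.exp (-S) ≤ wordWeight β Φ N y w} with hW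
  have hcard : (W.card : ℝ) ≤ Real.exp S := by
    have h1 : W.card • Real.exp (-S) ≤ ∑ w ∈ W, wordWeight β Φ N y w :=
      Finset.card_nsmul_le_sum _ _ _ fun w hw => (Finset.mem_filter.1 hw).2
    have h2 : ∑ w ∈ W, wordWeight β Φ N y w ≤ 1 :=
      (Finset.sum_le_univ_sum_of_nonneg fun w => (wordWeight_pos N y w).le).trans
        (sum_wordWeight_le hΦ N y)
    rw [nsmul_eq_mul, Real.exp_neg] at h1
    have := h1.trans h2
    rwa [← div_eq_mul_inv, div_le_one (Real.exp_pos _)] at this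
  calc _ ≤ m (⋃ w ∈ W, {x | ∀ j : Fin N, x j.1 = w j}) := by
        refine measure_mono fun x hx => ?_
        simp only [Set.mem_iUnion, Set.mem_ofPred_eq]
        refine ⟨fun i => x i, ?_, fun j => rfl⟩
        rw [hW, Finset.mem_filter]
        exact ⟨Finset.mem_univ _, (Real.exp_le_exp.2 (neg_le_neg hx.1)).trans
          (exp_le_wordWeight hβ hr hC N y x hx.2)⟩
    _ ≤ ∑ w ∈ W, m {x | ∀ j : Fin N, x j.1 = w j} := measure_biUnion_finset_le _ _
    _ = ENNReal.ofReal (W.card / 2 ^ N) := by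
        simp only [hm.2, Finset.sum_const, nsmul_eq_mul]
        rw [ENNReal.ofReal_div_of_pos (by positivity), ENNReal.ofReal_natCast,
          ENNReal.ofReal_pow (by norm_num), div_eq_mul_inv, ← ENNReal.inv_pow]
        simp
    _ ≤ _ := ENNReal.ofReal_le_ofReal (by gcongr)

/-- The Birkhoff sums of `C` up to `L j` are at most `L j H'`, for all `j ≥ M`. -/
def goodCodes {n : ℕ} (C : (Fin n → Fin 2) → ℝ) (H' : ℝ) (M : ℕ) : Set (ℕ → Fin 2) :=
  {x | ∀ j ≥ M, ∑ k ∈ Finset.range ((n + 1) * j), digitCost C (fun i => x (k + i))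
    ≤ ((n + 1) * j : ℕ) * H'}

lemma ae_mem_goodCodes (hm : IsCoinMeasure m) {n : ℕ} (C : (Fin n → Fin 2) → ℝ) {H' : ℝ}
    (h : avg C < H') : ∀ᵐ x ∂m, ∃ M, x ∈ goodCodes C H' M := by
  filter_upwards [ae_tendsto_birkhoff hm (digitCost C)] with x hx
  have h1 : ((n + 1 : ℕ) : ℝ) * avg (digitCost C) < (n + 1 : ℕ) * H' := by
    rw [avg_digitCost]
    exact mul_lt_mul_of_pos_left h (by positivity)
  obtain ⟨M, hM⟩ := eventually_atTop.1 (hx.eventually_lt_const h1)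
  refine ⟨M + 1, fun j hj => ?_⟩
  have hj0 : (0 : ℝ) < j := by exact_mod_cast (by omega : 0 < j)
  have := (div_lt_iff₀ hj0).1 (hM j (by omega))
  push_cast at this ⊢
  linarith

lemma map_goodCodes_le (hm : IsCoinMeasure m) (hβ : 1 < β)
    (hΦ : ∀ s, Real.exp (-Φ s) + Real.exp (-Φ (-s)) ≤ 1)
    {r : ℝ} (hr : 0 < r) {n : ℕ} {C : (Fin n → Fin 2) → ℝ}
    (hC : ∀ (x : ℕ → Fin 2) (t : ℝ), |t - pos β x| ≤ r → Φ t ≤ C fun i => x i)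
    {H' : ℝ} {M j : ℕ} (hj : M ≤ j) (y : ℝ) :
    (m.restrict (goodCodes C H' M)).map (piBeta β)
        (Metric.closedBall y (r * (β ^ ((n + 1) * j))⁻¹))
      ≤ ENNReal.ofReal (Real.exp (((n + 1) * j : ℕ) * (H' - Real.log 2))) := by
  have hmeas := (continuous_piBeta hβ).measurable
  rw [Measure.map_apply hmeas Metric.isClosed_closedBall.measurableSet,
    Measure.restrict_apply (hmeas Metric.isClosed_closedBall.measurableSet)]
  refine (measure_mono fun x hx => ?_).trans ((measure_codes_le hm hβ hΦ hr hC ((n + 1) * j) y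
    (((n + 1) * j : ℕ) * H')).trans (le_of_eq ?_))
  · refine ⟨hx.2 j hj, ?_⟩
    have := hx.1
    rwa [Set.mem_preimage, Metric.mem_closedBall, dist_comm, Real.dist_eq] at this
  · rw [mul_sub, Real.exp_sub, mul_comm _ (Real.log 2), ← Real.rpow_def_of_pos (by norm_num),
      Real.rpow_natCast]

lemma ae_mem_range (hβ : 1 < β) : ∀ᵐ x ∂(m.map (piBeta β)), x ∈ Set.range (piBeta β) := by
  exact (ae_map_iff (p := fun x => x ∈ Set.range (piBeta β))
    (continuous_piBeta hβ).measurable.aemeasurable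
    (isCompact_range (continuous_piBeta hβ)).isClosed.measurableSet).2 (.of_forall fun x => ⟨x, rfl⟩)

lemma le_measure_closedBall (hm : IsCoinMeasure m) (hβ : 1 < β) (N : ℕ) (x : ℕ → Fin 2) :
    2⁻¹ ^ N ≤ m.map (piBeta β) (Metric.closedBall (piBeta β x) (β ^ N)⁻¹) := by
  rw [Measure.map_apply (continuous_piBeta hβ).measurable
    Metric.isClosed_closedBall.measurableSet, ← hm.2 N fun i => x i]
  refine measure_mono fun y hy => ?_
  rw [Set.mem_preimage, Metric.mem_closedBall, Real.dist_eq]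
  exact abs_piBeta_sub_le hβ N y x fun k hk => hy ⟨k, hk⟩

lemma isCoboundedUnder_log (hm : IsCoinMeasure m) (hβ : 1 < β) (x : ℕ → Fin 2) :
    IsCoboundedUnder (· ≥ ·) (𝓝[>] (0 : ℝ)) fun r : ℝ =>
      Real.log ((m.map (piBeta β) (Metric.closedBall (piBeta β x) r)).toReal) / Real.log r := by
  have := hm.1
  have : IsProbabilityMeasure (m.map (piBeta β)) :=
    Measure.isProbabilityMeasure_map (continuous_piBeta hβ).measurable.aemeasurable
  refine IsCoboundedUnder.of_frequently_le (a := Real.log 2 / Real.log β) ?_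
  have ht : Tendsto (fun N : ℕ => (β ^ (N + 1))⁻¹) atTop (𝓝[>] (0 : ℝ)) := by
    refine tendsto_nhdsWithin_iff.2 ⟨?_, .of_forall fun N => by simp; positivity⟩
    exact ((tendsto_pow_atTop_atTop_of_one_lt hβ).comp (tendsto_add_atTop_nat 1)).inv_tendsto_atTop
  refine ht.frequently (Eventually.frequently (.of_forall fun N => ?_))
  have hl := Real.log_pos hβ
  have h := ENNReal.toReal_mono (measure_ne_top _ _) (le_measure_closedBall hm hβ (N + 1) x)
  rw [ENNReal.toReal_pow, ENNReal.toReal_inv, ENNReal.toReal_ofNat] at h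
  have h2 := Real.log_le_log (by positivity) h
  rw [inv_pow, Real.log_inv, Real.log_pow] at h2
  rw [Real.log_inv, Real.log_pow, div_le_iff_of_neg (by simp; positivity)]
  have : Real.log 2 / Real.log β * -(((N + 1 : ℕ) : ℝ) * Real.log β)
      = -(((N + 1 : ℕ) : ℝ) * Real.log 2) := by
    field_simp
  linarith

/-- A system of costs with a small average bounds the local dimension from below. -/
theorem le_liminf_of_costBound (hm : IsCoinMeasure m) (hβ : 1 < β)
    (hΦ : ∀ s, Real.exp (-Φ s) + Real.exp (-Φ (-s)) ≤ 1) {H D : ℝ} (hC : CostBound β Φ H)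
    (hD : 0 ≤ D) (hH : H < Real.log 2 - D * Real.log β) :
    ∀ᵐ x ∂(m.map (piBeta β)), D ≤ liminf (fun r : ℝ =>
      Real.log ((m.map (piBeta β) (Metric.closedBall x r)).toReal) / Real.log r) (𝓝[>] 0) := by
  have := hm.1
  have hmeas := (continuous_piBeta hβ).measurable
  obtain ⟨r, hr, n, C, hC, havg⟩ := hC
  obtain ⟨H', hH', hH''⟩ := exists_between hH
  set μ := m.map (piBeta β) with hμ
  have : IsProbabilityMeasure μ := Measure.isProbabilityMeasure_map hmeas.aemeasurable
  obtain ⟨ν, hν⟩ : ∃ ν : ℕ → Measure ℝ,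
      ∀ M, ν M = (m.restrict (goodCodes C H' M)).map (piBeta β) := ⟨_, fun M => rfl⟩
  have : ∀ M, IsFiniteMeasure (ν M) := fun M => by rw [hν]; infer_instance
  have hac : ∀ M, ν M ≪ μ := fun M => hν M ▸ (Measure.restrict_le_self.absolutelyContinuous).map hmeas
  have h1 : ∀ᵐ x ∂μ, ∀ M, Tendsto (fun ρ => ν M (Metric.closedBall x ρ)
      / μ (Metric.closedBall x ρ)) (𝓝[>] 0) (𝓝 ((ν M).rnDeriv μ x)) :=
    ae_all_iff.2 fun M => Besicovitch.ae_tendsto_rnDeriv _ _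
  have h2 : ∀ᵐ x ∂μ, ∃ M, (ν M).rnDeriv μ x ≠ 0 := by
    set Z : Set ℝ := {x | ∀ M, (ν M).rnDeriv μ x = 0} with hZ
    have hZm : MeasurableSet Z := by
      have : Z = ⋂ M, {x | (ν M).rnDeriv μ x = 0} := by ext x; simp [hZ]
      rw [this]
      exact .iInter fun M => Measure.measurable_rnDeriv _ _ (measurableSet_singleton 0)
    have hν0 : ∀ M, ν M Z = 0 := fun M => by
      rw [← Measure.setLIntegral_rnDeriv (hac M), setLIntegral_eq_zero_iff hZm
        (Measure.measurable_rnDeriv _ _)]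
      exact .of_forall fun x hx => hx M
    have hm0 : m (piBeta β ⁻¹' Z) = 0 := by
      have h3 : ∀ M, m (piBeta β ⁻¹' Z ∩ goodCodes C H' M) = 0 := fun M => by
        have := hν0 M
        rwa [hν, Measure.map_apply hmeas hZm, Measure.restrict_apply (hmeas hZm)] at this
      have h4 : ∀ᵐ x ∂m, ∀ M, x ∉ piBeta β ⁻¹' Z ∩ goodCodes C H' M :=
        ae_all_iff.2 fun M => measure_eq_zero_iff_ae_notMem.1 (h3 M)
      refine measure_eq_zero_iff_ae_notMem.2 ?_
      filter_upwards [h4, ae_mem_goodCodes hm C (havg.trans_lt hH')] with x hx ⟨M, hM⟩ hxZ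
      exact hx M ⟨hxZ, hM⟩
    rw [← Measure.map_apply hmeas hZm] at hm0
    filter_upwards [measure_eq_zero_iff_ae_notMem.1 hm0] with x hx
    simpa [hZ] using hx
  filter_upwards [h1, h2, ae_mem_range hβ] with x hx1 ⟨M, hM⟩ ⟨ε, hε⟩
  refine le_liminf_of_le (by rw [← hε]; exact isCoboundedUnder_log hm hβ ε) ?_
  obtain ⟨c, hc0, hc⟩ := ENNReal.lt_iff_exists_nnreal_btwn.1 (pos_iff_ne_zero.2 hM)
  have hc0 : (0 : ℝ) < c := by exact_mod_cast hc0
  have hlβ := Real.log_pos hβ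
  set L : ℝ := ((n + 1 : ℕ) : ℝ) with hL
  have hL0 : 0 < L := by positivity
  set A := Real.log 2 - H' with hA
  have hA0 : D * Real.log β < A := by linarith
  have hApos : 0 < A := lt_of_le_of_lt (by positivity) hA0
  have hlog : Tendsto Real.log (𝓝[>] 0) atBot := Real.tendsto_log_nhdsGT_zero
  have e1 : ∀ᶠ ρ in 𝓝[>] (0 : ℝ), Real.log ρ < Real.log r - (M + 1) * (L * Real.log β) :=
    hlog.eventually_lt_atBot _
  have e2 : ∀ᶠ ρ in 𝓝[>] (0 : ℝ), Real.log ρ * (A / Real.log β - D)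
      ≤ Real.log c + A * Real.log r / Real.log β - A * L :=
    (hlog.atBot_mul_const (sub_pos.2 ((lt_div_iff₀ hlβ).2 hA0))).eventually_le_atBot _
  have e3 : ∀ᶠ ρ in 𝓝[>] (0 : ℝ), Real.log ρ < 0 := hlog.eventually_lt_atBot _
  filter_upwards [e1, e2, e3, (hx1 M).eventually_const_lt hc, self_mem_nhdsWithin]
    with ρ h1 h2 h3 h4 hρ
  have hρ : 0 < ρ := hρ
  set q := (Real.log r - Real.log ρ) / (L * Real.log β) with hq
  have hqM : (M : ℝ) + 1 ≤ q := by
    rw [hq, le_div_iff₀ (by positivity)]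
    linarith
  set j := ⌊q⌋₊ with hj
  have hjq : (j : ℝ) ≤ q := Nat.floor_le (by linarith [Nat.cast_nonneg (α := ℝ) M])
  have hqj : q < j + 1 := Nat.lt_floor_add_one q
  have hMj : M ≤ j := Nat.le_floor (by linarith)
  have hρr : ρ ≤ r * (β ^ ((n + 1) * j))⁻¹ := by
    rw [← Real.log_le_log_iff hρ (by positivity), Real.log_mul hr.ne' (by positivity),
      Real.log_inv, Real.log_pow]
    rw [hq, le_div_iff₀ (by positivity)] at hjq
    push_cast
    rw [hL] at hjq
    push_cast at hjq
    linarith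
  have hνle : ν M (Metric.closedBall x ρ)
      ≤ ENNReal.ofReal (Real.exp (((n + 1) * j : ℕ) * (H' - Real.log 2))) := by
    rw [hν]
    exact (measure_mono (Metric.closedBall_subset_closedBall hρr)).trans
      (map_goodCodes_le hm hβ hΦ hr hC hMj x)
  have hμ0 : μ (Metric.closedBall x ρ) ≠ 0 := fun h => by
    rw [hac M h, h] at h4
    simp at h4
  have hμpos : 0 < (μ (Metric.closedBall x ρ)).toReal :=
    ENNReal.toReal_pos hμ0 (measure_ne_top _ _)
  have h5 : c * (μ (Metric.closedBall x ρ)).toReal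
      ≤ Real.exp (((n + 1) * j : ℕ) * (H' - Real.log 2)) := by
    rw [ENNReal.lt_div_iff_mul_lt (.inl hμ0) (.inl (measure_ne_top _ _))] at h4
    have := ENNReal.toReal_mono ENNReal.ofReal_ne_top (h4.le.trans hνle)
    rwa [ENNReal.toReal_mul, ENNReal.coe_toReal, ENNReal.toReal_ofReal (Real.exp_pos _).le] at this
  have h6 := Real.log_le_log (by positivity) h5
  rw [Real.log_exp, Real.log_mul hc0.ne' hμpos.ne'] at h6
  rw [le_div_iff_of_neg h3]
  have h7 : ((n + 1) * j : ℕ) * (H' - Real.log 2) = -(A * (L * j)) := by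
    rw [hA, hL]
    push_cast
    ring
  have h8 : A * ((Real.log r - Real.log ρ) / Real.log β - L) ≤ A * (L * j) := by
    refine mul_le_mul_of_nonneg_left ?_ hApos.le
    have : L * q = (Real.log r - Real.log ρ) / Real.log β := by
      rw [hq]
      field_simp
    nlinarith
  have h9 : A * ((Real.log r - Real.log ρ) / Real.log β - L) = A * Real.log r / Real.log β
      - Real.log ρ * (A / Real.log β) - A * L := by ring
  rw [h7] at h6
  rw [mul_sub] at h2
  linarith

end BernoulliConv

namespace BernoulliConv

/-- Packed table with 32-bit entries `⌈2²² log (1 + 2 ^ (-l / 8))⌉`, `l ≤ 160`. -/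
def tableA : Nat := 938745361340047499144302272153230746105489258578893418254951531433443823374267110881059188081744984925888371648422020780388275235019705025060509756402776719389801681312906825836819274786096093782330781320239477111142703308546084193364713942781700262166437941178459284155838961044736936553897993023245598653526666314093712105268264433979610317404373655979211567666123343679080610324681536516450097460679298344791129417573995068648733290847844559634121665699144594511336901410050095522053310104157443957910057866696501385942253431583609327045868022892799790891945537573057066836573401795261009704025317575139779265690467613106123403112012896316379567613408511522043110133430869932385498482722844280107611270111329861459010032992008612883575492374698508596087914760078249061638543298062690023150460941873071562801991389467666965115563494768667521408737480399481573906641348443477415494408880403942822507552310756930655731678973804078659141234682684402415852165161332096191177213081700681633515895818041709056519219641606848983725160092245362789874921563101885808809887936495102135987348435556754679030365813328504759313555107531349793090686943599435122853219135641267263286069129411406386481269342095957839718560259256783901973016529046583299209598608458165897911192168102074543665860941448339835518533451406465222322990144230508833670767413109426729796749426025234626805361198940831176767746957970027273762777909155232706366479676963356012658595560827292586634631875922957011604107200237501275826114983188831269467874909550625033082018015763590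

/-- Packed table with 32-bit entries `⌈2²² log (1 + 2 ^ (l / 8))⌉`, `l ≤ 160`. -/
def tableB : Nat := 10916745657632722721523495223354442015688124496936139215131185100489939678672803068898921693626487976217201204378474711673809411302702826095826613914997011457530900118319571771679915057229334909826406687223528808451540535755150317025954911790066383059039619727164105370384260329592838018733995407403859461407130385660148132526564685393991750850813180399987625612656692455803490357637728197338651319558865058447863789017352271396752037897981742892073874712676123430518036160797434138703409550463706994262853414400146176596884815475660662691541816665298912837205584537197064190463772183756752922311937989563657904082538140189632232780986783155856765924232952955416535372697282098913248691873703238862107300220775767823971433300061540089544028863483584346940147982521908823519444463022825107814827166235261038253189091763206954058451327196110340652084982059735858727316560254932007112691825125781018919146731790869953202685145166222825202416080522119134393492198954530009407289356221350538315312403152527568216622222867945849445013116874348315948313720610000209248114507092619811047738427923724668358131338596387670274883167745119177391043090945091448478940822853056437323113738717639383496492506715054094272603900974048178794164930975702123022274289796299639331983754655371073633170227565276595101912185286306589016879198666247982232576873100822796638591351036165897304023233308487316720421397229990154097261532629312722042168340115619526850074668208718674588967571197709814069406504646185673066174857818458253959370715449754173961242623441439707389062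

/-- `force x f` is `f x`, arranged so that the kernel evaluates `x` to a literal first. -/
def force {α : Type} (x : Nat) (f : Nat → α) : α :=
  Nat.rec (motive := fun _ => α) (f 0) (fun k _ => f k) (Nat.succ x)

/-- Lower and upper bounds, in units `2⁻ᵉ`, for the steps `(β - 1) β ^ (-(k + 1))`. -/
def digs (B0 B1 sh : Nat) : Nat → Nat → Nat → List (Nat × Nat)
  | 0, _, _ => []
  | n+1, x, y =>
    force (x * 1099511627776 / B1) fun x' =>
    force (y * 1099511627776 / B0 + 1) fun y' =>
    force (x' >>> sh) fun p => force ((y' >>> sh) + 1) fun q =>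
    (p, q) :: digs B0 B1 sh n x' y'

/-- Upper bounds for `2⁶⁰ β⁻ⁿ`. -/
def tailZ (B0 : Nat) : Nat → Nat → Nat
  | 0, z => z
  | n+1, z => tailZ B0 n (z * 1099511627776 / B0 + 1)

/-- Total uncertainty of the steps that are smaller than `K`. -/
def spread (K : Nat) : List (Nat × Nat) → Nat
  | [] => 0
  | p :: l => bif Nat.blt p.1 K then p.2 - p.1 + spread K l else spread K l

def massStep (FR : Nat) : List (Nat × Nat) → Nat → Nat
  | [], M => M
  | p :: l, M => massStep FR l (M + M <<< (40 * ((p.1*4 + FR/2) / FR)))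

def smooth : List Nat → Nat → Nat
  | [], M => M
  | p :: l, M => smooth l (M + M <<< (40 * p))

/-- Push `n` samples of `M`, from the bottom, onto `acc`. -/
noncomputable def sampleDown (n : Nat) : Nat → List Nat → List Nat :=
  Nat.rec (motive := fun _ => Nat → List Nat → List Nat) (fun _ acc => acc)
    (fun _ ih M acc => force (Nat.shiftRight M 160) fun M' =>
      force (Nat.land M 1099511627775) fun v => ih M' (v :: acc)) n

noncomputable def sampleDownBig (q : Nat) : Nat → List Nat → List Nat :=
  Nat.rec (motive := fun _ => Nat → List Nat → List Nat) (fun _ acc => acc)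
    (fun _ ih M acc => force (Nat.shiftRight M 5120) fun M' =>
      force (Nat.mod M (Nat.pow 2 5120)) fun v => ih M' (sampleDown 32 v acc)) q

/-- Put `n` samples of `M`, from the bottom, in front of `acc`. -/
noncomputable def sampleUp (n : Nat) : Nat → List Nat → List Nat :=
  Nat.rec (motive := fun _ => Nat → List Nat → List Nat) (fun _ acc => acc)
    (fun _ ih M acc => force (Nat.shiftRight M 160) fun M' =>
      force (Nat.land M 1099511627775) fun v => v :: ih M' acc) n

noncomputable def sampleUpBig (q : Nat) : Nat → List Nat :=
  Nat.rec (motive := fun _ => Nat → List Nat) (fun _ => [])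
    (fun _ ih M => force (Nat.shiftRight M 5120) fun M' =>
      force (Nat.mod M (Nat.pow 2 5120)) fun v => sampleUp 32 v (ih M')) q

/-- The level `⌊8 log₂ (a / b) + 1/2⌋`, at most `160`. -/
def level (a b : Nat) : Nat :=
  Nat.sub (Nat.log2 (Nat.div (Nat.mul (Nat.pow a 8) 362) (Nat.pow b 8))) 8

def entry (t l : Nat) : Nat := Nat.land (Nat.shiftRight t (Nat.mul 32 l)) 4294967295

noncomputable def withLevel {α : Type} (l : Nat) (k : Nat → α) : α :=
  Bool.rec (k 160) (force l k) (Nat.ble l 160)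

/-- Pass the pair of costs of a cell, given the masses `a` of the cell and `b` of its mirror. -/
noncomputable def withPair {α : Type} (a b : Nat) (k : Nat → Nat → α) : α :=
  Bool.rec
   (Bool.rec
     (withLevel (level a (Nat.succ b)) fun l =>
        force (entry tableA l) fun x => force (entry tableB l) fun y => k x y)
     (withLevel (level b (Nat.succ a)) fun l =>
        force (entry tableB l) fun x => force (entry tableA l) fun y => k x y)
     (Nat.ble a b))
   (k 2907270 2907270)
   (Nat.beq a b)

/-- The costs of the cells `0, …, n - 1` paired with those of their mirror images; the first `jz`
pairs are symmetric. -/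
noncomputable def pairs (n : Nat) : Nat → List Nat → List Nat → List (Nat × Nat) :=
  Nat.rec (motive := fun _ => Nat → List Nat → List Nat → List (Nat × Nat)) (fun _ _ _ => [])
    (fun _ ih jz la lb =>
      Nat.rec
        (withPair (la.headD 0) (lb.headD 0) fun x y => (x, y) :: ih 0 la.tail lb.tail)
        (fun jz' _ => (2907270, 2907270) :: ih jz' la.tail lb.tail) jz) n

/-- Arrange the pairs as the list of costs of all cells, from left to right. -/
def unfoldPairs : List (Nat × Nat) → List Nat → List Nat → List Nat
  | [], L, R => L ++ R.reverse
  | p :: l, L, R => unfoldPairs l ((p.2 - 1) :: L) ((p.1 - 1) :: R)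

/-- Maxima of consecutive entries (followed by `0`). -/
def maxima : List Nat → List Nat
  | [] => []
  | [a] => [a]
  | a :: b :: l => (bif Nat.ble a b then b else a) :: maxima (b :: l)

def merge (w : Nat) : List Nat → List Nat
  | [] => []
  | [a] => [a]
  | a :: b :: l => (a + b <<< w) :: merge w l

/-- Merge groups of `2 ^ s` consecutive entries. -/
def mergeTimes : Nat → Nat → List Nat → List Nat
  | 0, _, l => l
  | s+1, w, l => mergeTimes s (2*w) (merge w l)

def dropBlocks (q : Nat) : List Nat → List Nat :=
  Nat.rec (motive := fun _ => List Nat → List Nat) (fun l => l)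
    (fun _ ih l => List.casesOn l [] fun _ l' => ih l') q

def addBlocks (l : List Nat) : List Nat → List Nat :=
  List.rec (motive := fun _ => List Nat → List Nat) (fun _ => [])
    (fun a _ ih m => force (a + m.headD 0) fun v => v :: ih m.tail) l

def shiftBlocks (s mask c : Nat) (l : List Nat) : List Nat :=
  List.rec (motive := fun _ => List Nat) []
    (fun a l ih => force (a >>> s + Nat.land (l.headD 0) mask <<< c) fun v => v :: ih) l

def fineBlocks (r r' : Nat) (l : List Nat) : List Nat → List Nat :=
  List.rec (motive := fun _ => List Nat → List Nat) (fun _ => [])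
    (fun a _ ih m => force (a * r + m.headD 0 * r') fun v => v :: ih m.tail) l

/-- Drop `p` digits of the number represented by the blocks, `R` digits in base `2⁵⁶` each. -/
def shiftDigits (R p : Nat) (l : List Nat) : List Nat :=
  force (p / R) fun q => force (56 * (p % R)) fun s => force (1 <<< s - 1) fun mask =>
  force (56 * R - s) fun c => shiftBlocks s mask c (dropBlocks q l)

/-- Sum of the digits whose positions are the sums of the sublists of the list. -/
def digitSum (R : Nat) : List (Nat × Nat) → List Nat → Nat
  | [], F => F.headD 0 % 72057594037927936
  | p :: l, F => digitSum R l (addBlocks F (shiftDigits R p.1 F))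

def rep (m : Nat) : Nat := ((1 <<< (56*m)) - 1) / 72057594037927935

/-- One more than the sum of the costs (minus one) of all words of length `n`, for `β` in the window
`[B0, B1] / 2⁴⁰`; zero if the parameters do not fit. -/
def windowSum (A M : List Nat) (e FR n J B0 B1 : Nat) : Nat :=
  force (60 - e) fun sh =>
  force (((2199023255552 - B0) <<< e) / 2199023255552 + 2) fun m0 =>
  force (((2199023255552 - B1) <<< e) / 2199023255552) fun m1 =>
  let ds := digs B0 B1 sh n ((B0 - 1099511627776) <<< 20) ((B1 - 1099511627776) <<< 20)
  force (m0 - m1 + spread (2*J*FR) ds + (tailZ B0 n 1152921504606846976 >>> sh) + 3) fun E =>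
  bif Nat.ble E FR && Nat.ble m0 (J*FR) then
    force (rep (FR - E + 1)) fun r => force (rep (E-1) <<< (56*(FR-E+1))) fun r' =>
    force (FR * 16) fun R =>
    digitSum R ds (shiftDigits R (J*FR - m0) (fineBlocks r r' A M)) + 1
  else 0

/-- All windows `[B0, B0 + w], [B0 + w, B0 + 2 w], …` satisfy the cost bound. -/
def windowsOk (A M : List Nat) (e FR n J w Bs lb G : Nat) : Nat → Nat → Bool
  | 0, _ => true
  | k+1, B0 =>
    force (B0 + w) fun B1 =>
    force (windowSum A M e FR n J B0 B1) fun f =>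
    Nat.blt 0 f && Nat.blt ((f / 2^n + 2) * 10^10 * Bs + 9804094000 * (lb * Bs + 4194304 * (B1 - Bs)))
      ((6931471803 * 4194304 + G) * Bs) && windowsOk A M e FR n J w Bs lb G k B1

/-- The costs of all cells, tuned to the parameter `Bc / 2⁴⁰`. -/
noncomputable def cells (Bc e FR n J jz : Nat) : List Nat :=
  force (60 - e) fun sh =>
  force (((2199023255552 - Bc) <<< e) / 2199023255552) fun m0 =>
  force ((tailZ Bc n 1152921504606846976 >>> sh) / 2) fun E =>
  force (smooth [1,2,4,8,16,1,2,4,8,16] (massStep FR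
    (digs Bc Bc sh n ((Bc - 1099511627776) <<< 20) ((Bc - 1099511627776) <<< 20))
    (1 <<< (40 * (((J*FR - m0 + E)*4)/FR)))) >>> (33*40)) fun M =>
  force ((J + 31) / 32) fun q =>
  let ls := sampleDownBig q (M <<< (160*(32*q - J))) []
  unfoldPairs (pairs J jz (sampleUpBig q (M >>> (160*J))) ls) [] []

/-- Lower bound for `2⁸⁰ (s + ∑_{i ≥ j} zⁱ / i!)`, `z = x / 2²⁶`, given a lower bound `t` for the
term of index `j`; `k` terms are used. -/
def expSum (x : Nat) : Nat → Nat → Nat → Nat → Nat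
  | 0, _, _, s => s
  | k+1, j, t, s => expSum x k (j+1) (t * x / (67108864 * (j + 1))) (s + t)

/-- A lower bound for `2⁸⁰ exp (x / 2²⁶)`. -/
def expLower (x : Nat) : Nat := expSum x 24 0 1208925819614629174706176 0

/-- Conditions on the parameters; `2²² log (Bs / 2⁴⁰) ≤ lb` is certified by `expLower`. -/
def paramsOk (e FR n J jz Bs lb B0 : Nat) : Bool :=
  Nat.ble e 60 && Nat.blt 0 FR && Nat.ble n 28 && Nat.ble jz J && Nat.blt 0 Bs && Nat.ble Bs B0 &&
  Nat.blt 1099511627776 B0 && Nat.ble (Bs * 2 ^ 1280) (1099511627776 * expLower lb ^ 16)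

noncomputable def groupOk (Bc e FR n J jz w Bs lb G k B0 : Nat) : Bool :=
  paramsOk e FR n J jz Bs lb B0 &&
  windowsOk (mergeTimes 4 (56*FR) (cells Bc e FR n J jz))
    (mergeTimes 4 (56*FR) (maxima (cells Bc e FR n J jz))) e FR n J w Bs lb G k B0

/-! ### Correctness of the tables -/

lemma force_eq {α : Type} (x : Nat) (f : Nat → α) : force x f = f x := by cases x <;> rfl

lemma expSum_le (x k : ℕ) : ∀ j t s : ℕ, (t : ℝ) ≤ 2 ^ 80 * ((x / 2 ^ 26 : ℝ) ^ j / j.factorial) →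
    (s : ℝ) ≤ 2 ^ 80 * ∑ i ∈ Finset.range j, (x / 2 ^ 26 : ℝ) ^ i / i.factorial →
    (expSum x k j t s : ℝ) ≤ 2 ^ 80 * Real.exp (x / 2 ^ 26) := by
  induction k with
  | zero =>
    intro j t s _ hs
    exact hs.trans (mul_le_mul_of_nonneg_left (Real.sum_le_exp_of_nonneg (by positivity) _)
      (by positivity))
  | succ k ih =>
    intro j t s ht hs
    refine ih _ _ _ ?_ ?_
    · refine Nat.cast_div_le.trans ?_
      push_cast
      rw [div_le_iff₀ (by positivity), Nat.factorial_succ]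
      have := mul_le_mul_of_nonneg_right ht (Nat.cast_nonneg (α := ℝ) x)
      refine this.trans (le_of_eq ?_)
      push_cast
      field_simp
      ring
    · rw [Finset.sum_range_succ, mul_add]
      push_cast
      linarith

lemma expLower_pow_le (x : ℕ) : (expLower x : ℝ) ^ 16 ≤ 2 ^ 1280 * Real.exp (x / 2 ^ 22) := by
  have h := expSum_le x 24 0 1208925819614629174706176 0 (by norm_num) (by simp)
  calc (expLower x : ℝ) ^ 16 ≤ (2 ^ 80 * Real.exp (x / 2 ^ 26)) ^ 16 := by
        gcongr
        exact h
    _ = 2 ^ 1280 * Real.exp (x / 2 ^ 22) := by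
        rw [mul_pow, ← Real.exp_nat_mul, ← pow_mul]
        norm_num
        ring_nf

/-- A pair of costs with total mass at most one. -/
def Valid (p : ℕ × ℕ) : Prop :=
  Real.exp (-(p.1 / 2 ^ 22 : ℝ)) + Real.exp (-(p.2 / 2 ^ 22 : ℝ)) ≤ 1

lemma exp_neg_le (x q : ℕ) (h : 2 ^ 1280 * 2 ^ 60 ≤ q * expLower x ^ 16) :
    Real.exp (-(x / 2 ^ 22 : ℝ)) ≤ q / 2 ^ 60 := by
  have h1 := expLower_pow_le x
  have h2 : (2 : ℝ) ^ 1280 * 2 ^ 60 ≤ q * (expLower x : ℝ) ^ 16 := by exact_mod_cast h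
  have h3 : (2 : ℝ) ^ 1280 * 2 ^ 60 ≤ 2 ^ 1280 * (q * Real.exp (x / 2 ^ 22)) := by
    refine h2.trans ?_
    rw [mul_left_comm]
    gcongr
  have h4 := le_of_mul_le_mul_left h3 (by positivity)
  rwa [Real.exp_neg, ← one_div, div_le_div_iff₀ (Real.exp_pos _) (by positivity), one_mul]

/-- A certificate for `Valid`. -/
def validCheck (x y : Nat) : Bool :=
  let q := 2 ^ 1340 / expLower x ^ 16 + 1
  Nat.ble (2 ^ 1340) ((2 ^ 60 - q) * expLower y ^ 16) && Nat.ble 1 (expLower x)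

set_option exponentiation.threshold 2000 in
lemma valid_of_validCheck {x y : ℕ} (h : validCheck x y = true) : Valid (x, y) := by
  simp only [validCheck, Bool.and_eq_true, Nat.ble_eq] at h
  obtain ⟨h1, h2⟩ := h
  set q := 2 ^ 1340 / expLower x ^ 16 + 1 with hq
  have hx : Real.exp (-(x / 2 ^ 22 : ℝ)) ≤ q / 2 ^ 60 := by
    refine exp_neg_le x q ?_
    rw [← pow_add, hq]
    exact (Nat.lt_div_mul_add (pow_pos h2 16)).le.trans (by rw [add_mul, one_mul])
  have hy := exp_neg_le y (2 ^ 60 - q) (by rw [← pow_add]; exact h1)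
  have hq1 : q ≤ 2 ^ 60 := by
    by_contra hlt
    rw [Nat.sub_eq_zero_of_le (by omega), zero_mul] at h1
    exact absurd h1 (by norm_num)
  rw [Nat.cast_sub hq1] at hy
  unfold Valid
  push_cast at hy
  have : (q : ℝ) / 2 ^ 60 + (2 ^ 60 - q) / 2 ^ 60 = 1 := by field_simp; ring
  linarith

def tableCheck : Nat → Bool
  | 0 => true
  | k+1 => validCheck (entry tableA k) (entry tableB k) && Nat.blt (entry tableA k) (2 ^ 27) &&
    Nat.blt (entry tableB k) (2 ^ 27) && Nat.blt 0 (entry tableA k) && Nat.blt 0 (entry tableB k)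
    && tableCheck k

set_option maxRecDepth 100000 in
lemma tableCheck_eq_true : tableCheck 161 = true := by decide +kernel

/-- The properties of the pairs of costs that are used. -/
def Good (p : ℕ × ℕ) : Prop := Valid p ∧ 0 < p.1 ∧ 0 < p.2 ∧ p.1 < 2 ^ 27 ∧ p.2 < 2 ^ 27

lemma Valid.swap {x y : ℕ} (h : Valid (x, y)) : Valid (y, x) := by
  unfold Valid at *
  linarith

lemma Good.swap {x y : ℕ} (h : Good (x, y)) : Good (y, x) :=
  ⟨h.1.swap, h.2.2.1, h.2.1, h.2.2.2.2, h.2.2.2.1⟩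

lemma good_of_tableCheck {k : ℕ} (h : tableCheck k = true) :
    ∀ l < k, Good (entry tableA l, entry tableB l) := by
  induction k with
  | zero => intro l hl; omega
  | succ k ih =>
    simp only [tableCheck, Bool.and_eq_true, Nat.blt_eq] at h
    intro l hl
    rcases Nat.lt_succ_iff_lt_or_eq.1 hl with h' | rfl
    · exact ih h.2 l h'
    · exact ⟨valid_of_validCheck h.1.1.1.1.1, h.1.1.2, h.1.2, h.1.1.1.1.2, h.1.1.1.2⟩

lemma good_symm : Good (2907270, 2907270) :=
  ⟨valid_of_validCheck (by decide +kernel), by norm_num, by norm_num, by norm_num, by norm_num⟩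

lemma valid_default : Valid (1, 2 ^ 27) := valid_of_validCheck (by decide +kernel)

lemma withPair_good {α : Type} (a b : ℕ) (k : ℕ → ℕ → α) (P : α → Prop)
    (h : ∀ x y, Good (x, y) → P (k x y)) : P (withPair a b k) := by
  have ht := good_of_tableCheck tableCheck_eq_true
  have hl : ∀ l (k : ℕ → α), (∀ l ≤ 160, P (k l)) → P (withLevel l k) := by
    intro l k hk
    unfold withLevel
    cases hb : Nat.ble l 160 with
    | false => exact hk 160 le_rfl
    | true =>
      simp only [force_eq]
      exact hk l (Nat.le_of_ble_eq_true hb)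
  unfold withPair
  cases Nat.beq a b with
  | true => exact h _ _ good_symm
  | false =>
    cases Nat.ble a b with
    | true =>
      refine hl _ _ fun l hl => ?_
      simp only [force_eq]
      exact h _ _ (ht l (by omega)).swap
    | false =>
      refine hl _ _ fun l hl => ?_
      simp only [force_eq]
      exact h _ _ (ht l (by omega))

lemma pairs_spec (n : ℕ) : ∀ (jz : ℕ) (la lb : List ℕ),
    (pairs n jz la lb).length = n ∧ (∀ p ∈ pairs n jz la lb, Good p) ∧
    ∀ k (h : k < (pairs n jz la lb).length), k < jz → (pairs n jz la lb)[k] = (2907270, 2907270) := by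
  induction n with
  | zero => intro jz la lb; simp [pairs]
  | succ n ih =>
    intro jz la lb
    cases jz with
    | zero =>
      refine withPair_good (la.headD 0) (lb.headD 0)
        (fun x y => (x, y) :: pairs n 0 la.tail lb.tail)
        (fun l => l.length = n + 1 ∧ (∀ p ∈ l, Good p) ∧
          ∀ k (h : k < l.length), k < 0 → l[k] = (2907270, 2907270)) fun x y hxy => ?_
      obtain ⟨h1, h2, h3⟩ := ih 0 la.tail lb.tail
      refine ⟨by simp [h1], ?_, fun k _ hk => by omega⟩
      simpa [hxy] using fun a b h => h2 (a, b) h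
    | succ jz =>
      obtain ⟨h1, h2, h3⟩ := ih jz la.tail lb.tail
      have h : pairs (n + 1) (jz + 1) la lb
        = (2907270, 2907270) :: pairs n jz la.tail lb.tail := rfl
      rw [h]
      refine ⟨by simp [h1], ?_, fun k hk hk' => ?_⟩
      · simpa [good_symm] using fun a b h => h2 (a, b) h
      · cases k with
        | zero => rfl
        | succ k => exact h3 k _ (by omega)

/-! ### The costs defined by a list of pairs -/

/-- The costs of the cells `[k, k + 1]`, `k ∈ ℤ`. -/
def cellCost (P : List (ℕ × ℕ)) : ℤ → ℕ
  | .ofNat k => (P.getD k (1, 2 ^ 27)).1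
  | .negSucc k => (P.getD k (1, 2 ^ 27)).2

lemma cellCost_of_le {P : List (ℕ × ℕ)} {k : ℤ} (h : (P.length : ℤ) ≤ k) : cellCost P k = 1 := by
  obtain ⟨k, rfl⟩ := Int.eq_ofNat_of_zero_le (by omega : 0 ≤ k)
  have : P.length ≤ k := by exact_mod_cast h
  change (P.getD k (1, 2 ^ 27)).1 = 1
  rw [List.getD_eq_default _ _ this]

lemma getD_valid {P : List (ℕ × ℕ)} (hP : ∀ p ∈ P, Good p) (k : ℕ) :
    Valid (P.getD k (1, 2 ^ 27)) := by
  by_cases h : k < P.length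
  · rw [List.getD_eq_getElem _ _ h]
    exact (hP _ (List.getElem_mem h)).1
  · rw [List.getD_eq_default _ _ (not_lt.1 h)]
    exact valid_default

lemma cellCost_valid {P : List (ℕ × ℕ)} (hP : ∀ p ∈ P, Good p) (k : ℤ) :
    Valid (cellCost P k, cellCost P (-k - 1)) := by
  cases k with
  | ofNat k =>
    have : -(Int.ofNat k) - 1 = Int.negSucc k := by rw [Int.negSucc_eq]; simp; ring
    rw [this]
    exact getD_valid hP k
  | negSucc k =>
    have : -(Int.negSucc k) - 1 = Int.ofNat k := by rw [Int.negSucc_eq]; simp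
    rw [this]
    exact (getD_valid hP k).swap

lemma cellCost_symm {P : List (ℕ × ℕ)} {jz : ℕ} (hj : jz ≤ P.length)
    (hP : ∀ k (h : k < P.length), k < jz → P[k] = (2907270, 2907270)) {k : ℤ}
    (h1 : -jz ≤ k) (h2 : k < jz) : cellCost P k = 2907270 := by
  cases k with
  | ofNat k =>
    have hk : k < jz := by simpa using h2
    change (P.getD k (1, 2 ^ 27)).1 = _
    rw [List.getD_eq_getElem _ _ (hk.trans_le hj), hP k (hk.trans_le hj) hk]
  | negSucc k =>
    have hk : k < jz := by rw [Int.negSucc_eq] at h1; omega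
    change (P.getD k (1, 2 ^ 27)).2 = _
    rw [List.getD_eq_getElem _ _ (hk.trans_le hj), hP k (hk.trans_le hj) hk]

/-- The cost function; cells have length `1 / c`. -/
noncomputable def costFun (P : List (ℕ × ℕ)) (c s : ℝ) : ℝ :=
  (max (cellCost P ⌊s * c⌋) (cellCost P (⌈s * c⌉ - 1)) : ℕ) / 2 ^ 22

lemma costFun_valid {P : List (ℕ × ℕ)} (hP : ∀ p ∈ P, Good p) (c s : ℝ) :
    Real.exp (-costFun P c s) + Real.exp (-costFun P c (-s)) ≤ 1 := by
  refine le_trans (add_le_add ?_ ?_) (cellCost_valid hP ⌊s * c⌋)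
  · rw [costFun, Real.exp_le_exp, neg_le_neg_iff]
    gcongr
    exact le_max_left _ _
  · rw [costFun, Real.exp_le_exp, neg_le_neg_iff, neg_mul, Int.ceil_neg]
    gcongr
    exact le_max_right _ _

lemma costFun_core {P : List (ℕ × ℕ)} {jz : ℕ} (hj : jz ≤ P.length)
    (hP : ∀ k (h : k < P.length), k < jz → P[k] = (2907270, 2907270)) {c s : ℝ}
    (h : |s * c| < jz) : costFun P c s = 2907270 / 2 ^ 22 := by
  have h1 := (abs_lt.1 h).1
  have h2 := (abs_lt.1 h).2
  rw [costFun, cellCost_symm hj hP, cellCost_symm hj hP]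
  · simp
  · have : -(jz : ℤ) < ⌈s * c⌉ := Int.lt_ceil.2 (by push_cast; exact h1)
    omega
  · have : ⌈s * c⌉ ≤ jz := Int.ceil_le.2 (by push_cast; exact h2.le)
    omega
  · exact Int.le_floor.2 (by push_cast; exact h1.le)
  · exact Int.floor_lt.2 (by push_cast; exact h2)

lemma unfoldPairs_eq (P : List (ℕ × ℕ)) : ∀ L R, unfoldPairs P L R
    = (P.map fun p => p.2 - 1).reverse ++ L ++ (R.reverse ++ P.map fun p => p.1 - 1) := by
  induction P with
  | nil => intro L R; simp [unfoldPairs]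
  | cons p P ih => intro L R; simp [unfoldPairs, ih]

/-- The costs of the cells, minus one, as a function of the index shifted to be nonnegative. -/
def cellList (P : List (ℕ × ℕ)) (a : ℕ) : ℕ := (unfoldPairs P [] []).getD a 0

lemma cellCost_eq {P : List (ℕ × ℕ)} (hP : ∀ p ∈ P, Good p) (a : ℕ) :
    cellCost P (a - P.length) = cellList P a + 1 := by
  rw [cellList, unfoldPairs_eq]
  simp only [List.append_nil, List.reverse_nil, List.nil_append]
  rcases lt_or_ge a P.length with h | h
  · have : (a : ℤ) - P.length = Int.negSucc (P.length - 1 - a) := by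
      rw [Int.negSucc_eq]
      omega
    rw [this, cellCost, List.getD_append _ _ _ _ (by simpa using h),
      List.getD_eq_getElem _ _ (by omega), List.getD_eq_getElem _ _ (by simpa using h)]
    simp only [List.getElem_reverse, List.getElem_map, List.length_map]
    have := (hP _ (List.getElem_mem (by omega : P.length - 1 - a < P.length))).2.2.1
    omega
  · rcases lt_or_ge a (2 * P.length) with h' | h'
    · have : (a : ℤ) - P.length = Int.ofNat (a - P.length) := by
        rw [Int.ofNat_eq_natCast]
        omega
      rw [this, cellCost, List.getD_append_right _ _ _ _ (by simpa using h),
        List.getD_eq_getElem _ _ (by omega), List.getD_eq_getElem _ _ (by simp; omega)]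
      simp only [List.getElem_map, List.length_reverse, List.length_map]
      have := (hP _ (List.getElem_mem (by omega : a - P.length < P.length))).2.1
      omega
    · rw [cellCost_of_le (by omega), List.getD_eq_default _ _ (by simp; omega)]

lemma length_unfoldPairs (P : List (ℕ × ℕ)) : (unfoldPairs P [] []).length = 2 * P.length := by
  rw [unfoldPairs_eq]
  simp
  omega

lemma cellList_lt {P : List (ℕ × ℕ)} (hP : ∀ p ∈ P, Good p) (a : ℕ) : cellList P a < 2 ^ 27 := by
  by_cases h : a < (unfoldPairs P [] []).length
  · rw [cellList, List.getD_eq_getElem _ _ h]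
    have hv : ∀ v ∈ unfoldPairs P [] [], v < 2 ^ 27 := by
      intro v hv
      rw [unfoldPairs_eq] at hv
      simp only [List.append_nil, List.reverse_nil, List.nil_append, List.mem_append,
        List.mem_reverse, List.mem_map] at hv
      rcases hv with ⟨p, hp, rfl⟩ | ⟨p, hp, rfl⟩ <;>
      · have := (hP p hp).2.2.2
        omega
    exact hv _ (List.getElem_mem h)
  · rw [cellList, List.getD_eq_default _ _ (not_lt.1 h)]
    norm_num

/-- Bound for the cost (minus one) on `[i, i + E]`, in units of `1 / R` of a cell. -/
def fineCost (P : List (ℕ × ℕ)) (R E i : ℕ) : ℕ :=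
  if i % R + E ≤ R then cellList P (i / R) else max (cellList P (i / R)) (cellList P (i / R + 1))

lemma fineCost_eq_zero {P : List (ℕ × ℕ)} {R E i : ℕ} (hR : 0 < R)
    (h : 2 * P.length * R ≤ i) : fineCost P R E i = 0 := by
  have h1 : 2 * P.length ≤ i / R := (Nat.le_div_iff_mul_le hR).2 h
  have h2 : ∀ a ≥ 2 * P.length, cellList P a = 0 := fun a ha => by
    rw [cellList, List.getD_eq_default _ _ (by rw [length_unfoldPairs]; exact ha)]
  rw [fineCost, h2 _ h1, h2 _ (h1.trans (Nat.le_succ _))]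
  simp

lemma fineCost_lt {P : List (ℕ × ℕ)} (hP : ∀ p ∈ P, Good p) (R E i : ℕ) :
    fineCost P R E i < 2 ^ 27 := by
  unfold fineCost
  split_ifs
  · exact cellList_lt hP _
  · exact max_lt (cellList_lt hP _) (cellList_lt hP _)

lemma costFun_le {P : List (ℕ × ℕ)} (hP : ∀ p ∈ P, Good p) {R E i : ℕ} (hR : 0 < R)
    (hER : E ≤ R) {U s : ℝ} (h1 : (i : ℝ) - P.length * R < s * U)
    (h2 : i < 2 * P.length * R → s * U < i - P.length * R + E) :
    costFun P (U / R) s ≤ (fineCost P R E i + 1 : ℕ) / 2 ^ 22 := by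
  have hR' : (0 : ℝ) < R := by exact_mod_cast hR
  set J := P.length with hJ
  have hx : s * (U / R) = (s * U) / R := by ring
  have hl1 : ((i / R : ℕ) : ℤ) - J ≤ ⌊s * (U / R)⌋ := by
    rw [Int.le_floor, hx, le_div_iff₀ hR', Int.cast_sub, Int.cast_natCast, Int.cast_natCast]
    have : ((i / R : ℕ) : ℝ) * R ≤ i := by exact_mod_cast Nat.div_mul_le_self i R
    linarith
  have hl2 : ((i / R : ℕ) : ℤ) - J ≤ ⌈s * (U / R)⌉ - 1 := by
    have : ((i / R : ℕ) : ℤ) - J < ⌈s * (U / R)⌉ := by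
      rw [Int.lt_ceil, hx, lt_div_iff₀ hR', Int.cast_sub, Int.cast_natCast, Int.cast_natCast]
      have : ((i / R : ℕ) : ℝ) * R ≤ i := by exact_mod_cast Nat.div_mul_le_self i R
      linarith
    omega
  rw [costFun]
  gcongr
  rcases lt_or_ge i (2 * J * R) with hi | hi
  · have h2 := h2 hi
    have hdm : ((i / R : ℕ) : ℝ) * R + (i % R : ℕ) = i := by
      have := Nat.div_add_mod i R
      rw [mul_comm] at this
      exact_mod_cast this
    have hu : ∀ b : ℕ, i % R + E ≤ b * R → ⌊s * (U / R)⌋ < ((i / R : ℕ) : ℤ) - J + b ∧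
        ⌈s * (U / R)⌉ - 1 < ((i / R : ℕ) : ℤ) - J + b := by
      intro b hb
      have hb' : ((i % R : ℕ) : ℝ) + E ≤ b * R := by exact_mod_cast hb
      have hlt : s * (U / R) < ((i / R : ℕ) : ℝ) - J + b := by
        rw [hx, div_lt_iff₀ hR']
        nlinarith
      have hc : (((((i / R : ℕ) : ℤ) - J + b : ℤ)) : ℝ) = ((i / R : ℕ) : ℝ) - J + b := by
        rw [Int.cast_add, Int.cast_sub, Int.cast_natCast, Int.cast_natCast, Int.cast_natCast]
      refine ⟨by rw [Int.floor_lt, hc]; exact hlt, ?_⟩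
      have : ⌈s * (U / R)⌉ ≤ ((i / R : ℕ) : ℤ) - J + b := by
        rw [Int.ceil_le, hc]
        exact hlt.le
      omega
    have hc := cellCost_eq hP (i / R)
    have hc' := cellCost_eq hP (i / R + 1)
    unfold fineCost
    split_ifs with hif
    · obtain ⟨h3, h4⟩ := hu 1 (by omega)
      have e1 : ⌊s * (U / R)⌋ = ((i / R : ℕ) : ℤ) - J := by rw [Nat.cast_one] at h3; omega
      have e2 : ⌈s * (U / R)⌉ - 1 = ((i / R : ℕ) : ℤ) - J := by rw [Nat.cast_one] at h4; omega
      rw [e1, e2, hc, max_self]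
    · obtain ⟨h3, h4⟩ := hu 2 (by have := Nat.mod_lt i hR; omega)
      have key : ∀ k : ℤ, ((i / R : ℕ) : ℤ) - J ≤ k → k < ((i / R : ℕ) : ℤ) - J + (2 : ℕ) →
          cellCost P k ≤ max (cellList P (i / R)) (cellList P (i / R + 1)) + 1 := by
        intro k hk1 hk2
        rw [Nat.cast_two] at hk2
        rcases (by omega : k = ((i / R : ℕ) : ℤ) - J ∨ k = ((i / R + 1 : ℕ) : ℤ) - J) with rfl | rfl
        · rw [hc]; omega
        · rw [hc']; omega
      exact max_le (key _ hl1 h3) (key _ hl2 h4)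
  · have : 2 * J ≤ i / R := (Nat.le_div_iff_mul_le hR).2 hi
    rw [cellCost_of_le (by omega), cellCost_of_le (by omega)]
    omega

/-! ### Arithmetic with packed lists -/

/-- The number with digits `f 0, …, f (N - 1)` in base `2⁵⁶`. -/
def num (N : ℕ) (f : ℕ → ℕ) : ℕ := ∑ i ∈ Finset.range N, f i * (2 ^ 56) ^ i

lemma num_add (N : ℕ) (f g : ℕ → ℕ) : num N f + num N g = num N fun i => f i + g i := by
  simp only [num, add_mul, Finset.sum_add_distrib]

lemma num_split (m k : ℕ) (f : ℕ → ℕ) :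
    num (m + k) f = num m f + 2 ^ (56 * m) * num k fun i => f (i + m) := by
  rw [num, Finset.sum_range_add, num, num, Finset.mul_sum]
  congr 1
  refine Finset.sum_congr rfl fun i _ => ?_
  rw [add_comm m i, pow_add, pow_mul]
  ring

lemma num_lt {f : ℕ → ℕ} (hf : ∀ i, f i < 2 ^ 56) (m : ℕ) : num m f < 2 ^ (56 * m) := by
  induction m with
  | zero => simp [num]
  | succ m ih =>
    rw [num_split, show num 1 (fun i => f (i + m)) = f m by simp [num], mul_add, pow_add, mul_one]
    have := Nat.mul_le_mul_left (2 ^ (56 * m)) (Nat.succ_le_of_lt (hf m))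
    rw [Nat.mul_succ] at this
    omega

lemma num_mod {N : ℕ} (hN : 0 < N) {f : ℕ → ℕ} (hf : ∀ i, f i < 2 ^ 56) :
    num N f % 72057594037927936 = f 0 := by
  obtain ⟨k, rfl⟩ := Nat.exists_eq_add_of_le hN
  rw [num_split, show num 1 f = f 0 by simp [num], show 2 ^ (56 * 1) = 72057594037927936 by norm_num,
    Nat.add_mul_mod_self_left]
  exact Nat.mod_eq_of_lt (hf 0)

/-- The blocks of `R` digits of the number with digits `f i`. -/
def IsBlocks (R : ℕ) (f : ℕ → ℕ) (l : List ℕ) : Prop :=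
  ∀ j, l.getD j 0 = num R fun r => f (j * R + r)

lemma dropBlocks_eq (q : ℕ) : ∀ l, dropBlocks q l = l.drop q := by
  induction q with
  | zero => intro l; rfl
  | succ q ih =>
    rintro (_ | ⟨a, l⟩)
    · simp [dropBlocks]
    · rw [List.drop_succ_cons, ← ih]
      rfl

lemma addBlocks_getD (l : List ℕ) : ∀ (m : List ℕ), m.length ≤ l.length → ∀ j,
    (addBlocks l m).getD j 0 = l.getD j 0 + m.getD j 0 := by
  induction l with
  | nil =>
    intro m hm j
    rw [List.length_nil, Nat.le_zero, List.length_eq_zero_iff] at hm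
    simp [addBlocks, hm]
  | cons a l ih =>
    intro m hm j
    have h : addBlocks (a :: l) m = force (a + m.headD 0) fun v => v :: addBlocks l m.tail := rfl
    rw [h, force_eq]
    have hm' : m.tail.length ≤ l.length := by
      rw [List.length_tail]
      exact Nat.sub_le_of_le_add hm
    cases j with
    | zero => cases m <;> simp
    | succ j =>
      rw [List.getD_cons_succ, ih _ hm', List.getD_cons_succ]
      cases m <;> simp

lemma shiftBlocks_cons (s mask c a : ℕ) (l : List ℕ) : shiftBlocks s mask c (a :: l)
    = (a >>> s + Nat.land (l.headD 0) mask <<< c) :: shiftBlocks s mask c l := by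
  have h : shiftBlocks s mask c (a :: l) = force (a >>> s + Nat.land (l.headD 0) mask <<< c) fun v =>
    v :: shiftBlocks s mask c l := rfl
  rw [h, force_eq]

lemma length_shiftBlocks (s mask c : ℕ) (l : List ℕ) :
    (shiftBlocks s mask c l).length = l.length := by
  induction l with
  | nil => rfl
  | cons a l ih => rw [shiftBlocks_cons, List.length_cons, ih, List.length_cons]

lemma shiftBlocks_getD (s mask c : ℕ) (l : List ℕ) : ∀ j, (shiftBlocks s mask c l).getD j 0
    = l.getD j 0 >>> s + Nat.land (l.getD (j + 1) 0) mask <<< c := by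
  induction l with
  | nil =>
    intro j
    simp [shiftBlocks]
  | cons a l ih =>
    intro j
    rw [shiftBlocks_cons]
    cases j with
    | zero => cases l <;> simp
    | succ j => simpa using ih j

lemma length_shiftDigits_le (R p : ℕ) (l : List ℕ) : (shiftDigits R p l).length ≤ l.length := by
  simp [shiftDigits, force_eq, length_shiftBlocks, dropBlocks_eq]

lemma IsBlocks.shiftDigits {R : ℕ} (hR : 0 < R) {f : ℕ → ℕ} {l : List ℕ} (h : IsBlocks R f l)
    (hf : ∀ i, f i < 2 ^ 56) (p : ℕ) :
    IsBlocks R (fun i => f (i + p)) (shiftDigits R p l) := by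
  intro j
  have hr := Nat.mod_lt p hR
  set r := p % R with hrdef
  set q := p / R with hqdef
  have hp : R * q + r = p := Nat.div_add_mod p R
  obtain ⟨k, hk⟩ := Nat.exists_eq_add_of_le hr.le
  have hland : ∀ x, Nat.land x (1 <<< (56 * r) - 1) = x % 2 ^ (56 * r) := fun x => by
    rw [Nat.one_shiftLeft]
    exact Nat.and_two_pow_sub_one_eq_mod _ _
  have hget : ∀ i, (l.drop q).getD i 0 = num R fun s => f ((q + i) * R + s) := fun i => by
    rw [← h (q + i)]
    simp [List.getD_eq_getElem?_getD]
  simp only [_root_.BernoulliConv.shiftDigits, force_eq]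
  rw [← hrdef, ← hqdef, shiftBlocks_getD, dropBlocks_eq, hland, hget, hget,
    show 56 * R - 56 * r = 56 * k by omega, Nat.shiftLeft_eq, Nat.shiftRight_eq_div_pow]
  have e1 : ∀ g : ℕ → ℕ, num R g = num r g + 2 ^ (56 * r) * num k fun i => g (i + r) := fun g => by
    conv_lhs => rw [hk, num_split]
  have e2 : ∀ g : ℕ → ℕ, num R g = num k g + 2 ^ (56 * k) * num r fun i => g (i + k) := fun g => by
    conv_lhs => rw [hk, add_comm, num_split]
  rw [e1, e1 fun s => f ((q + (j + 1)) * R + s), e2, Nat.add_mul_div_left _ _ (by positivity),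
    Nat.div_eq_of_lt (num_lt (fun i => hf _) _), zero_add, Nat.add_mul_mod_self_left,
    Nat.mod_eq_of_lt (num_lt (fun i => hf _) _), mul_comm (num r _)]
  congr 2
  · ext i
    congr 1
    rw [← hp]
    ring
  · congr 1
    ext i
    congr 1
    rw [← hp]
    have : (q + (j + 1)) * R = j * R + R * q + R := by ring
    omega

lemma sum_cons_nat {N : ℕ} (f : (Fin (N + 1) → Fin 2) → ℕ) :
    ∑ w, f w = ∑ w : Fin N → Fin 2, (f (Fin.cons 0 w) + f (Fin.cons 1 w)) := by
  rw [← (Fin.consEquiv fun _ : Fin (N + 1) => Fin 2).sum_comp, Fintype.sum_prod_type,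
    Fin.sum_univ_two, Finset.sum_add_distrib]
  rfl

/-- Sum of the first entries selected by a word. -/
def wordSum : (ds : List (ℕ × ℕ)) → (Fin ds.length → Fin 2) → ℕ
  | [], _ => 0
  | p :: l, w => (w 0 : ℕ) * p.1 + wordSum l fun i => w i.succ

lemma digitSum_eq {R : ℕ} (hR : 0 < R) (ds : List (ℕ × ℕ)) : ∀ {f : ℕ → ℕ} {b : ℕ} {F : List ℕ},
    (∀ i, f i ≤ b) → b * 2 ^ ds.length < 2 ^ 56 → IsBlocks R f F →
    digitSum R ds F = ∑ w, f (wordSum ds w) := by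
  induction ds with
  | nil =>
    intro f b F hf hb hF
    have hb' : b < 2 ^ 56 := by simpa using hb
    have h : F.headD 0 = num R f := by
      have := hF 0
      simp only [zero_mul, zero_add] at this
      rw [← this]
      cases F <;> simp
    rw [digitSum, h, num_mod hR fun i => (hf i).trans_lt hb']
    simp [wordSum]
  | cons p l ih =>
    intro f b F hf hb hF
    rw [List.length_cons, pow_succ] at hb
    have hp : 1 ≤ 2 ^ l.length := Nat.one_le_two_pow
    have hb' : b < 2 ^ 56 := lt_of_le_of_lt (by nlinarith) hb
    have hF' : IsBlocks R (fun i => f i + f (i + p.1)) (addBlocks F (shiftDigits R p.1 F)) := by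
      intro j
      rw [addBlocks_getD _ _ (length_shiftDigits_le _ _ _), hF,
        hF.shiftDigits hR (fun i => (hf i).trans_lt hb') p.1, num_add]
    rw [digitSum, ih (b := 2 * b) (fun i => by linarith [hf i, hf (i + p.1)]) (by linarith) hF',
      show (∑ w, f (wordSum (p :: l) w)) = _ from sum_cons_nat (N := l.length) _]
    refine Finset.sum_congr rfl fun w _ => ?_
    simp only [wordSum, Fin.cons_zero, Fin.cons_succ]
    congr 2
    · simp
    · simp
      ring

lemma merge_getD (w : ℕ) : ∀ (l : List ℕ) (j : ℕ),
    (merge w l).getD j 0 = l.getD (2 * j) 0 + l.getD (2 * j + 1) 0 * 2 ^ w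
  | [], j => by simp [merge]
  | [a], j => by cases j <;> simp [merge, Nat.mul_succ]
  | a :: b :: l, 0 => by simp [merge, Nat.shiftLeft_eq]
  | a :: b :: l, j + 1 => by simpa [merge, Nat.mul_succ] using merge_getD w l j

lemma mergeTimes_getD (s : ℕ) : ∀ (w : ℕ) (l : List ℕ) (j : ℕ), (mergeTimes s w l).getD j 0
    = ∑ i ∈ Finset.range (2 ^ s), l.getD (j * 2 ^ s + i) 0 * (2 ^ w) ^ i := by
  induction s with
  | zero => intro w l j; simp [mergeTimes]
  | succ s ih =>
    intro w l j
    have h : ∀ (n : ℕ) (f : ℕ → ℕ), ∑ i ∈ Finset.range (2 * n), f i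
        = ∑ i ∈ Finset.range n, (f (2 * i) + f (2 * i + 1)) := fun n f => by
      induction n with
      | zero => simp
      | succ n ih => rw [Nat.mul_succ, Finset.sum_range_succ, Finset.sum_range_succ, ih,
          Finset.sum_range_succ, add_assoc]
    rw [mergeTimes, ih, pow_succ' 2 s, h]
    refine Finset.sum_congr rfl fun i _ => ?_
    rw [merge_getD, show 2 * (j * 2 ^ s + i) = j * (2 * 2 ^ s) + 2 * i by ring, ← add_assoc,
      pow_succ, pow_mul (2 ^ w), ← pow_mul 2 w, mul_comm w 2]
    ring

lemma length_mergeTimes_congr (s : ℕ) : ∀ (w : ℕ) (l m : List ℕ), l.length = m.length →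
    (mergeTimes s w l).length = (mergeTimes s w m).length := by
  have h : ∀ (w : ℕ) (l : List ℕ), (merge w l).length = (l.length + 1) / 2 := by
    intro w l
    induction l using List.twoStepInduction with
    | nil => rfl
    | singleton a => simp [merge]
    | cons_cons a b l ih _ => simp [merge, ih]; omega
  induction s with
  | zero => intro w l m h; exact h
  | succ s ih => intro w l m hl; exact ih _ _ _ (by rw [h, h, hl])

lemma fineBlocks_getD (r r' : ℕ) (l : List ℕ) : ∀ (m : List ℕ), m.length = l.length → ∀ j,
    (fineBlocks r r' l m).getD j 0 = l.getD j 0 * r + m.getD j 0 * r' := by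
  induction l with
  | nil =>
    intro m hm j
    rw [List.length_nil, List.length_eq_zero_iff] at hm
    simp [fineBlocks, hm]
  | cons a l ih =>
    intro m hm j
    have h : fineBlocks r r' (a :: l) m
      = force (a * r + m.headD 0 * r') fun v => v :: fineBlocks r r' l m.tail := rfl
    rw [h, force_eq]
    cases m with
    | nil => simp at hm
    | cons b m =>
      cases j with
      | zero => simp
      | succ j => simpa using ih m (by simpa using hm) j

lemma rep_eq (m : ℕ) : rep m = num m fun _ => 1 := by
  have h := Nat.geomSum_eq (m := 2 ^ 56) (by norm_num) m
  simp only [num, one_mul, rep, Nat.shiftLeft_eq]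
  rw [h, pow_mul]
  norm_num

lemma maxima_getD : ∀ (l : List ℕ) (i : ℕ),
    (maxima l).getD i 0 = max (l.getD i 0) (l.getD (i + 1) 0)
  | [], i => by simp [maxima]
  | [a], i => by cases i <;> simp [maxima]
  | a :: b :: l, 0 => by
    simp only [maxima, List.getD_cons_zero, List.getD_cons_succ]
    cases h : Nat.ble a b with
    | true => exact (max_eq_right (Nat.le_of_ble_eq_true h)).symm
    | false =>
      refine (max_eq_left ?_).symm
      by_contra hlt
      change ¬b ≤ a at hlt
      rw [Nat.ble_eq_true_of_le (not_le.1 hlt).le] at h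
      cases h
  | a :: b :: l, i + 1 => by
    have := maxima_getD (b :: l) i
    simpa only [maxima, List.getD_cons_succ] using this

lemma length_maxima : ∀ l : List ℕ, (maxima l).length = l.length
  | [] => rfl
  | [a] => rfl
  | a :: b :: l => by simp [maxima, length_maxima (b :: l)]

lemma num_blocks (R L : ℕ) (f : ℕ → ℕ) :
    num (L * R) f = ∑ a ∈ Finset.range L, (num R fun r => f (a * R + r)) * (2 ^ (56 * R)) ^ a := by
  induction L with
  | zero => simp [num]
  | succ L ih =>
    rw [Finset.sum_range_succ, ← ih, Nat.succ_mul, num, Finset.sum_range_add, num, num,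
      Finset.sum_mul]
    congr 1
    refine Finset.sum_congr rfl fun r _ => ?_
    rw [pow_add, pow_mul 2 56 R, ← pow_mul, mul_comm L R, pow_mul]
    ring

lemma num_block (g h m k : ℕ) : (num (m + k) fun r => if r < m then g else h)
    = g * rep m + h * (rep k <<< (56 * m)) := by
  rw [num, Finset.sum_range_add, rep_eq, rep_eq, num, num, Nat.shiftLeft_eq, Finset.mul_sum,
    Finset.sum_mul, Finset.mul_sum]
  congr 1
  · refine Finset.sum_congr rfl fun i hi => ?_
    rw [if_pos (Finset.mem_range.1 hi), one_mul]
  · refine Finset.sum_congr rfl fun i _ => ?_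
    rw [if_neg (by omega), pow_add, pow_mul]
    ring

lemma isBlocks_fineCost (P : List (ℕ × ℕ)) {R E : ℕ} (hE : 0 < E) (hER : E ≤ R) :
    IsBlocks (R * 16) (fineCost P R E) (fineBlocks (rep (R - E + 1))
      (rep (E - 1) <<< (56 * (R - E + 1))) (mergeTimes 4 (56 * R) (unfoldPairs P [] []))
      (mergeTimes 4 (56 * R) (maxima (unfoldPairs P [] [])))) := by
  intro j
  rw [fineBlocks_getD _ _ _ _ (length_mergeTimes_congr _ _ _ _ (length_maxima _)), mergeTimes_getD,
    mergeTimes_getD, mul_comm R 16, num_blocks, Finset.sum_mul, Finset.sum_mul,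
    ← Finset.sum_add_distrib]
  refine Finset.sum_congr rfl fun i _ => ?_
  set a := j * 2 ^ 4 + i with ha
  have hcell : ∀ r, j * (16 * R) + (i * R + r) = a * R + r := fun r => by rw [ha]; ring
  simp only [hcell]
  have h := num_block (cellList P a) (max (cellList P a) (cellList P (a + 1))) (R - E + 1) (E - 1)
  rw [show R - E + 1 + (E - 1) = R by omega] at h
  have h' : num R (fun r => fineCost P R E (a * R + r)) = num R fun r =>
      if r < R - E + 1 then cellList P a else max (cellList P a) (cellList P (a + 1)) := by
    refine Finset.sum_congr rfl fun r hr => ?_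
    have hr := Finset.mem_range.1 hr
    have e1 : (a * R + r) % R = r := by
      rw [mul_comm, Nat.mul_add_mod, Nat.mod_eq_of_lt hr]
    have e2 : (a * R + r) / R = a := by
      rw [mul_comm, Nat.mul_add_div (by omega), Nat.div_eq_of_lt hr, add_zero]
    simp only [fineCost, e1, e2]
    congr 1
    exact if_congr (by omega) rfl rfl
  rw [h', h, maxima_getD]
  simp only [cellList]
  ring

/-! ### Soundness of the checker -/

/-- The list bounds the numbers `c / β, c / β², …`. -/
def Steps (β : ℝ) : ℝ → List (ℕ × ℕ) → Prop
  | _, [] => True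
  | c, p :: l => (p.1 : ℝ) ≤ c / β ∧ c / β ≤ p.2 ∧ Steps β (c / β) l

lemma length_digs (B0 B1 sh n : ℕ) : ∀ x y, (digs B0 B1 sh n x y).length = n := by
  induction n with
  | zero => intro x y; rfl
  | succ n ih => intro x y; simp [digs, force_eq, ih]

section
variable {β : ℝ} {B0 B1 : ℕ}

lemma le_mul_div_add_one (hβ : 1 < β) (h0 : 0 < B0) (hB : (B0 : ℝ) ≤ β * 2 ^ 40) {y : ℕ} {z : ℝ}
    (hy : z ≤ y) : z / β ≤ (y * 1099511627776 / B0 + 1 : ℕ) := by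
  have h1 : (B0 : ℝ) * (y * 1099511627776 / B0 + 1 : ℕ) ≥ y * 2 ^ 40 := by
    have := (Nat.lt_mul_div_succ (y * 1099511627776) h0).le
    have h : ((y * 1099511627776 : ℕ) : ℝ) ≤ (B0 * (y * 1099511627776 / B0 + 1) : ℕ) := by
      exact_mod_cast this
    rw [Nat.cast_mul B0] at h
    refine le_trans (le_of_eq ?_) h
    push_cast
    norm_num
  rw [div_le_iff₀ (by linarith)]
  have h2 : (0 : ℝ) ≤ (y * 1099511627776 / B0 + 1 : ℕ) := Nat.cast_nonneg _
  nlinarith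

lemma mul_div_le (hβ : 1 < β) (hB : β * 2 ^ 40 ≤ B1) {x : ℕ} {z : ℝ}
    (hx : (x : ℝ) ≤ z) : ((x * 1099511627776 / B1 : ℕ) : ℝ) ≤ z / β := by
  refine Nat.cast_div_le.trans ?_
  have : (0 : ℝ) < B1 := by nlinarith
  rw [div_le_div_iff₀ this (by linarith)]
  push_cast
  have : (0 : ℝ) ≤ x := Nat.cast_nonneg x
  nlinarith

lemma shiftRight_le {x sh : ℕ} {c : ℝ} (h : (x : ℝ) ≤ c * 2 ^ sh) : ((x >>> sh : ℕ) : ℝ) ≤ c := by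
  rw [Nat.shiftRight_eq_div_pow]
  refine Nat.cast_div_le.trans ?_
  rw [div_le_iff₀ (by positivity)]
  exact_mod_cast h

lemma le_shiftRight {y sh : ℕ} {c : ℝ} (h : c * 2 ^ sh ≤ y) : c ≤ (y >>> sh + 1 : ℕ) := by
  rw [Nat.shiftRight_eq_div_pow]
  have h1 := (Nat.lt_mul_div_succ y (Nat.two_pow_pos sh)).le
  have h2 : (y : ℝ) ≤ (2 ^ sh * (y / 2 ^ sh + 1) : ℕ) := by exact_mod_cast h1
  rw [Nat.cast_mul, Nat.cast_pow, Nat.cast_ofNat, mul_comm] at h2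
  exact le_of_mul_le_mul_right (h.trans h2) (by positivity)

lemma digs_steps (hβ : 1 < β) (h0 : 0 < B0) (hB0 : (B0 : ℝ) ≤ β * 2 ^ 40) (hB1 : β * 2 ^ 40 ≤ B1)
    (sh n : ℕ) : ∀ (x y : ℕ) (c : ℝ), (x : ℝ) ≤ c * 2 ^ sh → c * 2 ^ sh ≤ y →
      Steps β c (digs B0 B1 sh n x y) := by
  induction n with
  | zero => intro x y c _ _; trivial
  | succ n ih =>
    intro x y c hx hy
    have h1 : ((x * 1099511627776 / B1 : ℕ) : ℝ) ≤ c / β * 2 ^ sh := by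
      rw [div_mul_eq_mul_div]
      exact mul_div_le hβ hB1 hx
    have h2 : c / β * 2 ^ sh ≤ (y * 1099511627776 / B0 + 1 : ℕ) := by
      rw [div_mul_eq_mul_div]
      exact le_mul_div_add_one hβ h0 hB0 hy
    simp only [digs, force_eq]
    exact ⟨shiftRight_le h1, le_shiftRight h2, ih _ _ _ h1 h2⟩

lemma le_tailZ (hβ : 1 < β) (h0 : 0 < B0) (hB0 : (B0 : ℝ) ≤ β * 2 ^ 40) (n : ℕ) :
    ∀ (z : ℕ) (c : ℝ), c ≤ z → c / β ^ n ≤ tailZ B0 n z := by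
  induction n with
  | zero => intro z c h; simpa [tailZ] using h
  | succ n ih =>
    intro z c h
    have := ih _ _ (le_mul_div_add_one hβ h0 hB0 h)
    rwa [div_div, ← pow_succ'] at this

lemma wordSum_le (hβ : 1 < β) (ds : List (ℕ × ℕ)) : ∀ (V : ℝ), 0 ≤ V → Steps β ((β - 1) * V) ds →
    ∀ x : ℕ → Fin 2, (wordSum ds (fun i => x i) : ℝ) ≤ V * piBeta β x := by
  induction ds with
  | nil =>
    intro V hV _ x
    simpa [wordSum] using mul_nonneg hV (piBeta_mem hβ x).1
  | cons p l ih =>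
    rintro V hV ⟨h1, -, h3⟩ x
    have hs := ih (V / β) (by positivity) (by rwa [← mul_div_assoc]) fun k => x (k + 1)
    have h := piBeta_shift hβ x
    have e : V * piBeta β x
        = (x 0 : ℕ) * ((β - 1) * V / β) + V / β * piBeta β fun k => x (k + 1) := by
      have : β ≠ 0 := by positivity
      field_simp
      linear_combination V * h
    rw [e]
    simp only [wordSum]
    push_cast
    exact add_le_add (mul_le_mul_of_nonneg_left h1 (Nat.cast_nonneg _)) hs

lemma le_wordSum_add (hβ : 1 < β) (K : ℕ) (ds : List (ℕ × ℕ)) : ∀ (V : ℝ), 0 ≤ V →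
    Steps β ((β - 1) * V) ds → ∀ x : ℕ → Fin 2, wordSum ds (fun i => x i) < K →
    V * piBeta β x ≤ wordSum ds (fun i => x i) + spread K ds + V / β ^ ds.length := by
  induction ds with
  | nil =>
    intro V hV _ x _
    simpa [wordSum, spread] using mul_le_of_le_one_right hV (piBeta_mem hβ x).2
  | cons p l ih =>
    rintro V hV ⟨h1, h2, h3⟩ x hx
    simp only [wordSum] at hx
    have hs := ih (V / β) (by positivity) (by rwa [← mul_div_assoc]) (fun k => x (k + 1))
      (lt_of_le_of_lt (Nat.le_add_left _ _) hx)
    have h := piBeta_shift hβ x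
    have e : V * piBeta β x
        = (x 0 : ℕ) * ((β - 1) * V / β) + V / β * piBeta β fun k => x (k + 1) := by
      have : β ≠ 0 := by positivity
      field_simp
      linear_combination V * h
    rw [div_div, ← pow_succ'] at hs
    have hp : p.1 ≤ p.2 := by exact_mod_cast h1.trans h2
    have key : ((x 0 : ℕ) : ℝ) * ((β - 1) * V / β) + spread K l
        ≤ (x 0 : ℕ) * p.1 + spread K (p :: l) := by
      rcases (by omega : x 0 = 0 ∨ x 0 = 1) with h0 | h0
      · rw [h0]
        simp only [spread, Fin.val_zero, Nat.cast_zero, zero_mul, zero_add, Nat.cast_le]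
        cases Nat.blt p.1 K <;> simp
      · have hx0 : x ((0 : Fin (p :: l).length) : ℕ) = 1 := h0
        rw [hx0] at hx
        rw [h0]
        have hlt : Nat.blt p.1 K = true := by
          rw [Nat.blt_eq]
          simp only [Fin.val_one, one_mul] at hx
          omega
        simp only [spread, hlt, cond_true, Fin.val_one, Nat.cast_one, one_mul]
        rw [Nat.cast_add, Nat.cast_sub hp]
        linarith
    have hw : (wordSum (p :: l) fun i => x i) = (x 0 : ℕ) * p.1 + wordSum l fun i => x (i + 1) := rfl
    have hlen : (p :: l).length = l.length + 1 := rfl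
    rw [e, hw, Nat.cast_add, Nat.cast_mul]
    simp only [hlen]
    linarith

/-- The error allowed for in `windowSum`. -/
lemma costBound_of_windowSum {P : List (ℕ × ℕ)} (hP : ∀ p ∈ P, Good p) {A M : List ℕ} {e FR n : ℕ}
    (hβ : 1 < β) (hβ2 : β ≤ 2) (he : e ≤ 60) (hn : n ≤ 28) (h0 : 1099511627776 < B0)
    (hB0 : (B0 : ℝ) ≤ β * 2 ^ 40) (hB1 : β * 2 ^ 40 ≤ B1)
    (hAM : ∀ E, 0 < E → E ≤ FR → IsBlocks (FR * 16) (fineCost P FR E)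
      (fineBlocks (rep (FR - E + 1)) (rep (E - 1) <<< (56 * (FR - E + 1))) A M))
    (hf : 0 < windowSum A M e FR n P.length B0 B1) :
    CostBound β (costFun P (2 ^ e / FR))
      ((windowSum A M e FR n P.length B0 B1 / 2 ^ n + 2 : ℕ) / 2 ^ 22) := by
  set J := P.length with hJ
  set f := windowSum A M e FR n J B0 B1 with hfdef
  simp only [windowSum, force_eq] at hfdef
  set m0 := (2199023255552 - B0) <<< e / 2199023255552 + 2 with hm0
  set m1 := (2199023255552 - B1) <<< e / 2199023255552 with hm1
  set ds := digs B0 B1 (60 - e) n ((B0 - 1099511627776) <<< 20) ((B1 - 1099511627776) <<< 20)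
    with hds
  set z := tailZ B0 n 1152921504606846976 >>> (60 - e) with hz
  set E := m0 - m1 + spread (2 * J * FR) ds + z + 3 with hE
  have hcond : (Nat.ble E FR && Nat.ble m0 (J * FR)) = true := by
    cases h : (Nat.ble E FR && Nat.ble m0 (J * FR)) with
    | true => rfl
    | false =>
      rw [h, cond_false] at hfdef
      omega
  rw [hcond, cond_true] at hfdef
  rw [Bool.and_eq_true, Nat.ble_eq, Nat.ble_eq] at hcond
  obtain ⟨hEF, hm0J⟩ := hcond
  have hE0 : 0 < E := by rw [hE]; exact Nat.succ_pos _
  have hFR : 0 < FR := by omega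
  have hlen : ds.length = n := length_digs _ _ _ _ _ _
  have hpow : (2 : ℝ) ^ e * 2 ^ (60 - e) = 2 ^ 60 := by rw [← pow_add]; congr 1; omega
  have hB01 : B0 ≤ B1 := by exact_mod_cast hB0.trans hB1
  have hsteps : Steps β ((β - 1) * 2 ^ e) ds := by
    refine digs_steps hβ (by omega) hB0 hB1 _ _ _ _ _ ?_ ?_
    · rw [mul_assoc, hpow, Nat.shiftLeft_eq, Nat.cast_mul, Nat.cast_sub h0.le]
      norm_num at hB0 ⊢
      linarith
    · rw [mul_assoc, hpow, Nat.shiftLeft_eq, Nat.cast_mul, Nat.cast_sub (h0.le.trans hB01)]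
      norm_num at hB1 ⊢
      linarith
  have htail : (2 : ℝ) ^ e / β ^ n ≤ (z + 1 : ℕ) := by
    refine le_shiftRight ?_
    rw [div_mul_eq_mul_div, hpow]
    exact le_tailZ hβ (by omega) hB0 n _ _ (by norm_num)
  have hm0' : (1 - β / 2) * 2 ^ e ≤ m0 - 1 := by
    have h1 := (Nat.lt_mul_div_succ ((2199023255552 - B0) <<< e)
      (by norm_num : 0 < 2199023255552)).le
    have h2 : ((2199023255552 - B0 : ℕ) : ℝ) * 2 ^ e
        ≤ 2199023255552 * (m0 - 1) := by
      rw [Nat.shiftLeft_eq] at h1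
      have : ((2199023255552 - B0) * 2 ^ e : ℕ) ≤ 2199023255552 * (m0 - 1) := by
        rw [hm0, Nat.shiftLeft_eq]
        exact h1
      have h3 : (((2199023255552 - B0) * 2 ^ e : ℕ) : ℝ) ≤ (2199023255552 * (m0 - 1) : ℕ) := by
        exact_mod_cast this
      rw [Nat.cast_mul, Nat.cast_pow, Nat.cast_mul, Nat.cast_sub (by omega : 1 ≤ m0)] at h3
      push_cast at h3
      exact h3
    have h4 : (2199023255552 - B0 : ℝ) ≤ (2199023255552 - B0 : ℕ) := by
      rw [sub_le_iff_le_add]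
      have : 2199023255552 ≤ (2199023255552 - B0) + B0 := by omega
      exact_mod_cast this
    have h5 : (0 : ℝ) < 2 ^ e := by positivity
    have h6 := mul_le_mul_of_nonneg_right h4 h5.le
    nlinarith
  have hm1' : (m1 : ℝ) ≤ (1 - β / 2) * 2 ^ e := by
    rw [hm1, Nat.shiftLeft_eq]
    refine Nat.cast_div_le.trans ?_
    rw [div_le_iff₀ (by norm_num), Nat.cast_mul]
    have h5 : (0 : ℝ) < 2 ^ e := by positivity
    rcases le_total B1 2199023255552 with h | h
    · rw [Nat.cast_sub h]
      push_cast
      nlinarith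
    · rw [Nat.sub_eq_zero_of_le h]
      push_cast
      nlinarith
  have hm01 : m1 ≤ m0 := by
    have : (m1 : ℝ) ≤ m0 := by linarith
    exact_mod_cast this
  set g : ℕ → ℕ := fineCost P FR E with hg
  have hval : f = ∑ w, g (J * FR - m0 + wordSum ds w) + 1 := by
    have hglt : ∀ i, g i ≤ 2 ^ 27 := fun i => (fineCost_lt hP FR E i).le
    have hg0 : ∀ i ≥ 2 * J * FR, g i = 0 := fun i hi => fineCost_eq_zero hFR hi
    have hb : (2 ^ 27 : ℕ) * 2 ^ ds.length ≤ 2 ^ 55 := by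
      rw [hlen, ← pow_add]
      exact Nat.pow_le_pow_right (by norm_num) (by omega)
    have hglt' : ∀ i, g i < 2 ^ 56 := fun i => (hglt i).trans_lt (by norm_num)
    have hR : 0 < FR * 16 := by omega
    rw [hfdef, digitSum_eq hR ds (fun i => hglt _) (hb.trans_lt (by norm_num))
      ((hAM E hE0 hEF).shiftDigits hR hglt' _)]
    simp only [add_comm (wordSum _ _)]
  refine ⟨1 / (4 * 2 ^ e), by positivity, ds.length,
    fun w => (g (J * FR - m0 + wordSum ds w) + 1 : ℕ) / 2 ^ 22, ?_, ?_⟩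
  · intro x t ht
    set S := wordSum ds fun i => x i with hS
    have h5 : (0 : ℝ) < 2 ^ e := by positivity
    have hpos : pos β x * 2 ^ e = 2 ^ e * piBeta β x - (1 - β / 2) * 2 ^ e := by rw [pos]; ring
    have habs : |t * 2 ^ e - pos β x * 2 ^ e| ≤ 1 / 4 := by
      rw [← sub_mul, abs_mul, abs_of_pos h5]
      have := mul_le_mul_of_nonneg_right ht h5.le
      refine this.trans (le_of_eq ?_)
      field_simp
    rw [abs_le] at habs
    have hlow := wordSum_le hβ ds _ h5.le hsteps x
    have hi : ((J * FR - m0 + S : ℕ) : ℝ) = J * FR - m0 + S := by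
      rw [Nat.cast_add, Nat.cast_sub hm0J, Nat.cast_mul]
    refine costFun_le hP hFR hEF ?_ fun hlt => ?_
    · rw [hi]
      linarith [habs.1]
    · have hSK : S < 2 * J * FR := by
        have : 2 * P.length * FR = 2 * (J * FR) := by rw [hJ]; ring
        have : 2 * J * FR = 2 * (J * FR) := by ring
        change J * FR - m0 + S < _ at hlt
        omega
      have hup := le_wordSum_add hβ (2 * J * FR) ds _ h5.le hsteps x hSK
      have hup' : (2 : ℝ) ^ e / β ^ ds.length = 2 ^ e / β ^ n := by rw [hlen]
      rw [hup'] at hup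
      have hEr : (E : ℝ) = m0 - m1 + spread (2 * J * FR) ds + z + 3 := by
        rw [hE]
        push_cast [Nat.cast_sub hm01]
        ring
      push_cast at htail
      rw [hEr]
      change _ < ((J * FR - m0 + S : ℕ) : ℝ) - _ + _
      rw [hi]
      linarith [habs.2]
  · have hcard : (∑ _w : Fin ds.length → Fin 2, (1 : ℝ)) = 2 ^ n := by
      simp [hlen]
    have hlen' : (2 : ℝ) ^ ds.length = 2 ^ n := by rw [hlen]
    rw [avg, hlen', ← Finset.sum_div, div_right_comm]
    gcongr
    rw [div_le_iff₀ (by positivity)]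
    have h1 := (Nat.lt_mul_div_succ f (Nat.two_pow_pos n)).le
    have h2 : (f : ℝ) ≤ (2 ^ n * (f / 2 ^ n + 1) : ℕ) := by exact_mod_cast h1
    have h3 : (f : ℝ) = ∑ w, (g (J * FR - m0 + wordSum ds w) : ℝ) + 1 := by
      rw [hval]
      push_cast
      rfl
    have h4 : ∑ w, ((g (J * FR - m0 + wordSum ds w) + 1 : ℕ) : ℝ)
        = ∑ w, (g (J * FR - m0 + wordSum ds w) : ℝ) + 2 ^ n := by
      rw [← hcard, ← Finset.sum_add_distrib]
      push_cast
      rfl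
    rw [h4]
    push_cast at h2 ⊢
    have h6 : (0 : ℝ) < 2 ^ n := by positivity
    linarith

end

/-- The cost `Φ` shows that the entropy is at least `D log β - G`, where `D = 0.9804094` and
`G = g / (2²² 10¹⁰)`; it is constant near `0`. -/
def Tuned (β : ℝ) (g : ℕ) (core : ℝ) (Φ : ℝ → ℝ) (H : ℝ) : Prop :=
  (∀ s, Real.exp (-Φ s) + Real.exp (-Φ (-s)) ≤ 1) ∧
  (∀ s, |s| < core → Φ s = 2907270 / 2 ^ 22) ∧ CostBound β Φ H ∧
  H < Real.log 2 - 0.9804094 * Real.log β + g / (2 ^ 22 * 10 ^ 10)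

lemma windowsOk_sound {P : List (ℕ × ℕ)} (hP : ∀ p ∈ P, Good p) {A M : List ℕ} {e FR n w Bs lb g : ℕ}
    {β : ℝ} (hβ : 1 < β) (hβ2 : β ≤ 2) (he : e ≤ 60) (hn : n ≤ 28) (hBs : 0 < Bs)
    (hlb : Real.log (Bs / 2 ^ 40) ≤ lb / 2 ^ 22)
    (hAM : ∀ E, 0 < E → E ≤ FR → IsBlocks (FR * 16) (fineCost P FR E)
      (fineBlocks (rep (FR - E + 1)) (rep (E - 1) <<< (56 * (FR - E + 1))) A M)) (k : ℕ) :
    ∀ B0, 1099511627776 < B0 → Bs ≤ B0 → (B0 : ℝ) ≤ β * 2 ^ 40 →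
      β * 2 ^ 40 ≤ (B0 + k * w : ℕ) → 0 < k →
      windowsOk A M e FR n P.length w Bs lb g k B0 = true →
      ∃ H, CostBound β (costFun P (2 ^ e / FR)) H ∧
        H < Real.log 2 - 0.9804094 * Real.log β + g / (2 ^ 22 * 10 ^ 10) := by
  induction k with
  | zero => intro _ _ _ _ _ h; exact absurd h (lt_irrefl 0)
  | succ k ih =>
    intro B0 h0 hs hB0 hB1 _ h
    simp only [windowsOk, force_eq, Bool.and_eq_true, Nat.blt_eq] at h
    obtain ⟨⟨hf, hlt⟩, hrest⟩ := h
    by_cases hβB : β * 2 ^ 40 ≤ (B0 + w : ℕ)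
    · refine ⟨_, costBound_of_windowSum hP hβ hβ2 he hn h0 hB0 hβB hAM hf, ?_⟩
      have hBs' : (0 : ℝ) < Bs := by exact_mod_cast hBs
      have h1 : Real.log β ≤ lb / 2 ^ 22 + ((B0 + w : ℕ) - Bs) / Bs := by
        have e : β = Bs / 2 ^ 40 * (β * 2 ^ 40 / Bs) := by field_simp
        have hpos : 0 < β * 2 ^ 40 / Bs := by positivity
        have h2 : Real.log β = Real.log (Bs / 2 ^ 40) + Real.log (β * 2 ^ 40 / Bs) := by
          rw [← Real.log_mul (by positivity) hpos.ne', ← e]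
        have h3 := Real.log_le_sub_one_of_pos hpos
        have h4 : β * 2 ^ 40 / Bs - 1 ≤ ((B0 + w : ℕ) - Bs) / Bs := by
          rw [sub_div, div_self hBs'.ne']
          gcongr
        linarith
      have h2 := Real.log_two_gt_d9
      set F := windowSum A M e FR n P.length B0 (B0 + w) / 2 ^ n + 2 with hF
      have h3 : ((F * 10 ^ 10 * Bs + 9804094000 * (lb * Bs + 4194304 * (B0 + w - Bs)) : ℕ) : ℝ)
          < ((6931471803 * 4194304 + g) * Bs : ℕ) := by exact_mod_cast hlt
      have h4 : ((B0 + w - Bs : ℕ) : ℝ) = (B0 + w : ℕ) - Bs := Nat.cast_sub (by omega)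
      push_cast [h4] at h3
      push_cast at h1
      have h5 : ((F : ℝ) / 2 ^ 22 + 0.9804094 * (lb / 2 ^ 22 + (B0 + w - Bs) / Bs)
          - 0.6931471803 - g / (2 ^ 22 * 10 ^ 10)) * (10 ^ 10 * 4194304 * Bs) < 0 := by
        have : ((F : ℝ) / 2 ^ 22 + 0.9804094 * (lb / 2 ^ 22 + (B0 + w - Bs) / Bs)
          - 0.6931471803 - g / (2 ^ 22 * 10 ^ 10)) * (10 ^ 10 * 4194304 * Bs)
          = (F * 10 ^ 10 * Bs + 9804094000 * (lb * Bs + 4194304 * (B0 + w - Bs)))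
            - (6931471803 * 4194304 + g) * Bs := by
          field_simp
          ring
        rw [this]
        linarith
      have h6 := neg_of_mul_neg_left h5 (by positivity)
      linarith
    · refine ih _ (by omega) (by omega) (not_le.1 hβB).le ?_ ?_ hrest
      · refine hB1.trans (le_of_eq ?_)
        push_cast
        ring
      · rcases Nat.eq_zero_or_pos k with rfl | hk
        · rw [zero_add, one_mul] at hB1
          exact absurd hB1 hβB
        · exact hk

lemma log_le_of_expLower {Bs lb : ℕ} (hBs : 0 < Bs)
    (h : Bs * 2 ^ 1280 ≤ 1099511627776 * expLower lb ^ 16) :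
    Real.log (Bs / 2 ^ 40) ≤ lb / 2 ^ 22 := by
  have hBs' : (0 : ℝ) < Bs := by exact_mod_cast hBs
  rw [Real.log_le_iff_le_exp (by positivity), div_le_iff₀ (by positivity)]
  have h1 := expLower_pow_le lb
  have h2 : (Bs : ℝ) * 2 ^ 1280 ≤ 1099511627776 * (expLower lb : ℝ) ^ 16 := by exact_mod_cast h
  have h3 : 2 ^ 1280 * (Bs : ℝ) ≤ 2 ^ 1280 * (Real.exp (lb / 2 ^ 22) * 2 ^ 40) := by
    rw [mul_comm]
    refine h2.trans ?_
    calc (1099511627776 : ℝ) * (expLower lb : ℝ) ^ 16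
        ≤ 1099511627776 * (2 ^ 1280 * Real.exp (lb / 2 ^ 22)) := by gcongr
      _ = _ := by ring
  exact le_of_mul_le_mul_left h3 (by positivity)

theorem tuned_of_groupOk {Bc e FR n J jz w Bs lb g k B0 : ℕ}
    (h : groupOk Bc e FR n J jz w Bs lb g k B0 = true) (hk : 0 < k) {β : ℝ} (hβ2 : β ≤ 2)
    (h0 : (B0 : ℝ) ≤ β * 2 ^ 40) (h1 : β * 2 ^ 40 ≤ (B0 + k * w : ℕ)) :
    ∃ Φ H, Tuned β g (jz * FR / 2 ^ e) Φ H := by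
  simp only [groupOk, Bool.and_eq_true, paramsOk, Nat.ble_eq, Nat.blt_eq] at h
  obtain ⟨⟨⟨⟨⟨⟨⟨⟨he, hFR⟩, hn⟩, hj⟩, hBs⟩, hBsB⟩, hB0⟩, hlb⟩, hw⟩ := h
  have hβ : 1 < β := by
    have : (1099511627776 : ℝ) < B0 := by exact_mod_cast hB0
    norm_num at h0
    linarith
  obtain ⟨P, hPc, hPl, hPg, hPj⟩ : ∃ P, cells Bc e FR n J jz = unfoldPairs P [] [] ∧
      P.length = J ∧ (∀ p ∈ P, Good p) ∧
      ∀ k (h : k < P.length), k < jz → P[k] = (2907270, 2907270) := by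
    simp only [cells, force_eq]
    exact ⟨_, rfl, pairs_spec _ _ _ _⟩
  rw [hPc] at hw
  subst hPl
  have hAM : ∀ E, 0 < E → E ≤ FR → _ := fun E hE hEF => isBlocks_fineCost P hE hEF
  obtain ⟨H, hH1, hH2⟩ := windowsOk_sound hPg hβ hβ2 he hn hBs (log_le_of_expLower hBs hlb) hAM k B0
    hB0 hBsB h0 h1 hk hw
  refine ⟨_, H, costFun_valid hPg _, fun s hs => costFun_core hj hPj ?_, hH1, hH2⟩
  have hFR' : (0 : ℝ) < FR := by exact_mod_cast hFR
  rw [abs_mul, abs_of_pos (show (0 : ℝ) < 2 ^ e / FR by positivity)]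
  rwa [lt_div_iff₀ (by positivity), ← div_lt_iff₀ hFR', mul_div_assoc] at hs

/-- The bound for the local dimension holds almost everywhere. -/
def DimBound (m : Measure (ℕ → Fin 2)) (β : ℝ) : Prop :=
  ∀ᵐ x ∂(m.map (piBeta β)), (0.9804094 : ℝ) ≤ liminf (fun r : ℝ =>
    Real.log (((m.map (piBeta β)) (Metric.closedBall x r)).toReal) / Real.log r) (𝓝[>] 0)

lemma Tuned.dimBound {m : Measure (ℕ → Fin 2)} (hm : IsCoinMeasure m) {β : ℝ} (hβ : 1 < β)
    {core H : ℝ} {Φ : ℝ → ℝ} (h : Tuned β 0 core Φ H) : DimBound m β :=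
  le_liminf_of_costBound hm hβ h.1 h.2.2.1 (by norm_num) (by simpa using h.2.2.2)

/-! ### Random signs -/

section signAvg

variable {V : Type*} [AddCommGroup V]

/-- The average of `F (± v₁ ± v₂ ± ⋯)` over all choices of signs. -/
noncomputable def signAvg : List V → (V → ℝ) → ℝ
  | [], F => F 0
  | a :: l, F => (signAvg l (fun v => F (v + a)) + signAvg l (fun v => F (v - a))) / 2

lemma signAvg_mono (l : List V) : ∀ {F G : V → ℝ}, (∀ v, F v ≤ G v) →
    signAvg l F ≤ signAvg l G := by
  induction l with
  | nil => intro F G h; exact h 0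
  | cons a l ih =>
    intro F G h
    have h1 := ih (F := fun v => F (v + a)) (G := fun v => G (v + a)) fun v => h _
    have h2 := ih (F := fun v => F (v - a)) (G := fun v => G (v - a)) fun v => h _
    simp only [signAvg]
    linarith

lemma signAvg_add (l : List V) : ∀ F G : V → ℝ,
    signAvg l (fun v => F v + G v) = signAvg l F + signAvg l G := by
  induction l with
  | nil => intro F G; rfl
  | cons a l ih =>
    intro F G
    simp only [signAvg, ih (fun v => F (v + a)), ih (fun v => F (v - a))]
    ring

lemma signAvg_mul (l : List V) (c : ℝ) : ∀ F : V → ℝ,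
    signAvg l (fun v => c * F v) = c * signAvg l F := by
  induction l with
  | nil => intro F; rfl
  | cons a l ih =>
    intro F
    simp only [signAvg, ih (fun v => F (v + a)), ih (fun v => F (v - a))]
    ring

lemma signAvg_const (l : List V) (c : ℝ) : signAvg l (fun _ => c) = c := by
  induction l with
  | nil => rfl
  | cons a l ih => simp only [signAvg, ih]; ring

lemma signAvg_neg (l : List V) : ∀ F : V → ℝ, signAvg l (fun v => F (-v)) = signAvg l F := by
  induction l with
  | nil => intro F; simp [signAvg]
  | cons a l ih =>
    intro F
    have h1 := ih fun v => F (v - a)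
    have h2 := ih fun v => F (v + a)
    simp only [signAvg]
    rw [← h1, ← h2, add_comm]
    congr 3 <;> · funext v; congr 1; abel

lemma signAvg_odd (l : List V) {F : V → ℝ} (h : ∀ v, F (-v) = -F v) : signAvg l F = 0 := by
  have h1 := signAvg_neg l F
  have h2 := signAvg_mul l (-1) F
  simp only [h] at h1
  simp only [neg_one_mul] at h2
  linarith

lemma signAvg_append (l₁ l₂ : List V) : ∀ F : V → ℝ, signAvg (l₁ ++ l₂) F =
    signAvg l₁ fun u => signAvg l₂ fun v => F (v + u) := by
  induction l₁ with
  | nil => intro F; simp [signAvg]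
  | cons a l ih =>
    intro F
    simp only [List.cons_append, signAvg, ih]
    simp only [add_assoc, add_sub_assoc]

lemma signAvg_map {W : Type*} [AddCommGroup W] (f : V →+ W) (l : List V) : ∀ F : W → ℝ,
    signAvg (l.map f) F = signAvg l fun v => F (f v) := by
  induction l with
  | nil => intro F; simp [signAvg]
  | cons a l ih => intro F; simp [signAvg, ih]

lemma signAvg_abs_le (l : List V) (F : V → ℝ) : |signAvg l F| ≤ signAvg l fun v => |F v| := by
  rw [abs_le]
  constructor
  · have := signAvg_mul l (-1) fun v => |F v|
    rw [neg_one_mul] at this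
    rw [← this]
    exact signAvg_mono l fun v => by simpa using neg_abs_le (F v)
  · exact signAvg_mono l fun v => le_abs_self _

lemma signAvg_congr_of_abs_le (l : List ℝ) : ∀ {F G : ℝ → ℝ},
    (∀ y, |y| ≤ (l.map abs).sum → F y = G y) → signAvg l F = signAvg l G := by
  induction l with
  | nil => intro F G h; exact h 0 (by simp)
  | cons a l ih =>
    intro F G h
    simp only [List.map_cons, List.sum_cons] at h
    simp only [signAvg]
    rw [ih (G := fun v => G (v + a)) fun y hy => h _ ((abs_add_le _ _).trans (by linarith)),
      ih (G := fun v => G (v - a)) fun y hy => h _ ((abs_sub _ _).trans (by linarith))]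

lemma signAvg_sq (l : List ℝ) : ∀ c, signAvg l (fun x => (x + c) ^ 2) =
    c ^ 2 + (l.map (· ^ 2)).sum := by
  induction l with
  | nil => intro c; simp [signAvg]
  | cons a l ih =>
    intro c
    simp only [signAvg, List.map_cons, List.sum_cons, add_assoc, sub_eq_add_neg, ih]
    ring

lemma signAvg_cos (l : List ℝ) : ∀ c, signAvg l (fun x => Real.cos (x + c)) =
    Real.cos c * (l.map Real.cos).prod := by
  induction l with
  | nil => intro c; simp [signAvg]
  | cons a l ih =>
    intro c
    simp only [signAvg, List.map_cons, List.prod_cons, add_assoc, sub_eq_add_neg, ih]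
    rw [Real.cos_add, Real.cos_add, Real.cos_neg, Real.sin_neg]
    ring

/-- Integer multiples of `π` in the phases only produce a sign. -/
lemma signAvg_cos_pair (l : List (ℝ × ℝ)) (hl : ∀ p ∈ l, ∃ n : ℤ, p.1 = p.2 + n * Real.pi) :
    ∃ s : ℝ, |s| = 1 ∧ ∀ (G : ℝ × ℝ → ℝ) (y : ℝ), signAvg l (fun x => G x * Real.cos (x.1 + y)) =
      s * signAvg l (fun x => G x * Real.cos (x.2 + y)) := by
  induction l with
  | nil => exact ⟨1, by simp, fun G y => by simp [signAvg]⟩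
  | cons p l ih =>
    obtain ⟨s, hs, h⟩ := ih fun q hq => hl q (List.mem_cons_of_mem _ hq)
    obtain ⟨n, hn⟩ := hl p List.mem_cons_self
    refine ⟨s * (-1) ^ n, by simp [abs_mul, hs, abs_zpow], fun G y => ?_⟩
    have h1 := h (fun x => G (x + p)) (p.1 + y)
    have h2 := h (fun x => G (x - p)) (-p.1 + y)
    have e1 : ∀ x : ℝ × ℝ, G (x + p) * Real.cos (x.2 + (p.1 + y))
        = (-1) ^ n * (G (x + p) * Real.cos (x.2 + p.2 + y)) := fun x => by
      rw [show x.2 + (p.1 + y) = x.2 + p.2 + y + n * Real.pi by rw [hn]; ring,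
        Real.cos_add_int_mul_pi]
      ring
    have e2 : ∀ x : ℝ × ℝ, G (x - p) * Real.cos (x.2 + (-p.1 + y))
        = (-1) ^ n * (G (x - p) * Real.cos (x.2 - p.2 + y)) := fun x => by
      rw [show x.2 + (-p.1 + y) = x.2 - p.2 + y - n * Real.pi by rw [hn]; ring,
        Real.cos_sub_int_mul_pi]
      ring
    simp only [e1, signAvg_mul] at h1
    simp only [e2, signAvg_mul] at h2
    simp only [← add_assoc] at h1 h2
    simp only [← sub_eq_add_neg] at h2
    simp only [signAvg, Prod.fst_add, Prod.snd_add, Prod.fst_sub, Prod.snd_sub]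
    rw [h1, h2]
    ring

end signAvg

/-- The list `z, z b, z b², …` of length `n`. -/
noncomputable def geo (b : ℝ) : ℕ → ℝ → List ℝ
  | 0, _ => []
  | n+1, z => z :: geo b n (z * b)

lemma geo_add (b : ℝ) (m n : ℕ) : ∀ z, geo b (m + n) z = geo b m z ++ geo b n (z * b ^ m) := by
  induction m with
  | zero => intro z; simp [geo]
  | succ m ih =>
    intro z
    rw [Nat.succ_add]
    simp only [geo, ih, List.cons_append]
    rw [pow_succ', mul_assoc]

lemma geo_mul (b c : ℝ) (n : ℕ) : ∀ z, geo b n (c * z) = (geo b n z).map (c * ·) := by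
  induction n with
  | zero => intro z; rfl
  | succ n ih => intro z; simp only [geo, List.map_cons, ← ih, mul_assoc]

lemma sum_geo_le {b : ℝ} (hb : 0 ≤ b) (hb1 : b < 1) (n : ℕ) : ∀ {z : ℝ}, 0 ≤ z →
    ((geo b n z).map abs).sum ≤ z / (1 - b) := by
  induction n with
  | zero => intro z hz; simpa [geo] using div_nonneg hz (by linarith)
  | succ n ih =>
    intro z hz
    have h := ih (z := z * b) (by positivity)
    simp only [geo, List.map_cons, List.sum_cons, abs_of_nonneg hz]
    have : z + z * b / (1 - b) = z / (1 - b) := by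
      have : 1 - b ≠ 0 := by linarith
      field_simp
      ring
    linarith

lemma sum_sq_geo_le {b : ℝ} (hb : 0 ≤ b) (hb1 : b < 1) (n : ℕ) : ∀ z : ℝ,
    ((geo b n z).map (· ^ 2)).sum ≤ z ^ 2 / (1 - b ^ 2) := by
  have hb2 : b ^ 2 < 1 := by nlinarith
  induction n with
  | zero => intro z; simpa [geo] using div_nonneg (sq_nonneg z) (by linarith)
  | succ n ih =>
    intro z
    have h := ih (z * b)
    simp only [geo, List.map_cons, List.sum_cons]
    have : z ^ 2 + (z * b) ^ 2 / (1 - b ^ 2) = z ^ 2 / (1 - b ^ 2) := by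
      have : 1 - b ^ 2 ≠ 0 := by linarith
      field_simp
      ring
    linarith

lemma avg_eq_signAvg (b : ℝ) (n : ℕ) : ∀ (z : ℝ) (F : ℝ → ℝ),
    avg (fun w : Fin n → Fin 2 => F (∑ k, (2 * (w k : ℕ) - 1) * (z * b ^ (k : ℕ))))
      = signAvg (geo b n z) F := by
  induction n with
  | zero => intro z F; simp [avg, geo, signAvg]
  | succ n ih =>
    intro z F
    simp only [geo, signAvg, ← ih]
    simp only [avg, sum_cons, Fin.sum_univ_succ, Fin.cons_zero, Fin.cons_succ]
    rw [pow_succ, ← div_div, ← add_div, add_comm (∑ x, F _)]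
    congr 4
    all_goals
      funext w
      congr 1
      simp only [Fin.val_zero, Fin.val_one, Fin.val_succ, pow_zero, pow_succ']
      push_cast
      simp only [mul_assoc]
      ring

/-! ### Perturbing a cost function -/

lemma abs_piBeta_sub_sum_le {β : ℝ} (hβ : 1 < β) (n : ℕ) : ∀ x : ℕ → Fin 2,
    |piBeta β x - 1 / 2 - ∑ k : Fin n, (2 * (x k : ℕ) - 1) * ((1 - β⁻¹) / 2 * β⁻¹ ^ (k : ℕ))|
      ≤ β⁻¹ ^ n / 2 := by
  induction n with
  | zero =>
    intro x
    have := piBeta_mem hβ x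
    rw [abs_le]
    simp only [Finset.univ_eq_empty, Finset.sum_empty, pow_zero]
    constructor <;> linarith [this.1, this.2]
  | succ n ih =>
    intro x
    have h := ih fun k => x (k + 1)
    have hs := piBeta_shift hβ x
    have hb : β * β⁻¹ = 1 := mul_inv_cancel₀ (by linarith)
    have hb0 : 0 < β⁻¹ := by positivity
    set S := ∑ k : Fin n, (2 * ((x (k + 1) : Fin 2) : ℕ) - 1 : ℝ) * ((1 - β⁻¹) / 2 * β⁻¹ ^ (k : ℕ))
    have e : ∑ k : Fin (n + 1), (2 * ((x k : Fin 2) : ℕ) - 1 : ℝ) * ((1 - β⁻¹) / 2 * β⁻¹ ^ (k : ℕ))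
        = (2 * ((x 0 : Fin 2) : ℕ) - 1) * ((1 - β⁻¹) / 2) + β⁻¹ * S := by
      rw [Fin.sum_univ_succ, Finset.mul_sum]
      simp only [Fin.val_zero, pow_zero, mul_one, Fin.val_succ]
      congr 1
      refine Finset.sum_congr rfl fun k _ => ?_
      rw [pow_succ]
      ring
    have e2 : piBeta β x = β⁻¹ * (β * piBeta β x) := by rw [← mul_assoc, mul_comm β⁻¹, hb, one_mul]
    rw [e, e2, hs]
    have e3 : β⁻¹ * (((x 0 : Fin 2) : ℕ) * (β - 1) + piBeta β (fun k => x (k + 1))) - 1 / 2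
        - ((2 * ((x 0 : Fin 2) : ℕ) - 1) * ((1 - β⁻¹) / 2) + β⁻¹ * S)
        = β⁻¹ * (piBeta β (fun k => x (k + 1)) - 1 / 2 - S) := by
      linear_combination ((x 0 : Fin 2) : ℕ) * hb
    rw [e3, abs_mul, abs_of_pos hb0, pow_succ', mul_div_assoc]
    exact mul_le_mul_of_nonneg_left h hb0.le

lemma avg_add {n : ℕ} (f g : (Fin n → Fin 2) → ℝ) : avg (fun w => f w + g w) = avg f + avg g := by
  simp only [avg, Finset.sum_add_distrib, add_div]

lemma avg_const {n : ℕ} (c : ℝ) : avg (fun _ : Fin n → Fin 2 => c) = c := by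
  simp [avg]

/-- The average of a function of the first letters. -/
lemma avg_castLE {n : ℕ} (f : (Fin n → Fin 2) → ℝ) : ∀ {N : ℕ} (h : n ≤ N),
    avg (fun w : Fin N → Fin 2 => f fun i => w (Fin.castLE h i)) = avg f := by
  induction n with
  | zero =>
    intro N h
    have : ∀ w : Fin N → Fin 2, (fun i => w (Fin.castLE h i)) = Fin.elim0 :=
      fun w => funext fun i => i.elim0
    simp only [this, avg_const]
    rw [← avg_const (n := 0) (f Fin.elim0)]
    congr 1
    funext w
    congr 1
    exact funext fun i => i.elim0
  | succ n ih =>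
    intro N h
    obtain ⟨N, rfl⟩ : ∃ N', N = N' + 1 := ⟨N - 1, by omega⟩
    have h' : n ≤ N := by omega
    have e : ∀ (a : Fin 2) (w : Fin N → Fin 2),
        (fun i => (Fin.cons a w : Fin (N + 1) → Fin 2) (Fin.castLE h i))
          = Fin.cons a fun i => w (Fin.castLE h' i) := fun a w => by
      funext i
      refine Fin.cases ?_ (fun i => ?_) i
      · rfl
      · rfl
    have h0 := ih (fun w => f (Fin.cons 0 w)) h'
    have h1 := ih (fun w => f (Fin.cons 1 w)) h'
    simp only [avg, sum_cons, e, pow_succ, ← div_div, add_div] at h0 h1 ⊢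
    rw [h0, h1]

lemma CostBound.add {β : ℝ} (hβ : 1 < β) {Φ v : ℝ → ℝ} {H : ℝ} (h : CostBound β Φ H)
    (hv : UniformContinuous v) {K : ℕ} {G G' : ℝ} (hG : ∃ᶠ M in atTop,
      signAvg (geo β⁻¹ (K + M) ((1 - β⁻¹) / 2)) (fun y => v (y + (β - 1) / 2)) ≤ -G) (hGG : G' < G) :
    CostBound β (fun s => Φ s + v s) (H - G') := by
  obtain ⟨r, hr, n, C, hC, hH⟩ := h
  obtain ⟨d, hd, hvd⟩ := Metric.uniformContinuous_iff.1 hv (G - G') (by linarith)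
  have hb0 : 0 < β⁻¹ := by positivity
  have hb1 : β⁻¹ < 1 := inv_lt_one_of_one_lt₀ hβ
  obtain ⟨M₁, hM₁⟩ := exists_pow_lt_of_lt_one hd hb1
  obtain ⟨M₂, hM₂, h0⟩ := (Filter.frequently_atTop.1 hG) (n + M₁)
  set N := K + M₂ with hN
  have hn : n ≤ N := by omega
  refine ⟨min r (d / 2), by positivity, N, fun w => C (fun i => w (Fin.castLE hn i)) +
    (v (∑ k, (2 * (w k : ℕ) - 1) * ((1 - β⁻¹) / 2 * β⁻¹ ^ (k : ℕ)) + (β - 1) / 2) + (G - G')),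
    fun x t ht => ?_, ?_⟩
  · refine add_le_add (hC x t (ht.trans (min_le_left _ _))) ?_
    have h1 := abs_piBeta_sub_sum_le hβ N x
    have h2 := ht.trans (min_le_right _ _)
    have h3 : β⁻¹ ^ N < d := (pow_le_pow_of_le_one hb0.le hb1.le (by omega)).trans_lt hM₁
    have h4 := hvd (a := t) (b := ∑ k : Fin N, (2 * ((x k : Fin 2) : ℕ) - 1)
      * ((1 - β⁻¹) / 2 * β⁻¹ ^ (k : ℕ)) + (β - 1) / 2) (by
        rw [Real.dist_eq, abs_lt]
        rw [pos] at h2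
        rw [abs_le] at h1 h2
        constructor <;> linarith [h1.1, h1.2, h2.1, h2.2])
    rw [Real.dist_eq] at h4
    linarith [(abs_lt.1 h4).2]
  · rw [avg_add, avg_add, avg_const, avg_castLE]
    rw [← avg_eq_signAvg] at h0
    linarith

/-! ### An oscillating perturbation -/

/-- The bump `1 - (s / r)²` on `[-r, r]`. -/
noncomputable def bump (r s : ℝ) : ℝ := 1 - (min 1 (|s| / r)) ^ 2

lemma bump_neg (r s : ℝ) : bump r (-s) = bump r s := by simp [bump]

lemma bump_eq_zero {r s : ℝ} (hr : 0 < r) (h : r ≤ |s|) : bump r s = 0 := by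
  rw [bump, min_eq_left ((one_le_div hr).2 h)]
  norm_num

lemma min_one_mem {r : ℝ} (hr : 0 < r) (s : ℝ) : 0 ≤ min 1 (|s| / r) ∧ min 1 (|s| / r) ≤ 1 :=
  ⟨le_min zero_le_one (by positivity), min_le_left _ _⟩

lemma bump_nonneg {r : ℝ} (hr : 0 < r) (s : ℝ) : 0 ≤ bump r s := by
  have := min_one_mem hr s
  rw [bump]
  nlinarith

lemma bump_le_one (r s : ℝ) : bump r s ≤ 1 := by
  rw [bump]
  linarith [sq_nonneg (min 1 (|s| / r))]

lemma le_bump {r : ℝ} (hr : 0 < r) (s : ℝ) : 1 - s ^ 2 / r ^ 2 ≤ bump r s := by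
  have h1 := min_one_mem hr s
  have h2 : min 1 (|s| / r) ^ 2 ≤ (|s| / r) ^ 2 := pow_le_pow_left₀ h1.1 (min_le_right _ _) 2
  rw [div_pow, sq_abs] at h2
  rw [bump]
  linarith

lemma abs_bump_sub_le {r : ℝ} (hr : 0 < r) (s t : ℝ) : |bump r s - bump r t| ≤ 2 / r * |s - t| := by
  have h1 := min_one_mem hr s
  have h2 := min_one_mem hr t
  have h3 : |min 1 (|s| / r) - min 1 (|t| / r)| ≤ |s - t| / r := by
    refine (abs_min_sub_min_le_max _ _ _ _).trans ?_
    rw [sub_self, abs_zero, ← sub_div, abs_div, abs_of_pos hr]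
    exact max_le (by positivity)
      (div_le_div_of_nonneg_right (abs_abs_sub_abs_le s t) hr.le)
  have e : bump r s - bump r t
      = (min 1 (|s| / r) - min 1 (|t| / r)) * -(min 1 (|s| / r) + min 1 (|t| / r)) := by
    rw [bump, bump]
    ring
  rw [e, abs_mul, abs_neg, abs_of_nonneg (add_nonneg h1.1 h2.1)]
  calc _ ≤ |s - t| / r * 2 := by gcongr; linarith
    _ = _ := by ring

lemma continuous_bump (r : ℝ) : Continuous (bump r) := by unfold bump; fun_prop

/-- The relative change of the weights. -/
noncomputable def wave (r ω ε s : ℝ) : ℝ := ε * (bump r s * Real.sin (ω * s))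

lemma wave_neg (r ω ε s : ℝ) : wave r ω ε (-s) = -wave r ω ε s := by
  simp only [wave, bump_neg, mul_neg, Real.sin_neg]

lemma wave_eq_zero {r ω ε s : ℝ} (hr : 0 < r) (h : r ≤ |s|) : wave r ω ε s = 0 := by
  rw [wave, bump_eq_zero hr h]
  ring

lemma abs_wave_le {r ω ε : ℝ} (hr : 0 < r) (s : ℝ) : |wave r ω ε s| ≤ |ε| := by
  rw [wave, abs_mul, abs_mul, abs_of_nonneg (bump_nonneg hr s)]
  have := mul_le_one₀ (bump_le_one r s) (abs_nonneg _) (Real.abs_sin_le_one (ω * s))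
  exact mul_le_of_le_one_right (abs_nonneg _) this

lemma neg_log_one_add_le {u : ℝ} (hu : |u| ≤ 1 / 21) : -Real.log (1 + u) ≤ -u + 11 / 20 * u ^ 2 := by
  have h := Real.abs_log_sub_add_sum_range_le (x := -u) (by rw [abs_neg]; linarith) 2
  rw [abs_neg, sub_neg_eq_add] at h
  norm_num [Finset.sum_range_succ] at h
  have h3 : |u| ^ 3 / (1 - |u|) ≤ u ^ 2 / 20 := by
    rw [div_le_iff₀ (by linarith), pow_succ, sq_abs]
    nlinarith [sq_nonneg u]
  have := (abs_le.1 (h.trans h3)).1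
  nlinarith [sq_nonneg u]

lemma wave_valid {β : ℝ} {g : ℕ} {r H ω ε : ℝ} {Φ : ℝ → ℝ} (hr : 0 < r) (hε : |ε| ≤ 1 / 21)
    (h : Tuned β g r Φ H) (s : ℝ) : Real.exp (-(Φ s + -Real.log (1 + wave r ω ε s)))
      + Real.exp (-(Φ (-s) + -Real.log (1 + wave r ω ε (-s)))) ≤ 1 := by
  have hpos : ∀ t, 0 < 1 + wave r ω ε t := fun t => by
    have := (abs_le.1 ((abs_wave_le (ω := ω) (ε := ε) hr t).trans hε)).1
    linarith
  have h1 := h.1 s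
  have e : ∀ t, Real.exp (-(Φ t + -Real.log (1 + wave r ω ε t)))
      = Real.exp (-Φ t) * (1 + wave r ω ε t) := fun t => by
    rw [neg_add, neg_neg, Real.exp_add, Real.exp_log (hpos t)]
  rw [e, e, wave_neg]
  rcases lt_or_ge |s| r with hs | hs
  · rw [h.2.1 s hs, h.2.1 (-s) (by rwa [abs_neg])] at h1 ⊢
    linarith
  · rw [wave_eq_zero hr hs]
    linarith

lemma uniformContinuous_log_wave {r ω ε : ℝ} (hr : 0 < r) (hε : |ε| ≤ 1 / 21) :
    UniformContinuous fun s => -Real.log (1 + wave r ω ε s) := by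
  have hpos : ∀ t, 0 < 1 + wave r ω ε t := fun t => by
    have := (abs_le.1 ((abs_wave_le (ω := ω) (ε := ε) hr t).trans hε)).1
    linarith
  have hc : Continuous (wave r ω ε) := by
    have := continuous_bump r
    unfold wave
    fun_prop
  refine Continuous.uniformContinuous_of_tendsto_cocompact (x := 0) ?_ ?_
  · exact ((continuous_const.add hc).log fun t => (hpos t).ne').neg
  · refine tendsto_const_nhds.congr' ?_
    have : {s : ℝ | r ≤ |s|} ∈ cocompact ℝ := by
      rw [mem_cocompact]
      refine ⟨Metric.closedBall 0 r, isCompact_closedBall _ _, fun s hs => ?_⟩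
      rw [Set.mem_compl_iff, Metric.mem_closedBall, dist_zero_right, Real.norm_eq_abs, not_le] at hs
      exact hs.le
    filter_upwards [this] with s hs
    rw [wave_eq_zero hr hs]
    simp

/-- Only words that start with `000` contribute to the average of a function supported near `0`. -/
lemma signAvg_three {F : ℝ → ℝ} {b z r c : ℝ} (hF : ∀ s, r ≤ s → F s = 0) (hb : 0 < b) (hb1 : b < 1)
    (hz : 0 < z) (h : r ≤ c - z - z * b + z * b ^ 2 - z * b ^ 3 / (1 - b)) (M : ℕ) :
    signAvg (geo b (3 + M) z) (fun y => F (y + c))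
      = signAvg (geo b M (z * b ^ 3)) (fun y => F (y + (c - z - z * b - z * b ^ 2))) / 8 := by
  have hs : ∀ y, |y| ≤ ((geo b M (z * b ^ 3)).map abs).sum → -(z * b ^ 3 / (1 - b)) ≤ y :=
    fun y hy => (abs_le.1 (hy.trans (sum_geo_le hb.le hb1 M (by positivity)))).1
  have h1 : 0 < z * b := by positivity
  have h2 : 0 < z * b ^ 2 := by positivity
  have key : ∀ d, c - z - z * b + z * b ^ 2 ≤ d →
      signAvg (geo b M (z * b ^ 3)) (fun y => F (y + d)) = 0 := fun d hd => by
    rw [signAvg_congr_of_abs_le _ (G := fun _ => 0) fun y hy => hF _ (by linarith [hs y hy]),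
      signAvg_const]
  rw [geo_add]
  simp only [geo, List.cons_append, List.nil_append, signAvg, sub_eq_add_neg, add_assoc]
  rw [key, key, key, key, key, key, key]
  · simp only [zero_add, add_zero]
    have e : -(z * b * b) + (-(z * b) + (-z + c)) = c + (-z + (-(z * b) + -(z * b ^ 2))) := by ring
    rw [e]
    ring
  all_goals nlinarith

lemma geo_eq_map (b : ℝ) (n : ℕ) : ∀ z, geo b n z = (List.range n).map fun k => z * b ^ k := by
  induction n with
  | zero => intro z; rfl
  | succ n ih =>
    intro z
    rw [geo, ih, List.range_succ_eq_map, List.map_cons, List.map_map]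
    simp only [pow_zero, mul_one, List.cons.injEq, true_and]
    refine List.map_congr_left fun k _ => ?_
    simp only [Function.comp_apply, pow_succ]
    ring

lemma list_sum_map_range (f : ℕ → ℝ) (n : ℕ) :
    ((List.range n).map f).sum = ∑ k ∈ Finset.range n, f k := by
  induction n with
  | zero => rfl
  | succ n ih => simp [List.range_succ, Finset.sum_range_succ, ih]

lemma signAvg_sub (l : List ℝ) (F G : ℝ → ℝ) :
    signAvg l (fun v => F v - G v) = signAvg l F - signAvg l G := by
  have h := signAvg_add l F fun v => -1 * G v
  rw [signAvg_mul] at h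
  simp only [neg_one_mul, ← sub_eq_add_neg] at h
  exact h

lemma abs_signAvg_sub_le (l : List ℝ) {F G D : ℝ → ℝ} (h : ∀ v, |F v - G v| ≤ D v) :
    |signAvg l F - signAvg l G| ≤ signAvg l D := by
  rw [← signAvg_sub]
  exact (signAvg_abs_le _ _).trans (signAvg_mono _ h)

lemma signAvg_abs_le_of_sq {l : List ℝ} {t : ℝ} (ht : 0 < t) (h : (l.map (· ^ 2)).sum ≤ t ^ 2) :
    signAvg l (fun v => |v|) ≤ t := by
  have h1 : signAvg l (fun v => |v|) ≤ signAvg l (fun v => t / 2 + 1 / (2 * t) * (v + 0) ^ 2) := by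
    refine signAvg_mono l fun v => ?_
    have : t / 2 + 1 / (2 * t) * (v + 0) ^ 2 - |v| = (t - |v|) ^ 2 / (2 * t) := by
      rw [add_zero, ← sq_abs v]
      field_simp
      ring
    have h2 : 0 ≤ (t - |v|) ^ 2 / (2 * t) := by positivity
    linarith
  rw [signAvg_add, signAvg_const, signAvg_mul, signAvg_sq] at h1
  refine h1.trans ?_
  have : 1 / (2 * t) * (0 ^ 2 + (l.map (· ^ 2)).sum) ≤ 1 / (2 * t) * t ^ 2 := by
    gcongr
    linarith
  have e : 1 / (2 * t) * t ^ 2 = t / 2 := by field_simp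
  linarith

/-- If the phases are close to multiples of `π`, the cosine is close to a fixed sign. -/
lemma le_abs_signAvg_bump_cos {r ω z b V F : ℝ} (hr : 0 < r) (hω : 0 < ω) (hb : 0 ≤ b) (hb1 : b < 1)
    (m : ℕ) (N : ℕ → ℤ) (hV : z ^ 2 / (1 - b ^ 2) ≤ V * r ^ 2)
    (hF : ∑ k ∈ Finset.range m, (ω * z * b ^ k - N k * Real.pi) ^ 2 ≤ F) :
    1 - V - F / 2 ≤ |signAvg (geo b m z) fun y => bump r y * Real.cos (ω * y)| := by
  set l : List (ℝ × ℝ) := (List.range m).map fun k =>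
    (ω * (z * b ^ k), ω * (z * b ^ k) - N k * Real.pi) with hl
  obtain ⟨s, hs, h⟩ := signAvg_cos_pair l (fun p hp => by
    obtain ⟨k, _, rfl⟩ := List.mem_map.1 hp
    exact ⟨N k, by ring⟩)
  have e1 : signAvg (geo b m z) (fun y => bump r y * Real.cos (ω * y))
      = s * signAvg l (fun x => bump r (x.1 / ω) * Real.cos (x.2 + 0)) := by
    rw [← h]
    have : l.map (AddMonoidHom.fst ℝ ℝ) = (geo b m z).map (AddMonoidHom.mulLeft ω) := by
      rw [hl, geo_eq_map, List.map_map, List.map_map]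
      rfl
    have e2 := signAvg_map (AddMonoidHom.fst ℝ ℝ) l fun x => bump r (x / ω) * Real.cos (x + 0)
    have e3 := signAvg_map (AddMonoidHom.mulLeft ω) (geo b m z)
      fun x => bump r (x / ω) * Real.cos (x + 0)
    rw [this, e3] at e2
    simp only [AddMonoidHom.coe_mulLeft, mul_div_cancel_left₀ _ hω.ne', add_zero,
      AddMonoidHom.coe_fst] at e2
    simpa using e2
  rw [e1, abs_mul, hs, one_mul]
  refine le_trans ?_ (le_abs_self _)
  have h1 : ∀ x : ℝ × ℝ, 1 + (-1 / r ^ 2 * (x.1 / ω + 0) ^ 2 + -1 / 2 * (x.2 + 0) ^ 2)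
      ≤ bump r (x.1 / ω) * Real.cos (x.2 + 0) := fun x => by
    have h2 := le_bump hr (x.1 / ω)
    have h3 := bump_nonneg hr (x.1 / ω)
    have h4 := bump_le_one r (x.1 / ω)
    have h5 := Real.one_sub_sq_div_two_le_cos (x := x.2 + 0)
    have h6 := mul_le_mul_of_nonneg_left h5 h3
    have h7 := mul_le_mul_of_nonneg_right h4 (sq_nonneg (x.2 + 0))
    have h8 : -1 / r ^ 2 * (x.1 / ω + 0) ^ 2 = -((x.1 / ω) ^ 2 / r ^ 2) := by
      rw [add_zero]
      ring
    rw [h8]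
    linarith
  refine le_trans ?_ (signAvg_mono l h1)
  rw [signAvg_add, signAvg_const, signAvg_add, signAvg_mul, signAvg_mul]
  have e4 := signAvg_map (AddMonoidHom.fst ℝ ℝ) l fun x => (x / ω + 0) ^ 2
  have e5 := signAvg_map (AddMonoidHom.snd ℝ ℝ) l fun x => (x + 0) ^ 2
  have e6 : l.map (AddMonoidHom.fst ℝ ℝ) = (geo b m z).map (AddMonoidHom.mulLeft ω) := by
    rw [hl, geo_eq_map, List.map_map, List.map_map]
    rfl
  have e7 := signAvg_map (AddMonoidHom.mulLeft ω) (geo b m z) fun x => (x / ω + 0) ^ 2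
  rw [e6, e7] at e4
  simp only [AddMonoidHom.coe_mulLeft, mul_div_cancel_left₀ _ hω.ne', AddMonoidHom.coe_fst] at e4
  simp only [AddMonoidHom.coe_snd] at e5
  rw [← e4, ← e5, signAvg_sq, signAvg_sq]
  have h9 : ((l.map Prod.snd).map (· ^ 2)).sum ≤ F := by
    rw [hl, List.map_map, List.map_map, list_sum_map_range]
    simpa [mul_assoc] using hF
  have h10 : ((geo b m z).map (· ^ 2)).sum / r ^ 2 ≤ V := by
    rw [div_le_iff₀ (by positivity)]
    exact (sum_sq_geo_le hb hb1 m z).trans hV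
  have h11 : -1 / r ^ 2 * (0 ^ 2 + ((geo b m z).map (· ^ 2)).sum)
      = -(((geo b m z).map (· ^ 2)).sum / r ^ 2) := by ring
  rw [h11]
  linarith

lemma le_abs_signAvg_bump_sin {r ω z b V F P t σ κ : ℝ} (hr : 0 < r) (hω : 0 < ω) (hb : 0 ≤ b)
    (hb1 : b < 1) (m L : ℕ) (N : ℕ → ℤ) (hV : z ^ 2 / (1 - b ^ 2) ≤ V * r ^ 2)
    (hF : ∑ k ∈ Finset.range m, (ω * z * b ^ k - N k * Real.pi) ^ 2 ≤ F)
    (hP0 : 0 ≤ P)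
    (hP : P ≤ |((geo b L (ω * z * b ^ m)).map Real.cos).prod|) (ht : 0 < t)
    (hzt : (z * b ^ m) ^ 2 / (1 - b ^ 2) ≤ t ^ 2) (hσ0 : 0 ≤ σ) (hσ : σ ≤ |Real.sin (ω * κ)|) :
    σ * (P * (1 - V - F / 2) - 2 / r * t) - 2 / r * |κ|
      ≤ |signAvg (geo b (m + L) z) fun y => bump r (y + κ) * Real.sin (ω * (y + κ))| := by
  set A := signAvg (geo b (m + L) z) fun y => bump r y * Real.cos (ω * y) with hA
  set A₂ := signAvg (geo b m z) fun y => bump r y * Real.cos (ω * y) with hA₂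
  set Q := ((geo b L (ω * z * b ^ m)).map Real.cos).prod with hQ
  have h1 : |signAvg (geo b (m + L) z) (fun y => bump r (y + κ) * Real.sin (ω * (y + κ)))
      - Real.sin (ω * κ) * A| ≤ 2 / r * |κ| := by
    have e1 : signAvg (geo b (m + L) z) (fun y => bump r y * Real.sin (ω * (y + κ)))
        = Real.sin (ω * κ) * A := by
      have e2 : ∀ y, bump r y * Real.sin (ω * (y + κ))
          = Real.sin (ω * κ) * (bump r y * Real.cos (ω * y))
            + Real.cos (ω * κ) * (bump r y * Real.sin (ω * y)) := fun y => by
        rw [mul_add, Real.sin_add]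
        ring
      simp only [e2]
      rw [signAvg_add, signAvg_mul, signAvg_mul,
        signAvg_odd (F := fun y => bump r y * Real.sin (ω * y)) _ fun y => by
          rw [bump_neg, mul_neg, Real.sin_neg, mul_neg], mul_zero, add_zero]
    rw [← e1]
    refine (abs_signAvg_sub_le _ (D := fun _ => 2 / r * |κ|) fun y => ?_).trans
      (signAvg_const _ _).le
    rw [← sub_mul, abs_mul]
    have := abs_bump_sub_le hr (y + κ) y
    rw [add_sub_cancel_left] at this
    exact (mul_le_of_le_one_right (abs_nonneg _) (Real.abs_sin_le_one _)).trans this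
  have h2 : |A - A₂ * Q| ≤ 2 / r * t := by
    have e1 : signAvg (geo b m z) (fun u => signAvg (geo b L (z * b ^ m))
        fun v => bump r u * Real.cos (ω * (v + u))) = A₂ * Q := by
      have e2 : ∀ u, signAvg (geo b L (z * b ^ m)) (fun v => bump r u * Real.cos (ω * (v + u)))
          = Q * (bump r u * Real.cos (ω * u)) := fun u => by
        have e3 := signAvg_map (AddMonoidHom.mulLeft ω) (geo b L (z * b ^ m))
          fun x => Real.cos (x + ω * u)
        simp only [AddMonoidHom.coe_mulLeft] at e3
        rw [signAvg_mul]
        simp only [mul_add]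
        rw [← e3, ← geo_mul, signAvg_cos, hQ, mul_assoc ω z]
        ring
      simp only [e2]
      rw [signAvg_mul, mul_comm]
    rw [← e1, hA, geo_add, signAvg_append]
    refine (abs_signAvg_sub_le _ (D := fun _ => 2 / r * t) fun u => ?_).trans
      (signAvg_const _ _).le
    refine (abs_signAvg_sub_le _ (D := fun v => 2 / r * |v|) fun v => ?_).trans ?_
    · rw [← sub_mul, abs_mul]
      have := abs_bump_sub_le hr (v + u) u
      rw [add_sub_cancel_right] at this
      exact (mul_le_of_le_one_right (abs_nonneg _) (Real.abs_cos_le_one _)).trans this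
    · rw [signAvg_mul]
      exact mul_le_mul_of_nonneg_left
        (signAvg_abs_le_of_sq ht ((sum_sq_geo_le hb hb1 _ _).trans hzt)) (by positivity)
  have h3 : P * (1 - V - F / 2) ≤ |A₂ * Q| := by
    rw [abs_mul, mul_comm]
    exact mul_le_mul (le_abs_signAvg_bump_cos hr hω hb hb1 m N hV hF) hP hP0 (abs_nonneg _)
  have h4 : P * (1 - V - F / 2) - 2 / r * t ≤ |A| := by
    have := abs_sub_abs_le_abs_sub (A₂ * Q) A
    rw [abs_sub_comm] at this
    linarith
  have h5 : σ * (P * (1 - V - F / 2) - 2 / r * t) ≤ |Real.sin (ω * κ) * A| := by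
    rw [abs_mul]
    exact (mul_le_mul_of_nonneg_left h4 hσ0).trans (mul_le_mul_of_nonneg_right hσ (abs_nonneg _))
  have := abs_sub_abs_le_abs_sub (Real.sin (ω * κ) * A)
    (signAvg (geo b (m + L) z) fun y => bump r (y + κ) * Real.sin (ω * (y + κ)))
  rw [abs_sub_comm] at this
  linarith

/-! ### Parameters near the tribonacci number -/

/-- Tribonacci numbers. -/
def trib (n : ℕ) : ℕ := [0, 1, 1, 2, 4, 7, 13, 24, 44, 81, 149, 274, 504, 927, 1705, 3136, 5768,
  10609, 19513, 35890, 66012, 121415, 223317, 410744, 755476, 1389537, 2555757, 4700770].getD n 0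

/-- An approximation of the inverse of the tribonacci number. -/
def tribInv : ℚ := 543689012692076 / 10 ^ 15

lemma trib_estimates : ∀ N ∈ Finset.Icc 13 27,
    ∑ k ∈ Finset.range (N - 4), (trib N * tribInv ^ k - trib (N - k)) ^ 2 ≤ 1185 / 100000 ∧
    384795 / 100000 ≤ trib N * tribInv ^ (N - 4) ∧ trib N * tribInv ^ (N - 4) ≤ 38480 / 10000 := by
  decide +kernel

lemma exists_trib {y : ℝ} (h0 : 75 / 10 ^ 9 ≤ y) (h1 : 927 * y ≤ 6478 / 10000) :
    ∃ N ∈ Finset.Icc 13 27, 352 / 1000 ≤ trib N * y ∧ trib N * y ≤ 6478 / 10000 := by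
  by_contra! h
  have step : ∀ N ∈ Finset.Icc 13 27, trib N * y ≤ 6478 / 10000 := fun N hN => by
    obtain ⟨ha, hb⟩ := Finset.mem_Icc.1 hN
    clear hN
    induction N, ha using Nat.le_induction with
    | base => simpa [trib] using h1
    | succ N ha ih =>
      have ih := ih (by omega)
      by_contra! hc
      have h2 := h N (Finset.mem_Icc.2 ⟨ha, by omega⟩)
      have h3 : ((trib (N + 1) : ℕ) : ℝ) * 352 ≤ trib N * 647.8 := by
        have : ∀ N ∈ Finset.Icc 13 26, trib (N + 1) * 3520 ≤ trib N * 6478 := by decide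
        have := this N (Finset.mem_Icc.2 ⟨ha, by omega⟩)
        have : ((trib (N + 1) * 3520 : ℕ) : ℝ) ≤ (trib N * 6478 : ℕ) := by exact_mod_cast this
        push_cast at this
        linarith
      by_cases h4 : 352 / 1000 ≤ trib N * y
      · linarith [h2 h4]
      · have hy : 0 < y := by linarith
        nlinarith
  have h2 := step 27 (by decide)
  have h3 := h 27 (by decide)
  simp only [trib] at h2 h3
  norm_num at h2 h3
  linarith [h3 (by linarith)]

lemma abs_cos_int_ge {x : ℝ} (n : ℤ) {a : ℝ} (h : |x - n| ≤ a) :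
    1 - (3.1416 * a) ^ 2 / 2 ≤ |Real.cos (Real.pi * x)| := by
  have h1 := Real.one_sub_sq_div_two_le_cos (x := Real.pi * (x - n))
  have h2 : |Real.cos (Real.pi * (x - n))| = |Real.cos (Real.pi * x)| := by
    rw [mul_sub, mul_comm _ (n : ℝ), Real.cos_sub_int_mul_pi, abs_mul]
    simp [abs_zpow]
  rw [← h2]
  refine le_trans ?_ (le_abs_self _)
  refine le_trans ?_ h1
  have h3 : (Real.pi * (x - n)) ^ 2 ≤ (3.1416 * a) ^ 2 := by
    rw [← sq_abs, abs_mul, abs_of_pos Real.pi_pos]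
    have := Real.pi_lt_d4
    gcongr
  linarith

lemma abs_cos_half_ge {x a : ℝ} (ha : 0 < a) (ha1 : a ≤ 3 / 10) (h : a ≤ |x - 1 / 2|)
    (h2 : |x - 1 / 2| ≤ 1 / 2) :
    3.1415 * a - (3.1415 * a) ^ 3 / 6 ≤ |Real.cos (Real.pi * x)| := by
  have h1 : |Real.cos (Real.pi * x)| = Real.sin (Real.pi * |x - 1 / 2|) := by
    have e : Real.pi * x = Real.pi * (x - 1 / 2) + Real.pi / 2 := by ring
    have hpi := Real.pi_pos
    rw [e, Real.cos_add_pi_div_two, abs_neg, Real.abs_sin_eq_sin_abs_of_abs_le_pi, abs_mul,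
      abs_of_pos hpi]
    rw [abs_mul, abs_of_pos hpi]
    nlinarith
  rw [h1]
  have h3 := Real.pi_gt_d4
  have h4 : 3.1415 * a ≤ Real.pi * |x - 1 / 2| := by
    have : 0 ≤ |x - 1 / 2| := abs_nonneg _
    nlinarith
  refine (Real.sin_gt_sub_cube (x := 3.1415 * a) (by positivity)).le.trans ?_
  refine Real.sin_le_sin_of_le_of_le_pi_div_two (by linarith) ?_ h4
  nlinarith

lemma one_sub_sq_le_prod_cos {b : ℝ} (hb : 0 ≤ b) (hb1 : b < 1) (n : ℕ) (z : ℝ) :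
    1 - z ^ 2 / (1 - b ^ 2) / 2 ≤ ((geo b n z).map Real.cos).prod := by
  have h1 := signAvg_cos (geo b n z) 0
  rw [Real.cos_zero, one_mul] at h1
  rw [← h1]
  have h2 := signAvg_mono (geo b n z) (F := fun x => 1 + -1 / 2 * (x + 0) ^ 2)
    fun x => (by linarith [Real.one_sub_sq_div_two_le_cos (x := x + 0)] :
      1 + -1 / 2 * (x + 0) ^ 2 ≤ Real.cos (x + 0))
  rw [signAvg_add, signAvg_const, signAvg_mul, signAvg_sq] at h2
  linarith [sum_sq_geo_le hb hb1 n z]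

lemma prod_cos_ge {b τ : ℝ} (hb0 : 0.543668 ≤ b) (hb1 : b ≤ 0.54371) (h0 : 3.8466 ≤ τ)
    (h1 : τ ≤ 3.8494) (R : ℕ) :
    0.106 ≤ |((geo b (7 + R) (Real.pi * τ)).map Real.cos).prod| := by
  have p : ∀ j : ℕ, 3.8466 * 0.543668 ^ j ≤ τ * b ^ j ∧ τ * b ^ j ≤ 3.8494 * 0.54371 ^ j := fun j =>
    ⟨by gcongr, by gcongr⟩
  have c0 := abs_cos_int_ge (x := τ * b ^ 0) 4 (a := 0.1534)
    (by have := p 0; rw [abs_le]; constructor <;> norm_num at this ⊢ <;> linarith)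
  have c1 := abs_cos_int_ge (x := τ * b ^ 1) 2 (a := 0.09296)
    (by have := p 1; rw [abs_le]; constructor <;> norm_num at this ⊢ <;> linarith)
  have c2 := abs_cos_int_ge (x := τ * b ^ 2) 1 (a := 0.13797)
    (by have := p 2; rw [abs_le]; constructor <;> norm_num at this ⊢ <;> linarith)
  have c3 := abs_cos_half_ge (x := τ * b ^ 3) (a := 0.1181) (by norm_num) (by norm_num)
    (by have := p 3; rw [le_abs]; left; norm_num at this ⊢; linarith)
    (by have := p 3; rw [abs_le]; constructor <;> norm_num at this ⊢ <;> linarith)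
  have c4 := abs_cos_half_ge (x := τ * b ^ 4) (a := 0.16359) (by norm_num) (by norm_num)
    (by have := p 4; rw [le_abs]; right; norm_num at this ⊢; linarith)
    (by have := p 4; rw [abs_le]; constructor <;> norm_num at this ⊢ <;> linarith)
  have c5 := abs_cos_int_ge (x := τ * b ^ 5) 0 (a := 0.18291)
    (by have := p 5; rw [abs_le]; constructor <;> norm_num at this ⊢ <;> linarith)
  have c6 := abs_cos_int_ge (x := τ * b ^ 6) 0 (a := 0.09945)
    (by have := p 6; rw [abs_le]; constructor <;> norm_num at this ⊢ <;> linarith)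
  have c7 : 0.9795 ≤ ((geo b R (Real.pi * (τ * b ^ 7))).map Real.cos).prod := by
    refine le_trans ?_ (one_sub_sq_le_prod_cos (by linarith) (by linarith) _ _)
    have h2 : Real.pi * (τ * b ^ 7) ≤ 3.1416 * 0.05408 := by
      have := p 7
      have h3 := Real.pi_lt_d4
      gcongr
      norm_num at this ⊢
      linarith
    have h3 : (Real.pi * (τ * b ^ 7)) ^ 2 ≤ (3.1416 * 0.05408) ^ 2 := by
      have := Real.pi_pos
      gcongr
    have h4 : (0.7043 : ℝ) ≤ 1 - b ^ 2 := by nlinarith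
    have h5 : (Real.pi * (τ * b ^ 7)) ^ 2 / (1 - b ^ 2) ≤ (3.1416 * 0.05408) ^ 2 / 0.7043 := by
      gcongr
    norm_num at h5 ⊢
    linarith
  have e : geo b (7 + R) (Real.pi * τ) = (List.range 7).map (fun k => Real.pi * (τ * b ^ k))
      ++ geo b R (Real.pi * (τ * b ^ 7)) := by
    rw [geo_add, geo_eq_map]
    simp only [mul_assoc]
  rw [e, List.map_append, List.prod_append, abs_mul]
  simp only [List.range_succ, List.range_zero, List.map_append, List.map_cons, List.map_nil,
    List.nil_append, List.prod_append, List.prod_cons, List.prod_nil, mul_one, abs_mul]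
  have h7 := c7.trans (le_abs_self _)
  calc (0.106 : ℝ) ≤ 0.8838 * 0.9573 * 0.906 * 0.3624 * 0.4912 * 0.8348 * 0.9511 * 0.9795 := by norm_num
    _ ≤ _ := by
      norm_num at c0 c1 c2 c3 c4 c5 c6
      gcongr
      all_goals norm_num
      all_goals linarith

lemma tribonacci_bounds {x : ℝ} (h1 : 1 < x) (h : x ^ 3 = x ^ 2 + x + 1) :
    1.83928675521416 < x ∧ x < 1.83928675521417 := by
  constructor
  · by_contra! hc
    nlinarith [mul_nonneg (sub_nonneg.2 hc) (sub_nonneg.2 h1.le), mul_nonneg (mul_nonneg (sub_nonneg.2 hc) (sub_nonneg.2 h1.le)) (sub_nonneg.2 h1.le)]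
  · by_contra! hc
    nlinarith [mul_nonneg (sub_nonneg.2 hc) (sub_nonneg.2 h1.le), mul_nonneg (mul_nonneg (sub_nonneg.2 hc) (sub_nonneg.2 h1.le)) (sub_nonneg.2 h1.le)]

lemma derivative_sum_le : ∀ m ∈ Finset.Icc 9 23,
    ∑ k ∈ Finset.range m, (k * (54372 / 100000 : ℚ) ^ (k - 1)) ^ 2 ≤ 372 / 100 ∧
    m * (54372 / 100000 : ℚ) ^ (m - 1) ≤ 688 / 10000 := by
  decide +kernel

lemma frequencies_near {T b : ℝ} (hT : 0 ≤ T) (hb0 : 0 ≤ b) (hb : b ≤ 0.54372)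
    (hD : T * |b - (tribInv : ℚ)| ≤ 0.01905) (k : ℕ) :
    |T * b ^ k - T * (tribInv : ℚ) ^ k| ≤ 0.01905 * (k * (0.54372 : ℝ) ^ (k - 1)) := by
  have ht0 : (0 : ℝ) ≤ (tribInv : ℚ) := by norm_num [tribInv]
  have ht1 : ((tribInv : ℚ) : ℝ) ≤ 0.54372 := by norm_num [tribInv]
  have h1 := abs_pow_sub_pow_le b ((tribInv : ℚ) : ℝ) k
  have h2 : max |b| |((tribInv : ℚ) : ℝ)| ^ (k - 1) ≤ 0.54372 ^ (k - 1) := by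
    refine pow_le_pow_left₀ (le_max_of_le_left (abs_nonneg _)) ?_ _
    rw [abs_of_nonneg hb0, abs_of_nonneg ht0]
    exact max_le hb ht1
  rw [← mul_sub, abs_mul, abs_of_nonneg hT]
  calc T * |b ^ k - (tribInv : ℚ) ^ k|
      ≤ T * (|b - (tribInv : ℚ)| * k * max |b| |((tribInv : ℚ) : ℝ)| ^ (k - 1)) := by gcongr
    _ ≤ T * (|b - (tribInv : ℚ)| * k * 0.54372 ^ (k - 1)) := by gcongr
    _ = T * |b - (tribInv : ℚ)| * (k * (0.54372 : ℝ) ^ (k - 1)) := by ring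
    _ ≤ _ := by gcongr

lemma frequency_sum_le {N : ℕ} (hN : N ∈ Finset.Icc 13 27) {b : ℝ} (hb0 : 0 ≤ b)
    (hb : b ≤ 0.54372) (hD : trib N * |b - (tribInv : ℚ)| ≤ 0.01905) :
    ∑ k ∈ Finset.range (N - 4), (trib N * b ^ k - trib (N - k)) ^ 2 ≤ 0.0212 ∧
      3.8466 ≤ trib N * b ^ (N - 4) ∧ trib N * b ^ (N - 4) ≤ 3.8494 := by
  obtain ⟨e1, e2, e3⟩ := trib_estimates N hN
  have hm : N - 4 ∈ Finset.Icc 9 23 := by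
    rw [Finset.mem_Icc] at hN ⊢
    omega
  obtain ⟨d1, d2⟩ := derivative_sum_le (N - 4) hm
  have hd := frequencies_near (by positivity) hb0 hb hD
  have e1' : ((∑ k ∈ Finset.range (N - 4), (trib N * tribInv ^ k - trib (N - k)) ^ 2 : ℚ) : ℝ)
      ≤ (1185 / 100000 : ℚ) := by exact_mod_cast e1
  have e2' : ((384795 / 100000 : ℚ) : ℝ) ≤ (trib N * tribInv ^ (N - 4) : ℚ) := by exact_mod_cast e2
  have e3' : ((trib N * tribInv ^ (N - 4) : ℚ) : ℝ) ≤ (38480 / 10000 : ℚ) := by exact_mod_cast e3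
  have d1' : ((∑ k ∈ Finset.range (N - 4), (k * (54372 / 100000 : ℚ) ^ (k - 1)) ^ 2 : ℚ) : ℝ)
      ≤ (372 / 100 : ℚ) := by exact_mod_cast d1
  have d2' : ((((N - 4 : ℕ) : ℚ) * (54372 / 100000 : ℚ) ^ (N - 4 - 1) : ℚ) : ℝ)
      ≤ (688 / 10000 : ℚ) := by exact_mod_cast d2
  push_cast at e1' e2' e3' d1' d2'
  refine ⟨?_, ?_⟩
  · have : ∀ k ∈ Finset.range (N - 4), ((trib N : ℝ) * b ^ k - trib (N - k)) ^ 2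
        ≤ 4 / 3 * (trib N * (tribInv : ℝ) ^ k - trib (N - k)) ^ 2
          + 4 * 0.01905 ^ 2 * (k * (54372 / 100000 : ℝ) ^ (k - 1)) ^ 2 := fun k _ => by
      have h1 := hd k
      rw [show (0.54372 : ℝ) = 54372 / 100000 by norm_num] at h1
      have h2 := pow_le_pow_left₀ (abs_nonneg _) h1 2
      rw [sq_abs] at h2
      set u := (trib N : ℝ) * (tribInv : ℝ) ^ k - trib (N - k)
      set v := (trib N : ℝ) * b ^ k - trib N * (tribInv : ℝ) ^ k
      have : (trib N : ℝ) * b ^ k - trib (N - k) = u + v := by ring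
      rw [this]
      nlinarith [sq_nonneg (u - 3 * v)]
    refine (Finset.sum_le_sum this).trans ?_
    rw [Finset.sum_add_distrib, ← Finset.mul_sum, ← Finset.mul_sum]
    linarith
  · have h1 := abs_le.1 (hd (N - 4))
    rw [show (0.54372 : ℝ) = 54372 / 100000 by norm_num] at h1
    constructor <;> linarith [h1.1, h1.2]

lemma le_abs_sin_pi_mul {u : ℝ} (h0 : 0.352 ≤ |u|) (h1 : |u| ≤ 0.6478) :
    0.89 ≤ |Real.sin (Real.pi * u)| := by
  have h2 := Real.one_sub_sq_div_two_le_cos (x := Real.pi / 2 - Real.pi * |u|)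
  rw [Real.cos_pi_div_two_sub] at h2
  have h3 : |Real.sin (Real.pi * u)| = |Real.sin (Real.pi * |u|)| := by
    rcases abs_choice u with h | h <;> rw [h]
    rw [mul_neg, Real.sin_neg, abs_neg]
  rw [h3]
  refine le_trans ?_ (le_abs_self _)
  have h4 : |Real.pi / 2 - Real.pi * abs u| ≤ 0.465 := by
    have e : Real.pi / 2 - Real.pi * |u| = Real.pi * (1 / 2 - |u|) := by ring
    rw [e, abs_mul, abs_of_pos Real.pi_pos]
    have h5 : |1 / 2 - abs u| ≤ 0.148 := by
      rw [abs_le]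
      constructor <;> linarith
    have := Real.pi_lt_d4
    calc Real.pi * |1 / 2 - abs u| ≤ 3.1416 * 0.148 := by gcongr
      _ ≤ _ := by norm_num
  have h5 := pow_le_pow_left₀ (abs_nonneg _) h4 2
  rw [sq_abs] at h5
  linarith

lemma near_estimates {β x : ℝ} (hx1 : 1.83928675521416 < x) (hx2 : x < 1.83928675521417)
    (hx : x ^ 3 = x ^ 2 + x + 1) (h0 : 1 / 100000000 ≤ |β - x|) (h1 : |β - x| ≤ 0.000069) :
    0.543668 ≤ β⁻¹ ∧ β⁻¹ ≤ 0.54371 ∧ 1.839217 ≤ β ∧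
    |β * (β ^ 3 - β ^ 2 - β - 1)| ≤ 0.000695 ∧
    ∃ N ∈ Finset.Icc 13 27, 0.352 ≤ |trib N * (β * (β ^ 3 - β ^ 2 - β - 1))| ∧
      |trib N * (β * (β ^ 3 - β ^ 2 - β - 1))| ≤ 0.6478 ∧
      trib N * |β⁻¹ - (tribInv : ℚ)| ≤ 0.01905 := by
  obtain ⟨ha, hb⟩ := abs_le.1 h1
  have hβ0 : 1.839217 ≤ β := by linarith
  have hβ1 : β ≤ 1.839356 := by linarith
  have hβp : 0 < β := by linarith
  set Q := β ^ 2 + (x - 1) * β + x ^ 2 - x - 1 with hQ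
  have hQ0 : 5.469 ≤ Q := by nlinarith
  have hQ1 : Q ≤ 5.471 := by nlinarith
  have e : β * (β ^ 3 - β ^ 2 - β - 1) = β * Q * (β - x) := by
    rw [hQ]
    linear_combination β * hx
  have hQp : 0 < Q := by linarith
  have hy : |β * (β ^ 3 - β ^ 2 - β - 1)| = β * Q * |β - x| := by
    rw [e, abs_mul, abs_of_pos (by positivity)]
  have hy0 : 75 / 10 ^ 9 ≤ |β * (β ^ 3 - β ^ 2 - β - 1)| := by
    rw [hy]
    calc (75 / 10 ^ 9 : ℝ) ≤ 1.839217 * 5.469 * (1 / 100000000) := by norm_num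
      _ ≤ _ := by gcongr
  have hy1 : |β * (β ^ 3 - β ^ 2 - β - 1)| ≤ 0.000695 := by
    rw [hy]
    calc β * Q * |β - x| ≤ 1.839356 * 5.471 * 0.000069 := by gcongr
      _ ≤ _ := by norm_num
  refine ⟨?_, ?_, hβ0, hy1, ?_⟩
  · rw [le_inv_comm₀ (by norm_num) hβp]
    norm_num at hβ1 ⊢
    linarith
  · rw [inv_le_comm₀ hβp (by norm_num)]
    norm_num at hβ0 ⊢
    linarith
  obtain ⟨N, hN, hN0, hN1⟩ := exists_trib hy0 (by linarith)
  refine ⟨N, hN, ?_, ?_, ?_⟩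
  · rw [abs_mul, Nat.abs_cast]; linarith
  · rw [abs_mul, Nat.abs_cast]; linarith
  have hT : (trib N : ℝ) ≤ 4700770 := by
    have : ∀ N ∈ Finset.Icc 13 27, trib N ≤ 4700770 := by decide
    exact_mod_cast this N hN
  have hxp : 0 < x := by linarith
  have h2 : |x⁻¹ - (tribInv : ℚ)| ≤ 1 / 10 ^ 13 := by
    have h3 : x⁻¹ ≤ (1.83928675521416 : ℝ)⁻¹ := by gcongr
    have h4 : (1.83928675521417 : ℝ)⁻¹ ≤ x⁻¹ := by gcongr
    rw [abs_le]
    norm_num [tribInv] at h3 h4 ⊢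
    constructor <;> linarith
  have h3 : |β⁻¹ - x⁻¹| = |β - x| / (β * x) := by
    rw [inv_sub_inv hβp.ne' hxp.ne', abs_div, abs_of_pos (by positivity : 0 < β * x), abs_sub_comm]
  have h4 : trib N * |β - x| ≤ 0.6478 / (1.839217 * 5.469) := by
    rw [le_div_iff₀ (by norm_num)]
    calc trib N * |β - x| * (1.839217 * 5.469) ≤ trib N * |β - x| * (β * Q) := by gcongr
      _ = trib N * |β * (β ^ 3 - β ^ 2 - β - 1)| := by rw [hy]; ring
      _ ≤ _ := by linarith
  calc trib N * |β⁻¹ - (tribInv : ℚ)|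
      ≤ trib N * (|β⁻¹ - x⁻¹| + |x⁻¹ - (tribInv : ℚ)|) := by
        gcongr
        exact abs_sub_le _ _ _
    _ = (trib N * |β - x|) / (β * x) + trib N * |x⁻¹ - (tribInv : ℚ)| := by rw [h3]; ring
    _ ≤ (0.6478 / (1.839217 * 5.469)) / (1.839217 * 1.839286) + 4700770 * (1 / 10 ^ 13) := by
        gcongr
        linarith
    _ ≤ _ := by norm_num

lemma Tuned.mono {β : ℝ} {g g' : ℕ} {core core' H : ℝ} {Φ : ℝ → ℝ} (h : Tuned β g core Φ H)
    (hc : core' ≤ core) (hg : g ≤ g') : Tuned β g' core' Φ H := by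
  refine ⟨h.1, fun s hs => h.2.1 s (hs.trans_le hc), h.2.2.1, h.2.2.2.trans_le ?_⟩
  gcongr

lemma le_abs_signAvg_near {β x : ℝ} (hx1 : 1.83928675521416 < x) (hx2 : x < 1.83928675521417)
    (hx : x ^ 3 = x ^ 2 + x + 1) (h0 : 1 / 100000000 ≤ |β - x|) (h1 : |β - x| ≤ 0.000069) :
    ∃ (ω : ℝ) (K : ℕ), ∀ M, 0.0169 ≤ |signAvg (geo β⁻¹ (K + M) ((1 - β⁻¹) / 2 * β⁻¹ ^ 3))
      fun y => bump 0.05448 (y + ((β - 1) / 2 - (1 - β⁻¹) / 2 - (1 - β⁻¹) / 2 * β⁻¹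
        - (1 - β⁻¹) / 2 * β⁻¹ ^ 2)) * Real.sin (ω * (y + ((β - 1) / 2 - (1 - β⁻¹) / 2
        - (1 - β⁻¹) / 2 * β⁻¹ - (1 - β⁻¹) / 2 * β⁻¹ ^ 2)))| := by
  obtain ⟨hb0, hb1, hβ0, hy, N, hN, hs0, hs1, hD⟩ := near_estimates hx1 hx2 hx h0 h1
  have hβp : 0 < β := by linarith
  obtain ⟨f1, f2, f3⟩ := frequency_sum_le hN (by linarith) (by linarith) hD
  have hκ : (β - 1) / 2 - (1 - β⁻¹) / 2 - (1 - β⁻¹) / 2 * β⁻¹ - (1 - β⁻¹) / 2 * β⁻¹ ^ 2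
      = (1 - β⁻¹) / 2 * β⁻¹ ^ 3 * (β * (β ^ 3 - β ^ 2 - β - 1)) := by
    field_simp
  rw [hκ]
  set y := β * (β ^ 3 - β ^ 2 - β - 1)
  set b := β⁻¹
  set c := (1 - b) / 2 * b ^ 3 with hc
  have hbp : 0 < b := by linarith
  have hcp : 0 < c := by
    have : 0 < 1 - b := by linarith
    positivity
  have hc1 : c ≤ 0.036674 := by
    have h2 : b ^ 3 ≤ 0.54371 ^ 3 := by gcongr
    have h3 : (1 - b) / 2 ≤ (1 - 0.543668) / 2 := by linarith
    calc c ≤ (1 - 0.543668) / 2 * 0.54371 ^ 3 := by rw [hc]; gcongr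
      _ ≤ _ := by norm_num
  have hb2 : 0.704379 ≤ 1 - b ^ 2 := by nlinarith
  have hT : (0 : ℝ) < trib N := by
    rcases (Nat.cast_nonneg (α := ℝ) (trib N)).eq_or_lt with h | h
    · rw [← h] at f2
      norm_num at f2
    · exact h
  refine ⟨Real.pi * trib N / c, N - 4 + 7, fun M => ?_⟩
  have hωc : Real.pi * trib N / c * c = Real.pi * trib N := by field_simp
  have hpi := Real.pi_pos
  have hpi2 : Real.pi ^ 2 ≤ 3.1416 ^ 2 := by
    have := Real.pi_lt_d4
    gcongr
  rw [add_assoc]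
  have hbm : b ^ (N - 4) ≤ 0.54371 ^ 9 := by
    calc b ^ (N - 4) ≤ b ^ 9 := pow_le_pow_of_le_one hbp.le (by linarith) (by
          rw [Finset.mem_Icc] at hN
          omega)
      _ ≤ _ := by gcongr
  refine le_trans ?_ (le_abs_signAvg_bump_sin (V := 0.6434) (F := 3.1416 ^ 2 * 0.0212) (P := 0.106)
    (t := 0.0001815) (σ := 0.89) (by norm_num) (by positivity) hbp.le (by linarith) (N - 4) (7 + M)
    (fun k => (trib (N - k) : ℤ)) ?_ ?_ (by norm_num) ?_ (by norm_num) ?_ (by norm_num) ?_)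
  · rw [abs_mul, abs_of_pos hcp]
    have : c * |y| ≤ 0.036674 * 0.000695 := by gcongr
    have h2 : 2 / 0.05448 * (c * |y|) ≤ 2 / 0.05448 * (0.036674 * 0.000695) := by gcongr
    refine le_trans ?_ (sub_le_sub_left h2 _)
    norm_num
  · rw [div_le_iff₀ (by linarith)]
    have : c ^ 2 ≤ 0.036674 ^ 2 := by gcongr
    norm_num at this ⊢
    linarith
  · rw [hωc]
    have : ∀ k ∈ Finset.range (N - 4), (Real.pi * trib N * b ^ k
        - ((trib (N - k) : ℤ) : ℝ) * Real.pi) ^ 2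
        = Real.pi ^ 2 * (trib N * b ^ k - trib (N - k)) ^ 2 := fun k _ => by push_cast; ring
    rw [Finset.sum_congr rfl this, ← Finset.mul_sum]
    gcongr
  · rw [hωc, mul_assoc]
    exact prod_cos_ge (by linarith) (by linarith) f2 f3 M
  · rw [div_le_iff₀ (by linarith)]
    have : (c * b ^ (N - 4)) ^ 2 ≤ (0.036674 * 0.54371 ^ 9) ^ 2 := by gcongr
    norm_num at this ⊢
    linarith
  · rw [← mul_assoc, hωc, mul_assoc]
    exact le_abs_sin_pi_mul hs0 hs1

lemma signAvg_log_wave_le {r ω ε S : ℝ} (hr : 0 < r) (hε : |ε| ≤ 1 / 21) (l : List ℝ) (κ : ℝ)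
    (hS : S ≤ ε * signAvg l fun y => bump r (y + κ) * Real.sin (ω * (y + κ))) :
    signAvg l (fun y => -Real.log (1 + wave r ω ε (y + κ))) ≤ -S + 11 / 20 * ε ^ 2 := by
  have h := signAvg_mono l (F := fun y => -Real.log (1 + wave r ω ε (y + κ)))
    (G := fun y => -ε * (bump r (y + κ) * Real.sin (ω * (y + κ))) + 11 / 20 * ε ^ 2) fun y => by
      have h1 := neg_log_one_add_le ((abs_wave_le (ω := ω) hr (y + κ)).trans hε)
      have h2 := pow_le_pow_left₀ (abs_nonneg _) (abs_wave_le (ω := ω) (ε := ε) hr (y + κ)) 2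
      rw [sq_abs, sq_abs] at h2
      rw [wave] at h1 h2 ⊢
      linarith
  rw [signAvg_add, signAvg_const, signAvg_mul] at h
  linarith

lemma le_of_near {β b : ℝ} (hb0 : 0.543668 ≤ b) (hb1 : b ≤ 0.54371) (hβ : 1.839217 ≤ β) :
    0.05448 ≤ (β - 1) / 2 - (1 - b) / 2 - (1 - b) / 2 * b + (1 - b) / 2 * b ^ 2
      - (1 - b) / 2 * b ^ 3 / (1 - b) := by
  have hb2 : b ^ 2 - b ^ 3 ≥ 0.543668 ^ 2 - 0.543668 ^ 3 := by
    nlinarith [mul_nonneg (sub_nonneg.2 hb0) (sub_nonneg.2 hb1),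
      mul_nonneg (sub_nonneg.2 hb0) (sub_nonneg.2 hb0)]
  have h2 : 1 - b ≠ 0 := by linarith
  have : (1 - b) / 2 * b ^ 3 / (1 - b) = b ^ 3 / 2 := by
    field_simp
  rw [this]
  norm_num at hb2 ⊢
  linarith

lemma Tuned.dimBound_of_near {m : Measure (ℕ → Fin 2)} (hm : IsCoinMeasure m) {β x : ℝ} {g : ℕ}
    {core H : ℝ} {Φ : ℝ → ℝ} (hT : Tuned β g core Φ H) (hg : g ≤ 671088640000)
    (hcore : 0.05448 ≤ core) (hx1 : 1 < x)
    (hx : x ^ 3 = x ^ 2 + x + 1) (h0 : 1 / 100000000 ≤ |β - x|) (h1 : |β - x| ≤ 0.000069) :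
    DimBound m β := by
  obtain ⟨hx1, hx2⟩ := tribonacci_bounds hx1 hx
  obtain ⟨hb0, hb1, hβ0, -, -⟩ := near_estimates hx1 hx2 hx h0 h1
  obtain ⟨ω, K, hω⟩ := le_abs_signAvg_near hx1 hx2 hx h0 h1
  replace hT := hT.mono hcore hg
  have hr : (0 : ℝ) < 0.05448 := by norm_num
  have hβ : 1 < β := by linarith
  set κ := (β - 1) / 2 - (1 - β⁻¹) / 2 - (1 - β⁻¹) / 2 * β⁻¹ - (1 - β⁻¹) / 2 * β⁻¹ ^ 2 with hκ
  obtain ⟨ε, hε, hf⟩ : ∃ ε : ℝ, |ε| = 0.01537 ∧ ∃ᶠ M in atTop, 0.01537 * 0.0169 ≤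
      ε * signAvg (geo β⁻¹ (K + M) ((1 - β⁻¹) / 2 * β⁻¹ ^ 3))
        fun y => bump 0.05448 (y + κ) * Real.sin (ω * (y + κ)) := by
    have : ∃ᶠ M in atTop (α := ℕ), _ := Filter.Frequently.of_forall fun M => le_abs.1 (hω M)
    rcases Filter.frequently_or_distrib.1 this with h | h
    · exact ⟨0.01537, by norm_num, h.mono fun M hM => by gcongr⟩
    · refine ⟨-0.01537, by norm_num, h.mono fun M hM => ?_⟩
      rw [neg_mul, ← mul_neg]
      gcongr
  have hε1 : |ε| ≤ 1 / 21 := by rw [hε]; norm_num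
  have hε2 : ε ^ 2 = 0.01537 ^ 2 := by rw [← sq_abs, hε]
  have hC := hT.2.2.1.add hβ (v := fun s => -Real.log (1 + wave 0.05448 ω ε s))
    (uniformContinuous_log_wave hr hε1) (K := 3 + K) (G := 0.0000162) (G' := 0.000016) (hf.mono
      fun M hM => by
        rw [add_assoc, signAvg_three (r := 0.05448) (c := (β - 1) / 2)
          (F := fun s => -Real.log (1 + wave 0.05448 ω ε s)) (fun s hs => by
            rw [wave_eq_zero hr (hs.trans (le_abs_self s)), add_zero, Real.log_one, neg_zero])
          (by linarith) (by linarith) (by linarith) 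
            (le_of_near hb0 hb1 hβ0), ← hκ]
        have := signAvg_log_wave_le (r := 0.05448) hr hε1 _ κ hM
        rw [hε2] at this
        linarith) (by norm_num)
  refine le_liminf_of_costBound hm hβ (fun s => wave_valid hr hε1 hT s) hC (by norm_num) ?_
  have := hT.2.2.2
  norm_num at this ⊢
  linarith

/-- Does the list of groups of windows cover the parameters between `a` and `b`? The entries of a
group are the arguments of `groupOk`, and `c / 100000` bounds the size of the core from below. -/
noncomputable def chainOk (g c : ℕ) : List (ℕ × ℕ × ℕ × ℕ × ℕ × ℕ × ℕ × ℕ × ℕ × ℕ) → ℕ → ℕ → Bool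
  | [], a, b => decide (b ≤ a)
  | (Bc, e, FR, n, J, jz, w, lb, k, B0) :: l, a, b =>
    decide (B0 ≤ a) && decide (0 < k) && decide (c * 2 ^ e ≤ 100000 * (jz * FR)) &&
      groupOk Bc e FR n J jz w B0 lb g k B0 && chainOk g c l (B0 + k * w) b

lemma exists_tuned_of_chainOk {g c : ℕ} {β : ℝ} (hβ2 : β ≤ 2)
    (l : List (ℕ × ℕ × ℕ × ℕ × ℕ × ℕ × ℕ × ℕ × ℕ × ℕ)) :
    ∀ {a b : ℕ}, chainOk g c l a b = true → (a : ℝ) ≤ β * 2 ^ 40 → β * 2 ^ 40 < b →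
      ∃ Φ H, Tuned β g (c / 100000) Φ H := by
  induction l with
  | nil =>
    intro a b h h0 h1
    have : b ≤ a := by simpa [chainOk] using h
    have : (b : ℝ) ≤ a := by exact_mod_cast this
    linarith
  | cons p l ih =>
    obtain ⟨Bc, e, FR, n, J, jz, w, lb, k, B0⟩ := p
    intro a b h h0 h1
    simp only [chainOk, Bool.and_eq_true, decide_eq_true_eq] at h
    obtain ⟨⟨⟨⟨hB0, hk⟩, hc⟩, hG⟩, hl⟩ := h
    rcases le_or_gt (((B0 + k * w : ℕ) : ℝ)) (β * 2 ^ 40) with h2 | h2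
    · exact ih hl h2 h1
    · have hB0' : (B0 : ℝ) ≤ a := by exact_mod_cast hB0
      obtain ⟨Φ, H, hT⟩ := tuned_of_groupOk hG hk hβ2 (hB0'.trans h0) h2.le
      refine ⟨Φ, H, hT.mono ?_ le_rfl⟩
      have hc' : (c : ℝ) * 2 ^ e ≤ 100000 * (jz * FR) := by exact_mod_cast hc
      rw [div_le_div_iff₀ (by norm_num) (by positivity)]
      linarith

lemma chainOk_cons {g c Bc e FR n J jz w lb k B0 a b : ℕ}
    {l : List (ℕ × ℕ × ℕ × ℕ × ℕ × ℕ × ℕ × ℕ × ℕ × ℕ)}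
    (h : (decide (B0 ≤ a) && decide (0 < k) && decide (c * 2 ^ e ≤ 100000 * (jz * FR)) &&
      groupOk Bc e FR n J jz w B0 lb g k B0) = true) (hl : chainOk g c l (B0 + k * w) b = true) :
    chainOk g c ((Bc, e, FR, n, J, jz, w, lb, k, B0) :: l) a b = true := by
  simp only [chainOk, h, hl, Bool.and_self]

lemma chainOk_nil {g c a b : ℕ} (h : b ≤ a) : chainOk g c [] a b = true := by
  simpa [chainOk] using h

set_option maxRecDepth 100000 in
theorem chainOk_lower : chainOk 0 0 [
    (1645134652332, 13, 160, 20, 16, 0, 692060160, 1453625, 24, 1554940339117),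
    (1661744096172, 13, 160, 19, 15, 0, 1174405120, 1498190, 21, 1571549782957),
    (1686406603693, 13, 192, 18, 12, 0, 979957186, 1563500, 24, 1596212290477),
    (1709925576156, 13, 160, 18, 14, 0, 1306525696, 1624849, 24, 1619731262941),
    (1748798385629, 13, 160, 17, 13, 0, 2110783488, 1705271, 16, 1651087879645),
    (1767538535901, 13, 160, 16, 12, 0, 2226126848, 1790199, 20, 1684860415453),
    (1766963916253, 13, 160, 15, 11, 0, 2376073216, 1899595, 16, 1729382952413),
    (1791451940726, 14, 256, 15, 13, 0, 2196137574, 1990800, 12, 1767400123869),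
    (1811792637400, 13, 192, 14, 8, 0, 1749528084, 2052879, 5, 1793753774757),
    (1880669819964, 14, 256, 15, 12, 0, 1210643906, 2073284, 12, 1802501415177),
    (1869642491424, 13, 160, 14, 9, 0, 1476395008, 2106953, 6, 1817029142049),
    (1837913420525, 14, 256, 14, 11, 0, 1232789831, 2127352, 10, 1825887512097),
    (1874293135693, 14, 192, 15, 15, 0, 935665336, 2155575, 5, 1838215410407),
    (1884984416587, 14, 224, 14, 12, 0, 1091609559, 2166237, 15, 1842893737087),
    (1904365037079, 14, 160, 15, 16, 0, 1240465408, 2203338, 24, 1859267880472),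
    (1923237727358, 15, 224, 15, 21, 0, 2258527846, 2269967, 17, 1889039050264),
    (1923675927262, 14, 160, 14, 13, 0, 1379926016, 2354362, 14, 1927434023646),
    (1942994891486, 14, 160, 14, 12, 0, 1190343475, 2396193, 11, 1946752987870),
    (1959846766095, 14, 224, 13, 8, 0, 1769828515, 2424309, 5, 1959846766095),
    (1968695908670, 14, 192, 13, 9, 0, 1494849945, 2443205, 3, 1968695908670),
    (1970549791037, 15, 224, 14, 16, 0, 884914257, 2452748, 2, 1973180458505),
    (1978708383403, 15, 160, 14, 21, 0, 983564287, 2456508, 10, 1974950287019),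
    (1984785929889, 15, 160, 14, 20, 0, 622854144, 2477345, 6, 1984785929889),
    (1987019816200, 16, 256, 15, 25, 0, 531502202, 2485235, 5, 1988523054753),
    (2000199997084, 16, 192, 15, 33, 0, 382017208, 2490837, 11, 1991180565763),
    (2001019899626, 16, 160, 15, 38, 0, 491782143, 2499679, 13, 1995382755051),
    (2007413067485, 16, 160, 15, 37, 0, 316040806, 2513096, 17, 2001775922910),
    (2007148616612, 16, 160, 15, 36, 0, 318347673, 2524338, 10, 2007148616612),
    (2013338570449, 17, 256, 16, 44, 0, 273133076, 2530985, 14, 2010332093342),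
    (2014813623273, 17, 224, 16, 50, 0, 238991441, 2538956, 7, 2014155956406),
    (2015171229626, 17, 224, 16, 49, 0, 238991441, 2542438, 4, 2015828896493),
    (2016784862257, 17, 160, 16, 68, 0, 156866969, 2544427, 3, 2016784862257),
    (2017631272802, 18, 256, 17, 85, 0, 135643791, 2545405, 11, 2017255463164),
    (2019499164141, 18, 256, 17, 84, 0, 136566538, 2548507, 4, 2018747544865),
    (2020421239932, 18, 192, 17, 112, 0, 96196362, 2549641, 2, 2019293811017),
    (2019251322717, 18, 160, 17, 134, 0, 78433484, 2550041, 10, 2019486203741),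
    (2020834253038, 19, 256, 18, 167, 0, 66899148, 2551670, 10, 2020270538581),
    (2020902371852, 19, 256, 18, 166, 0, 68283269, 2552981, 3, 2020902371852),
    (2021248150273, 19, 192, 18, 221, 0, 49136271, 2553406, 2, 2021107221659),
    (2021910137272, 19, 160, 18, 265, 0, 39216742, 2553610, 9, 2021205494201),
    (2021840302107, 20, 256, 19, 331, 0, 33910947, 2554343, 5, 2021558444879),
    (2022080321150, 20, 192, 19, 441, 0, 24395120, 2554694, 4, 2021727999614),
    (2022119181374, 20, 160, 20, 529, 0, 19464192, 2554897, 6, 2021825580094),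
    (2022230094500, 21, 224, 20, 754, 0, 14331412, 2555139, 11, 2021942365246),
    (2022246811418, 21, 160, 21, 1055, 0, 9876275, 2555466, 7, 2022100010778),
    (2022286585215, 22, 256, 21, 1318, 0, 8304721, 2555609, 5, 2022169144703),
    (2022298748692, 22, 192, 22, 1757, 0, 5925765, 2555696, 4, 2022210668308),
    (2022257859470, 23, 256, 22, 2635, 0, 4094689, 2555745, 2, 2022234371368)]
    1554940339117 2022242560746 = true := by
  repeat refine chainOk_cons (by decide +kernel) ?_
  exact chainOk_nil (by decide +kernel)

set_option maxRecDepth 100000 in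
theorem chainOk_near : chainOk 671088640000 5448 [
    (2022347713279, 22, 192, 22, 1757, 1191, 6012272, 2555761, 12, 2022242016819),
    (2022314164083, 22, 224, 21, 1505, 1021, 7115243, 2555910, 12, 2022314164083)]
    2022242016819 2022399546999 = true := by
  repeat refine chainOk_cons (by decide +kernel) ?_
  exact chainOk_nil (by decide +kernel)

set_option maxRecDepth 100000 in
theorem chainOk_upper : chainOk 0 0 [
    (2022427882065, 22, 192, 22, 1755, 0, 9702604, 2556073, 24, 2022392649912),
    (2022584408229, 22, 224, 21, 1503, 0, 27685683, 2556556, 18, 2022625512408),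
    (2023289299926, 19, 256, 18, 164, 0, 109366476, 2557543, 24, 2023101395107),
    (2025162476074, 18, 192, 17, 108, 0, 377015500, 2562981, 24, 2025726190531),
    (2034022943255, 18, 256, 16, 77, 0, 531208601, 2581674, 24, 2034774562531),
    (2049214712327, 17, 192, 16, 48, 0, 780769689, 2607872, 24, 2047523568955),
    (2072274995705, 17, 256, 15, 31, 0, 1497366528, 2646082, 11, 2066262041491),
    (2095134791366, 16, 192, 14, 19, 0, 2224658841, 2679384, 7, 2082733073299),
    (2116344547829, 16, 256, 13, 12, 0, 2011588198, 2710629, 11, 2098305685186),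
    (2141102685476, 15, 160, 13, 8, 0, 2491416576, 2754628, 14, 2120433155364),
    (2171096992240, 15, 224, 12, 3, 0, 7387008204, 2823060, 6, 2155312987428)]
    2022392649912 2199023255552 = true := by
  repeat refine chainOk_cons (by decide +kernel) ?_
  exact chainOk_nil (by decide +kernel)

end BernoulliConv

theorem stmt3 (β₃ : ℝ) (hβ₃1 : 1 < β₃) (hβ₃2 : β₃ < 2)
    (hβ₃ : β₃ ^ 3 = β₃ ^ 2 + β₃ + 1)
    (β : ℝ) (hβ1 : Real.sqrt 2 < β) (hβ2 : β < 2)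
    (hfar : (1 / 100000000 : ℝ) ≤ |β - β₃|)
    (m : Measure (ℕ → Fin 2)) (hm : IsCoinMeasure m) :
    ∀ᵐ x ∂(m.map (piBeta β)),
      (0.9804094 : ℝ) ≤
        liminf (fun r : ℝ =>
          Real.log (((m.map (piBeta β)) (Metric.closedBall x r)).toReal) / Real.log r)
          (𝓝[>] 0) := by
  have h2 : (1.4142135623 : ℝ) < √2 := Real.lt_sqrt_of_sq_lt (by norm_num)
  have hβ : 1 < β := by linarith
  obtain ⟨hx1, hx2⟩ := BernoulliConv.tribonacci_bounds hβ₃1 hβ₃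
  change BernoulliConv.DimBound m β
  have ha : ((1554940339117 : ℕ) : ℝ) ≤ β * 2 ^ 40 := by
    push_cast
    linarith
  rcases lt_or_ge (β * 2 ^ 40) ((2022242560746 : ℕ) : ℝ) with hL | hL
  · obtain ⟨Φ, H, hT⟩ := BernoulliConv.exists_tuned_of_chainOk hβ2.le _
      BernoulliConv.chainOk_lower ha hL
    exact hT.dimBound hm hβ
  rcases lt_or_ge (β * 2 ^ 40) ((2022392649912 : ℕ) : ℝ) with hU | hU
  · obtain ⟨Φ, H, hT⟩ := BernoulliConv.exists_tuned_of_chainOk hβ2.le _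
      BernoulliConv.chainOk_near (le_trans (by norm_num) hL) (hU.trans (by norm_num))
    push_cast at hL hU
    exact hT.dimBound_of_near hm le_rfl (by norm_num) hβ₃1 hβ₃ hfar
      (abs_le.2 ⟨by linarith, by linarith⟩)
  · obtain ⟨Φ, H, hT⟩ := BernoulliConv.exists_tuned_of_chainOk hβ2.le _
      BernoulliConv.chainOk_upper hU (by push_cast; linarith)
    exact hT.dimBound hm hβ
end

section
/- For β > 1, let ν_β be the distribution of the random series ∑_{n=0}^∞ ε_n β^{-n}, where (ε_n) are independent random variables each equal to 0 or 1 with probability 1/2 (i.e. ν_β is the pushforward of the infinite product of the (1/2,1/2) measure on {0,1}^ℕ under x ↦ ∑_{n≥0} x_n β^{-n}). Then for every integer k ≥ 1 there exists a Borel probability measure η on ℝ such that ν_β = ν_{β^k} ∗ η, where ∗ denotes convolution of measures. -/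
open MeasureTheory Filter Topology

/-- `ν_β`: the distribution of the random series `∑_{n≥0} ε_n β^{-n}`, i.e. the pushforward
of the fair-coin product measure under `x ↦ ∑_{n≥0} x_n β^{-n}`. -/
noncomputable def nuBeta (m : Measure (ℕ → Fin 2)) (β : ℝ) : Measure ℝ :=
  m.map (fun x => ∑' n : ℕ, ((x n : ℕ) : ℝ) / β ^ n)

open ProbabilityTheory

/-- The uniform measure on two points. -/
noncomputable def fairCoin : Measure (Fin 2) := (PMF.uniformOfFintype (Fin 2)).toMeasure

instance isProbabilityMeasure_fairCoin : IsProbabilityMeasure fairCoin := by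
  unfold fairCoin; infer_instance

lemma fairCoin_singleton (i : Fin 2) : fairCoin {i} = (2 : ENNReal)⁻¹ := by
  simp [fairCoin]

lemma IsCoinMeasure.eq_infinitePi {m : Measure (ℕ → Fin 2)} (hm : IsCoinMeasure m) :
    m = Measure.infinitePi (fun _ : ℕ => fairCoin) := by
  refine Measure.eq_infinitePi _ fun s t ht => ?_
  rw [← Measure.infinitePi_pi (fun _ : ℕ => fairCoin) fun i _ => ht i]
  obtain ⟨n, hn⟩ : ∃ n, s ⊆ Finset.range n := s.exists_nat_subset_range
  let r : (ℕ → Fin 2) → Fin n → Fin 2 := fun x j => x j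
  have hr : Measurable r := by fun_prop
  have hmap : m.map r = (Measure.infinitePi (fun _ : ℕ => fairCoin)).map r := by
    refine Measure.ext_of_singleton fun w => ?_
    rw [Measure.map_apply hr (measurableSet_singleton w),
      Measure.map_apply hr (measurableSet_singleton w)]
    have h₁ : r ⁻¹' {w} = {x | ∀ j : Fin n, x j.1 = w j} := by
      ext x; simp [r, funext_iff]
    have h₂ : r ⁻¹' {w} = Set.pi (Finset.range n)
        (fun i => if h : i < n then {w ⟨i, h⟩} else Set.univ) := by
      ext x
      simp only [h₁, Set.mem_ofPred_eq, Set.mem_pi, Finset.coe_range, Set.mem_Iio]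
      refine ⟨fun h i hi => by simpa [hi] using h ⟨i, hi⟩, fun h j => by simpa using h j j.2⟩
    rw [h₂, Measure.infinitePi_pi _ fun i _ => MeasurableSet.of_discrete, ← h₂, h₁, hm.2 n w,
      Finset.prod_congr rfl (g := fun _ => (2 : ENNReal)⁻¹)]
    · simp
    · intro i hi
      simp [Finset.mem_range.1 hi, fairCoin_singleton]
  have hst : Set.pi s t = r ⁻¹' {w | ∀ j : Fin n, j.1 ∈ s → w j ∈ t j} := by
    ext x
    refine ⟨fun h j hj => h j hj, fun h i hi => h ⟨i, Finset.mem_range.1 (hn hi)⟩ hi⟩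
  rw [hst, ← Measure.map_apply hr MeasurableSet.of_discrete, hmap,
    Measure.map_apply hr MeasurableSet.of_discrete]

lemma summable_digit_mul {c : ℕ → ℝ} (hc : Summable c) (hc₀ : ∀ n, 0 ≤ c n)
    (x : ℕ → Fin 2) : Summable fun n => ((x n : ℕ) : ℝ) * c n := by
  refine Summable.of_nonneg_of_le (fun n => mul_nonneg (Nat.cast_nonneg _) (hc₀ n))
    (fun n => mul_le_of_le_one_left (hc₀ n) ?_) hc
  exact_mod_cast Nat.le_of_lt_succ (x n).2

lemma measurable_tsum_of_summable {Ω : Type*} {_ : MeasurableSpace Ω} {f : ℕ → Ω → ℝ}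
    (hf : ∀ n, Measurable (f n)) (hs : ∀ ω, Summable fun n => f n ω) :
    Measurable fun ω => ∑' n, f n ω :=
  measurable_of_tendsto_metrizable (f := fun N ω => ∑ n ∈ Finset.range N, f n ω)
    (fun _ => Finset.measurable_fun_sum _ fun n _ => hf n)
    (tendsto_pi_nhds.2 fun ω => (hs ω).hasSum.tendsto_sum_nat)

lemma measurable_tsum_digit_mul {c : ℕ → ℝ} (hc : Summable c) (hc₀ : ∀ n, 0 ≤ c n)
    {S : Set ℕ} (hS : ∀ n ∉ S, c n = 0) :
    @Measurable _ _ (⨆ i ∈ S, MeasurableSpace.comap (fun x : ℕ → Fin 2 => x i) inferInstance) _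
      fun x : ℕ → Fin 2 => ∑' n, ((x n : ℕ) : ℝ) * c n := by
  refine measurable_tsum_of_summable (fun n => ?_) (summable_digit_mul hc hc₀)
  by_cases hn : n ∈ S
  · have hx : @Measurable _ _ (⨆ i ∈ S,
        MeasurableSpace.comap (fun x : ℕ → Fin 2 => x i) inferInstance) _
        fun x : ℕ → Fin 2 => x n :=
      Measurable.of_comap_le (le_iSup₂_of_le n hn le_rfl)
    exact (measurable_of_countable fun i : Fin 2 => ((i : ℕ) : ℝ) * c n).comp hx
  · simp [hS n hn]

lemma indepFun_tsum_digit_mul {c d : ℕ → ℝ} (hc : Summable c) (hc₀ : ∀ n, 0 ≤ c n)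
    (hd : Summable d) (hd₀ : ∀ n, 0 ≤ d n) {S T : Set ℕ} (hST : Disjoint S T)
    (hS : ∀ n ∉ S, c n = 0) (hT : ∀ n ∉ T, d n = 0) :
    IndepFun (fun x : ℕ → Fin 2 => ∑' n, ((x n : ℕ) : ℝ) * c n)
      (fun x : ℕ → Fin 2 => ∑' n, ((x n : ℕ) : ℝ) * d n)
      (Measure.infinitePi (fun _ : ℕ => fairCoin)) := by
  have hX : iIndepFun (fun (i : ℕ) (x : ℕ → Fin 2) => x i)
      (Measure.infinitePi (fun _ : ℕ => fairCoin)) :=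
    iIndepFun_infinitePi (X := fun _ ω => ω) fun _ => measurable_id
  have := indep_iSup_of_disjoint (fun i => (measurable_pi_apply i).comap_le) hX.iIndep hST
  rw [IndepFun_iff_Indep]
  exact indep_of_indep_of_le_left (indep_of_indep_of_le_right this
    (measurable_tsum_digit_mul hd hd₀ hT).comap_le) (measurable_tsum_digit_mul hc hc₀ hS).comap_le

lemma measurable_tsum_digit_mul_pi {c : ℕ → ℝ} (hc : Summable c) (hc₀ : ∀ n, 0 ≤ c n) :
    Measurable fun x : ℕ → Fin 2 => ∑' n, ((x n : ℕ) : ℝ) * c n :=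
  (measurable_tsum_digit_mul hc hc₀ (S := Set.univ) (by simp)).mono
    (iSup₂_le fun i _ => (measurable_pi_apply i).comap_le) le_rfl

lemma nuBeta_eq_map_mul (m : Measure (ℕ → Fin 2)) (β : ℝ) :
    nuBeta m β = m.map (fun x => ∑' n : ℕ, ((x n : ℕ) : ℝ) * β⁻¹ ^ n) := by
  simp [nuBeta, div_eq_mul_inv]

theorem stmt7 (β : ℝ) (hβ : 1 < β) (k : ℕ) (hk : 1 ≤ k)
    (m : Measure (ℕ → Fin 2)) (hm : IsCoinMeasure m) :
    ∃ η : Measure ℝ, IsProbabilityMeasure η ∧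
      nuBeta m β =
        ((nuBeta m (β ^ k)).prod η).map (fun q : ℝ × ℝ => q.1 + q.2) := by
  have hβ₀ : 0 ≤ β⁻¹ := by positivity
  have hsum : Summable fun n : ℕ => β⁻¹ ^ n :=
    summable_geometric_of_lt_one hβ₀ (inv_lt_one_of_one_lt₀ hβ)
  have hnn : ∀ n : ℕ, 0 ≤ β⁻¹ ^ n := fun n => pow_nonneg hβ₀ n
  have hinj : Function.Injective fun n : ℕ => k * n := mul_right_injective₀ (by lia)
  let S : Set ℕ := Set.range fun n : ℕ => k * n
  let c : ℕ → ℝ := S.indicator fun n => β⁻¹ ^ n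
  let d : ℕ → ℝ := Sᶜ.indicator fun n => β⁻¹ ^ n
  have hc : Summable c := hsum.indicator S
  have hd : Summable d := hsum.indicator Sᶜ
  have hc₀ : ∀ n, 0 ≤ c n := Set.indicator_nonneg fun n _ => hnn n
  have hd₀ : ∀ n, 0 ≤ d n := Set.indicator_nonneg fun n _ => hnn n
  have hind := indepFun_tsum_digit_mul hc hc₀ hd hd₀ (S := S) (T := Sᶜ) disjoint_compl_right
    (fun n hn => Set.indicator_of_notMem hn _) (fun n hn => Set.indicator_of_notMem hn _)
  have hcm := measurable_tsum_digit_mul_pi hc hc₀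
  have hdm := measurable_tsum_digit_mul_pi hd hd₀
  have hconv := hind.map_add_eq_map_conv_map hcm hdm
  obtain rfl := hm.eq_infinitePi
  refine ⟨(Measure.infinitePi fun _ : ℕ => fairCoin).map
    fun x => ∑' n, ((x n : ℕ) : ℝ) * d n,
    Measure.isProbabilityMeasure_map hdm.aemeasurable, ?_⟩
  have hmul : nuBeta (Measure.infinitePi fun _ : ℕ => fairCoin) (β ^ k) =
      (Measure.infinitePi fun _ : ℕ => fairCoin).map
        fun x => ∑' n, ((x n : ℕ) : ℝ) * c n := by
    have hpow : Summable fun n : ℕ => (β ^ k)⁻¹ ^ n :=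
      summable_geometric_of_lt_one (by positivity)
        (inv_lt_one_of_one_lt₀ (one_lt_pow₀ hβ (by lia)))
    rw [nuBeta_eq_map_mul]
    conv_lhs => rw [← Measure.map_infinitePi_infinitePi_of_inj
      (P := fun _ : ℕ => fairCoin) hinj]
    rw [Measure.map_map (measurable_tsum_digit_mul_pi hpow fun n => by positivity)
      (by fun_prop)]
    congr 1
    ext x
    rw [← hinj.tsum_eq]
    · refine tsum_congr fun n => ?_
      simp [c, S, pow_mul]
    · refine Function.support_subset_iff'.2 fun n hn => ?_
      simp [c, Set.indicator_of_notMem (show n ∉ S from hn)]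
  rw [hmul]
  refine Eq.trans ?_ hconv
  rw [nuBeta_eq_map_mul]
  congr 1
  ext x
  rw [Pi.add_apply, ← (summable_digit_mul hc hc₀ x).tsum_add (summable_digit_mul hd hd₀ x)]
  refine tsum_congr fun n => ?_
  rw [← mul_add, Set.indicator_self_add_compl_apply]
end
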